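/- Let G be a finite group with a nonabelian minimal normal subgroup N which has no direct factor isomorphic to A_5 or PSL(2,7). Assume there is a complex irreducible character ψ of N that extends to T := Stab_G(ψ), and set a := ψ(1)·|G:T|. Then n_3(G) ≤ n_{3a}(G)·|G:T| + (1/3)·n_a(G)·|G:T|. Moreover, if G = T then n_3(G) ≤ n_{3a}(G). -/

import Mathlib

open Module CategoryTheory

noncomputable section

/-- `χ : G → ℂ` is the character of an irreducible complex representation of `G`
of degree `d`. -/
def IsIrrCharDeg (G : Type) [Group G] (χ : G → ℂ) (d : ℕ) : Prop :=
  ∃ V : FDRep ℂ G, Simple V ∧ χ = FDRep.character V ∧ finrank ℂ V = d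

/-- `χ : G → ℂ` is an irreducible complex character of `G`. -/
def IsIrrChar (G : Type) [Group G] (χ : G → ℂ) : Prop :=
  ∃ d, IsIrrCharDeg G χ d

/-- `n_d(G)`: the number of irreducible complex characters of `G` of degree `d`. -/
def nChars (G : Type) [Group G] (d : ℕ) : ℕ :=
  {χ : G → ℂ | IsIrrCharDeg G χ d}.ncard

/-- The stabilizer (inertia group) in `G` of a function `ψ : N → ℂ` (e.g. a character of the
normal subgroup `N`) under the conjugation action of `G`, i.e. those `g : G` with
`ψ (g n g⁻¹) = ψ n` for all `n ∈ N`. -/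
def charStab {G : Type} [Group G] (N : Subgroup G) [N.Normal] (ψ : ↥N → ℂ) : Subgroup G where
  carrier := {g : G | ∀ n : N, ψ (MulAut.conjNormal g n) = ψ n}
  one_mem' := by
    intro n
    simp
  mul_mem' := by
    intro a b ha hb n
    rw [map_mul, MulAut.mul_apply, ha, hb]
  inv_mem' := by
    intro a ha n
    have h := ha (MulAut.conjNormal a⁻¹ n)
    rw [map_inv]
    rw [map_inv, ← MulAut.mul_apply, mul_inv_cancel, MulAut.one_apply] at h
    exact h.symm

/-- The character `ψ` of the subgroup `N` extends to the subgroup `T` (so `N ≤ T`), with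
extension `χ`: the restriction of `χ` to `N` equals `ψ`. -/
def ExtendsToChar {G : Type} [Group G] (N T : Subgroup G) (ψ : ↥N → ℂ) (χ : ↥T → ℂ) : Prop :=
  ∃ hle : N ≤ T, ∀ n : ↥N, χ (Subgroup.inclusion hle n) = ψ n

/-- `PSL(2,7)`: the projective special linear group of degree 2 over the field with 7
elements. -/
abbrev PSL27 : Type :=
  Matrix.SpecialLinearGroup (Fin 2) (ZMod 7) ⧸
    Subgroup.center (Matrix.SpecialLinearGroup (Fin 2) (ZMod 7))

set_option linter.unusedSectionVars false


structure Setup (N : Type) [Group N] [Fintype N] (χ : N → ℂ) : Prop where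
  perf : commutator N = ⊤
  nontriv : Nontrivial N
  tor : ∀ g : N, g ^ 2 ≠ 1 → ∃ l : Fin 3 → (Subgroup.centralizer {g} →* ℂ),
    (∀ d : Subgroup.centralizer {g}, χ (d : N) = ∑ i, l i d) ∧
    (∀ i j, l i ⟨g, Subgroup.mem_centralizer_singleton_iff.2 rfl⟩ =
      l j ⟨g, Subgroup.mem_centralizer_singleton_iff.2 rfl⟩ → i = j) ∧
    (∀ d, ∏ i, l i d = 1) ∧ (∀ d, (∀ i, l i d = 1) → d = 1)
  inv : ∀ g : N, g ≠ 1 → g ^ 2 = 1 → χ g = -1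
  one : χ 1 = 3
  conj : ∀ x g : N, χ (x * g * x⁻¹) = χ g
  sum : ∑ g, χ g = 0
  norm : ∑ g, χ g * χ g⁻¹ = Fintype.card N
  abel : ∀ K : Subgroup N, K.Normal → (∀ x ∈ K, ∀ y ∈ K, x * y = y * x) → K = ⊥

namespace Setup
variable {N : Type} [Group N] [Fintype N] {χ : N → ℂ}

/-- torus predicate -/
def IsTor (D : Subgroup N) : Prop := ∃ g : N, g ^ 2 ≠ 1 ∧ D = Subgroup.centralizer {g}

theorem comm_of (S : Setup N χ) {g : N} (hg : g ^ 2 ≠ 1) {x y : N}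
    (hx : x ∈ Subgroup.centralizer {g}) (hy : y ∈ Subgroup.centralizer {g}) : x * y = y * x := by
  obtain ⟨l, -, -, -, h⟩ := S.tor g hg
  let X : Subgroup.centralizer {g} := ⟨x, hx⟩
  let Y : Subgroup.centralizer {g} := ⟨y, hy⟩
  have := h (X * Y * X⁻¹ * Y⁻¹) (fun i => by
    have h1 : l i (X * X⁻¹) = 1 := by simp
    have h2 : l i (Y * Y⁻¹) = 1 := by simp
    rw [map_mul] at h1 h2
    rw [map_mul, map_mul, map_mul]
    linear_combination l i Y * l i Y⁻¹ * h1 + h2)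
  have h3 : X * Y = Y * X := by
    rw [mul_inv_eq_one, mul_inv_eq_iff_eq_mul] at this
    exact this
  exact congrArg Subtype.val h3

theorem comm_tor (S : Setup N χ) {D : Subgroup N} (hD : IsTor D) {x y : N}
    (hx : x ∈ D) (hy : y ∈ D) : x * y = y * x := by
  obtain ⟨g, hg, rfl⟩ := hD
  exact S.comm_of hg hx hy

/-- a regular element of a torus determines it -/
theorem tor_eq (S : Setup N χ) {D : Subgroup N} (hD : IsTor D) {x : N} (hx : x ∈ D)
    (hx2 : x ^ 2 ≠ 1) : D = Subgroup.centralizer {x} := by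
  obtain ⟨g, hg, rfl⟩ := hD
  apply le_antisymm
  · intro y hy
    rw [Subgroup.mem_centralizer_singleton_iff]
    exact S.comm_of hg hy hx
  · intro y hy
    rw [Subgroup.mem_centralizer_singleton_iff]
    refine S.comm_of hx2 hy ?_
    rw [Subgroup.mem_centralizer_singleton_iff] at hx ⊢
    exact hx.symm

theorem sum_hom {D : Type} [Group D] [Fintype D] (l : D →* ℂ) (h : l ≠ 1) : ∑ d, l d = 0 := by
  classical
  obtain ⟨a, ha⟩ : ∃ a, l a ≠ 1 := by
    by_contra hc
    push Not at hc
    exact h (MonoidHom.ext hc)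
  have : l a * ∑ d, l d = ∑ d, l d := by
    rw [Finset.mul_sum]
    exact Fintype.sum_equiv (Equiv.mulLeft a) _ _ (fun d => by simp)
  have h2 : (l a - 1) * ∑ d, l d = 0 := by linear_combination this
  exact (mul_eq_zero.1 h2).resolve_left (sub_ne_zero.2 ha)

open Classical in
/-- the torus data, packaged for `D` -/
theorem tor_data (S : Setup N χ) {D : Subgroup N} (hD : IsTor D) :
    ∃ l : Fin 3 → (D →* ℂ), (∀ d : D, χ (d : N) = ∑ i, l i d) ∧ Function.Injective l ∧
      (∀ d, ∏ i, l i d = 1) ∧ (∀ d, (∀ i, l i d = 1) → d = 1) := by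
  obtain ⟨g, hg, rfl⟩ := hD
  obtain ⟨l, h1, h2, h3, h4⟩ := S.tor g hg
  exact ⟨l, h1, fun i j hij => h2 i j (by rw [hij]), h3, h4⟩

open Classical in
theorem sum_inner {D : Type} [Group D] [Fintype D] (l m : D →* ℂ) :
    ∑ d, l d * m d⁻¹ = if l = m then (Fintype.card D : ℂ) else 0 := by
  have hm : ∀ d, m d * m d⁻¹ = 1 := fun d => by rw [← map_mul]; simp
  split_ifs with h
  · subst h
    rw [Finset.sum_congr rfl (fun d _ => hm d)]
    simp
  · let k : D →* ℂ := ⟨⟨fun d => l d * m d⁻¹, by simp⟩, fun x y => by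
      simp [mul_inv_rev]; ring⟩
    refine sum_hom k (fun hk => h ?_)
    ext d
    have : l d * m d⁻¹ = 1 := congrArg (fun f : D →* ℂ => f d) hk
    linear_combination m d * this - l d * hm d

theorem tor_norm (S : Setup N χ) {D : Subgroup N} (hD : IsTor D) [Fintype D] :
    ∑ d : D, χ d * χ (d : N)⁻¹ = 3 * Fintype.card D := by
  classical
  obtain ⟨l, h1, h2, h3, h4⟩ := S.tor_data hD
  have : ∀ d : D, χ d * χ (d : N)⁻¹ = ∑ i, ∑ j, l i d * l j d⁻¹ := fun d => by
    rw [h1 d, ← Subgroup.coe_inv, h1 d⁻¹, Finset.sum_mul_sum]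
  simp_rw [this]
  rw [Finset.sum_comm]
  have h5 : ∀ i, ∑ d : D, ∑ j, l i d * l j d⁻¹ = Fintype.card D := fun i => by
    rw [Finset.sum_comm]
    simp_rw [sum_inner, h2.eq_iff]
    simp
  rw [Finset.sum_congr rfl (fun i _ => h5 i)]
  simp

open Classical in
theorem tor_sum {D : Subgroup N} [Fintype D]
    {l : Fin 3 → (D →* ℂ)} (h1 : ∀ d : D, χ (d : N) = ∑ i, l i d) (h2 : Function.Injective l) :
    ∑ d : D, χ d = if (∃ i, l i = 1) then (Fintype.card D : ℂ) else 0 := by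
  have : ∀ i, ∑ d, l i d = if l i = 1 then (Fintype.card D : ℂ) else 0 := fun i => by
    have := sum_inner (l i) 1
    simpa using this
  simp_rw [h1]
  rw [Finset.sum_comm]
  simp_rw [this]
  split_ifs with h
  · obtain ⟨i, hi⟩ := h
    simp_rw [← hi, h2.eq_iff]
    simp
  · push Not at h
    simp [h]

end Setup

namespace Setup
variable {N : Type} [Group N] [Fintype N] {χ : N → ℂ}

open Classical in
theorem split_sum (F : N → ℂ) (hF : ∀ g, g ≠ 1 → g ^ 2 = 1 → F g = 0) (A : Finset N) (h1 : 1 ∈ A) :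
    ∑ g ∈ A, F g = F 1 + ∑ g ∈ A with g ^ 2 ≠ 1, F g := by
  rw [← Finset.add_sum_erase A F h1]
  congr 1
  symm
  apply Finset.sum_subset
  · intro g hg
    simp only [Finset.mem_filter, Finset.mem_erase] at *
    refine ⟨?_, hg.1⟩
    rintro rfl
    simp at hg
  · intro g hg hg'
    simp only [Finset.mem_filter, Finset.mem_erase] at *
    refine hF g hg.1 ?_
    by_contra hc
    exact hg' ⟨hg.2, hc⟩

open Classical in
/-- all tori -/
def tori (N : Type) [Group N] [Fintype N] : Finset (Subgroup N) := Finset.univ.filter IsTor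

theorem mem_tori {D : Subgroup N} : D ∈ tori N ↔ IsTor D := by simp [tori]

open Classical in
theorem sum_dec (S : Setup N χ) (F : N → ℂ) (hF : ∀ g, g ≠ 1 → g ^ 2 = 1 → F g = 0) :
    ∑ g, F g = F 1 + ∑ D ∈ tori N, (∑ d : D, F d - F 1) := by
  rw [split_sum F hF _ (Finset.mem_univ _)]
  congr 1
  rw [← Finset.sum_fiberwise_of_maps_to (t := tori N) (g := fun g => Subgroup.centralizer {g})]
  · refine Finset.sum_congr rfl (fun D hD => ?_)
    rw [mem_tori] at hD
    have : ∑ d : D, F d = ∑ d with d ∈ D, F d := by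
      refine (Finset.sum_subtype _ (fun x => ?_) F).symm
      simp
    rw [this, split_sum F hF ({d | d ∈ D} : Finset N) (by simp [D.one_mem]), add_sub_cancel_left]
    refine Finset.sum_congr ?_ (fun _ _ => rfl)
    ext g
    simp only [Finset.mem_filter, Finset.mem_univ, true_and]
    constructor
    · rintro ⟨h1, rfl⟩
      exact ⟨Subgroup.mem_centralizer_singleton_iff.2 rfl, h1⟩
    · rintro ⟨h1, h2⟩
      exact ⟨h2, (S.tor_eq hD h1 h2).symm⟩
  · intro g hg
    rw [mem_tori]
    exact ⟨g, by simpa using hg, rfl⟩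

open Classical in
/-- `D` has a trivial weight -/
def Zt (χ : N → ℂ) (D : Subgroup N) : Prop := ∑ d : D, χ d ≠ 0

open Classical in
theorem zt_iff {D : Subgroup N} 
    {l : Fin 3 → (D →* ℂ)} (h1 : ∀ d : D, χ (d : N) = ∑ i, l i d) (h2 : Function.Injective l) :
    Zt χ D ↔ ∃ i, l i = 1 := by
  unfold Zt
  rw [tor_sum h1 h2]
  simp

open Classical in
theorem zt_sum (S : Setup N χ) {D : Subgroup N} (hD : IsTor D) :
    ∑ d : D, χ d = if Zt χ D then (Nat.card D : ℂ) else 0 := by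
  obtain ⟨l, h1, h2, h3, h4⟩ := S.tor_data hD
  rw [tor_sum h1 h2, Nat.card_eq_fintype_card]
  simp only [zt_iff h1 h2]

open Classical in
theorem star (S : Setup N χ) : ∑ D ∈ tori N, ((Nat.card D : ℚ) - 4) = -4 := by
  have h := S.sum_dec (fun g => χ g * χ g⁻¹ - 1) (fun g h1 h2 => by
    have : g⁻¹ = g := by rw [inv_eq_iff_mul_eq_one, ← sq, h2]
    rw [this, S.inv g h1 h2]; ring)
  simp only [Finset.sum_sub_distrib, S.norm, inv_one, S.one] at h
  simp only [Finset.sum_const, Finset.card_univ, nsmul_eq_mul, mul_one] at h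
  have h2 : ∀ D ∈ tori N, ∑ d : D, χ d * χ (d : N)⁻¹ = 3 * Nat.card D := fun D hD => by
    rw [S.tor_norm (mem_tori.1 hD), Nat.card_eq_fintype_card]
  rw [Finset.sum_congr rfl h2] at h
  have : ∑ D ∈ tori N, ((Nat.card D : ℂ) - 4) = -4 := by
    simp only [← Nat.card_eq_fintype_card] at h
    rw [← Finset.mul_sum] at h
    rw [Finset.sum_sub_distrib]
    simp only [Finset.sum_const, nsmul_eq_mul] at h ⊢
    linear_combination -h/2
  exact_mod_cast this

open Classical in
theorem star2 (S : Setup N χ) : 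
    ∑ D ∈ tori N, (if Zt χ D then (Nat.card D : ℚ) else 0) = Nat.card N := by
  have h := S.sum_dec (fun g => χ g + 1) (fun g h1 h2 => by
    rw [S.inv g h1 h2]; ring)
  simp only [Finset.sum_add_distrib, Finset.sum_sub_distrib, S.sum, S.one] at h
  rw [Finset.sum_congr rfl (fun D hD => S.zt_sum (mem_tori.1 hD))] at h
  have h3 := S.star
  rw [Finset.sum_sub_distrib] at h3
  have h4 : (∑ D ∈ tori N, (Nat.card D : ℂ)) - ∑ D ∈ tori N, 4 = -4 := by exact_mod_cast h3
  have : ∑ D ∈ tori N, (if Zt χ D then (Nat.card D : ℂ) else 0) = Nat.card N := by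
    simp only [Finset.sum_const, nsmul_eq_mul, Finset.card_univ, ← Nat.card_eq_fintype_card, mul_one] at h h4 ⊢
    linear_combination -h-h4
  exact_mod_cast this
end Setup

namespace Setup
variable {N : Type} [Group N] [Fintype N] {χ : N → ℂ}

/-- conjugate subgroup -/
def cj (n : N) (D : Subgroup N) : Subgroup N := D.map (MulAut.conj n).toMonoidHom

theorem mem_cj {n x : N} {D : Subgroup N} : x ∈ cj n D ↔ n⁻¹ * x * n ∈ D := by
  unfold cj
  rw [Subgroup.mem_map]
  constructor
  · rintro ⟨y, hy, rfl⟩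
    simpa [mul_assoc] using hy
  · intro h
    exact ⟨_, h, by simp [mul_assoc]⟩

theorem cj_cent (n g : N) : cj n (Subgroup.centralizer {g}) = Subgroup.centralizer {n * g * n⁻¹} := by
  ext x
  rw [mem_cj, Subgroup.mem_centralizer_singleton_iff, Subgroup.mem_centralizer_singleton_iff]
  constructor
  · intro h
    have h' := congrArg (fun y => n * y * n⁻¹) h
    simpa [mul_assoc] using h'
  · intro h
    have h' := congrArg (fun y => n⁻¹ * y * n) h
    simpa [mul_assoc] using h'

theorem cj_tor {n : N} {D : Subgroup N} (hD : IsTor D) : IsTor (cj n D) := by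
  obtain ⟨g, hg, rfl⟩ := hD
  refine ⟨n * g * n⁻¹, ?_, cj_cent n g⟩
  rw [conj_pow]
  simpa using hg

/-- the equivalence with a conjugate -/
def cjEquiv (n : N) (D : Subgroup N) : D ≃* cj n D :=
  D.equivMapOfInjective _ (MulAut.conj n).injective

theorem card_cj (n : N) (D : Subgroup N) : Nat.card (cj n D) = Nat.card D :=
  (Nat.card_congr (cjEquiv n D).toEquiv).symm

open Classical in
theorem zt_cj (S : Setup N χ) (n : N) (D : Subgroup N) : Zt χ (cj n D) ↔ Zt χ D := by
  unfold Zt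
  have : ∑ d : D, χ d = ∑ d : cj n D, χ d := by
    refine Fintype.sum_equiv (cjEquiv n D).toEquiv _ _ (fun d => ?_)
    exact (S.conj n d).symm
  rw [this]

open Classical in
/-- conjugacy class of a subgroup -/
def orb (D : Subgroup N) : Finset (Subgroup N) := Finset.univ.image (fun n => cj n D)

theorem mem_orb {D E : Subgroup N} : E ∈ orb D ↔ ∃ n, cj n D = E := by simp [orb]

theorem self_mem_orb (D : Subgroup N) : D ∈ orb D := mem_orb.2 ⟨1, by ext x; simp [mem_cj]⟩

theorem orb_sub {D : Subgroup N} (hD : IsTor D) : orb D ⊆ tori N := by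
  intro E hE
  obtain ⟨n, rfl⟩ := mem_orb.1 hE
  exact mem_tori.2 (cj_tor hD)

theorem orb_card (D : Subgroup N) :
    (orb D).card * Nat.card (Subgroup.normalizer (D : Set N)) = Nat.card N := by
  classical
  letI : MulAction N (Subgroup N) := 
    { smul := fun n D => cj n D
      one_smul := fun D => by change cj 1 D = D; ext x; simp [mem_cj]
      mul_smul := fun a b D => by
        change cj (a * b) D = cj a (cj b D)
        ext x; simp [mem_cj, mul_assoc] }
  have h := MulAction.card_orbit_mul_card_stabilizer_eq_card_group N D
  rw [← Nat.card_eq_fintype_card, ← Nat.card_eq_fintype_card, ← Nat.card_eq_fintype_card] at h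
  rw [← h]
  congr 1
  · rw [Nat.card_eq_card_toFinset (MulAction.orbit N D)]
    congr 1
    ext E
    rw [mem_orb, Set.mem_toFinset]
    rfl
  · congr 2
    ext n
    rw [MulAction.mem_stabilizer_iff, Subgroup.mem_normalizer_iff'']
    change _ ↔ cj n D = D
    rw [SetLike.ext_iff]
    simp only [mem_cj]
    exact forall_congr' fun _ => Iff.comm

theorem orb_trans {D E : Subgroup N} (h : E ∈ orb D) : orb E ⊆ orb D := by
  intro F hF
  obtain ⟨n, rfl⟩ := mem_orb.1 hF
  obtain ⟨m, rfl⟩ := mem_orb.1 h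
  exact mem_orb.2 ⟨n * m, by ext x; simp [mem_cj, mul_assoc]⟩

theorem orb_symm {D E : Subgroup N} (h : E ∈ orb D) : D ∈ orb E := by
  obtain ⟨m, rfl⟩ := mem_orb.1 h
  exact mem_orb.2 ⟨m⁻¹, by ext x; simp [mem_cj, mul_assoc]⟩

theorem orb_cases (D E : Subgroup N) : E ∈ orb D ∨ Disjoint (orb D) (orb E) := by
  classical
  by_cases h : E ∈ orb D
  · exact Or.inl h
  · right
    rw [Finset.disjoint_left]
    intro F h1 h2
    exact h (orb_trans h1 (orb_symm h2))

theorem le_normalizer_tor (D : Subgroup N) : D ≤ Subgroup.normalizer (D : Set N) :=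
  Subgroup.le_normalizer

open Classical in
theorem exists_weyl (S : Setup N χ) {D : Subgroup N} (hD : IsTor D)
    {l : Fin 3 → (D →* ℂ)} (h1 : ∀ d : D, χ (d : N) = ∑ i, l i d) (h2 : Function.Injective l)
    (h4 : ∀ d, (∀ i, l i d = 1) → d = 1) :
    ∃ φ : Subgroup.normalizer (D : Set N) →* Equiv.Perm (Fin 3),
      (∀ n i d, l (φ n i) d = l i (D.normalizerMonoidHom n⁻¹ d)) ∧
      φ.ker = D.subgroupOf (Subgroup.normalizer (D : Set N)) := by
  have key : ∀ (n : Subgroup.normalizer (D : Set N)) (i : Fin 3), ∃ j, 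
      l j = (l i).comp (D.normalizerMonoidHom n⁻¹ : MulAut D).toMonoidHom := by
    intro n i
    by_contra hc
    push Not at hc
    let c : MulAut D := D.normalizerMonoidHom n⁻¹
    let m : Fin 3 → (D →* ℂ) := fun j => (l j).comp c.toMonoidHom
    have e1 : ∑ d : D, χ (d : N) * m i d⁻¹ = 0 := by
      simp_rw [h1, Finset.sum_mul]
      rw [Finset.sum_comm]
      simp_rw [sum_inner]
      refine Finset.sum_eq_zero fun j _ => ?_
      rw [if_neg (hc j)]
    have e3 : ∀ d : D, χ (d : N) = ∑ j, m j d := fun d => by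
      have := h1 (c d)
      have h5 : ((c d : D) : N) = (n : N)⁻¹ * d * n := by
        simp [c]
      rw [h5] at this
      have h6 := S.conj (n : N)⁻¹ d
      rw [inv_inv] at h6
      rw [← h6, this]
      rfl
    have hm : Function.Injective m := by
      intro a b hab
      apply h2
      ext d
      have := congrArg (fun f : D →* ℂ => f (c.symm d)) hab
      simpa [m] using this
    have e2 : ∑ d : D, χ (d : N) * m i d⁻¹ = Fintype.card D := by
      simp_rw [e3, Finset.sum_mul]
      rw [Finset.sum_comm]
      simp_rw [sum_inner, hm.eq_iff]
      simp
    rw [e1] at e2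
    have : Fintype.card D ≠ 0 := Fintype.card_ne_zero
    exact this (by exact_mod_cast e2.symm)
  choose p hp using key
  let φ0 : Subgroup.normalizer (D : Set N) →* Function.End (Fin 3) :=
    { toFun := p
      map_one' := by
        funext i
        apply h2
        rw [hp]
        change _ = l i
        ext d
        simp
      map_mul' := by
        intro a b
        funext i
        apply h2
        change _ = l (p a (p b i))
        rw [hp, hp, hp]
        ext d
        simp [mul_assoc] }
  refine ⟨φ0.toHomPerm, ?_, ?_⟩
  · intro n i d
    change l (p n i) d = _
    rw [hp]
    rfl
  · ext n
    rw [MonoidHom.mem_ker, Subgroup.mem_subgroupOf]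
    constructor
    · intro h
      have h5 : ∀ i, p n i = i := fun i => congrArg (fun f : Equiv.Perm (Fin 3) => f i) h
      obtain ⟨g, hg, hDg⟩ := id hD
      have hgD : g ∈ D := by rw [hDg]; exact Subgroup.mem_centralizer_singleton_iff.2 rfl
      have h6 : (D.normalizerMonoidHom n⁻¹ ⟨g, hgD⟩) * (⟨g, hgD⟩ : D)⁻¹ = 1 := by
        apply h4
        intro i
        have := congrArg (fun f : D →* ℂ => f ⟨g, hgD⟩) (hp n i)
        rw [h5] at this
        change l i ⟨g, hgD⟩ = l i (D.normalizerMonoidHom n⁻¹ ⟨g, hgD⟩) at this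
        rw [map_mul, ← this, ← map_mul]
        simp
      rw [mul_inv_eq_one] at h6
      have h7 := congrArg Subtype.val h6
      simp at h7
      have h9 : ∀ x, x ∈ D ↔ x ∈ Subgroup.centralizer {g} := fun x => by rw [hDg]
      rw [h9, Subgroup.mem_centralizer_singleton_iff]
      have h8 := congrArg (fun y => (n : N) * y) h7
      simpa [mul_assoc] using h8.symm
    · intro h
      apply Equiv.ext
      intro i
      change p n i = i
      apply h2
      rw [hp]
      ext d
      change l i (D.normalizerMonoidHom n⁻¹ d) = l i d
      congr 1
      apply Subtype.ext
      have := S.comm_tor hD h d.2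
      simp [mul_assoc, ← this]

end Setup

namespace Setup
variable {N : Type} [Group N] [Fintype N] {χ : N → ℂ}

theorem weyl_card (S : Setup N χ) {D : Subgroup N} (hD : IsTor D) :
    ∃ w, Nat.card (Subgroup.normalizer (D : Set N)) = w * Nat.card D ∧ w ∣ 6 ∧ 
      (Zt χ D → w ∣ 2) ∧ (∀ g, D = Subgroup.zpowers g → w ≠ 6) := by
  classical
  obtain ⟨l, h1, h2, h3, h4⟩ := S.tor_data hD
  obtain ⟨φ, hφ, hk⟩ := S.exists_weyl hD h1 h2 h4
  have h6 : Nat.card φ.range ∣ 6 := by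
    have := Subgroup.card_subgroup_dvd_card φ.range
    rwa [Nat.card_perm, Nat.card_fin] at this
  refine ⟨Nat.card φ.range, ?_, h6, ?_, ?_⟩
  · have := Subgroup.card_mul_index φ.ker
    rw [Subgroup.index_ker, hk, Nat.card_congr
      (Subgroup.subgroupOfEquivOfLe (le_normalizer_tor D)).toEquiv] at this
    rw [← this, mul_comm]
  · intro hz
    obtain ⟨i, hi⟩ := (zt_iff h1 h2).1 hz
    have hn3 : ¬ 3 ∣ Nat.card φ.range := by
      intro h
      have : Fact (Nat.Prime 3) := ⟨by norm_num⟩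
      obtain ⟨⟨σ, n, rfl⟩, hσ⟩ := exists_prime_orderOf_dvd_card' 3 h
      have hfix : φ n i = i := by
        apply h2
        ext d
        rw [hφ, hi]
        rfl
      have h7 : ∀ (τ : Equiv.Perm (Fin 3)) (i : Fin 3), τ i = i → τ ^ 2 = 1 := by decide
      have h8 := orderOf_dvd_of_pow_eq_one (h7 _ _ hfix)
      rw [← Subgroup.orderOf_coe] at hσ
      simp only at hσ
      rw [hσ] at h8
      norm_num at h8
    have h9 : Nat.card φ.range ≤ 6 := Nat.le_of_dvd (by norm_num) h6
    revert h6 hn3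
    generalize Nat.card φ.range = w at *
    interval_cases w <;> simp
  · intro g hg hw
    have htop : φ.range = ⊤ := by
      apply Subgroup.eq_top_of_card_eq
      rw [hw, Nat.card_perm, Nat.card_fin]
      rfl
    have hcomm : ∀ a b, φ a * φ b = φ b * φ a := by
      intro a b
      have hm : ∀ a : Subgroup.normalizer (D : Set N), ∃ k : ℤ, (a : N) * g * (a : N)⁻¹ = g ^ k := by
        intro a
        have := (Subgroup.mem_normalizer_iff.1 a.2 g).1 (by rw [hg]; exact Subgroup.mem_zpowers g)
        obtain ⟨k, hk⟩ := Subgroup.mem_zpowers_iff.1 (hg.le this)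
        exact ⟨k, hk.symm⟩
      obtain ⟨k, hka⟩ := hm a
      obtain ⟨m, hmb⟩ := hm b
      have hab : (a * b : N) * g * (a * b : N)⁻¹ = (b * a : N) * g * (b * a : N)⁻¹ := by
        have e1 : (a * b : N) * g * (a * b : N)⁻¹ = a * (b * g * (b : N)⁻¹) * (a : N)⁻¹ := by group
        have e2 : (b * a : N) * g * (b * a : N)⁻¹ = b * (a * g * (a : N)⁻¹) * (b : N)⁻¹ := by group
        rw [e1, e2, hka, hmb, ← conj_zpow, ← conj_zpow, hka, hmb, ← zpow_mul, ← zpow_mul, mul_comm]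
      have : φ (b * a)⁻¹ * φ (a * b) = 1 := by
        rw [← map_mul, ← MonoidHom.mem_ker, hk, Subgroup.mem_subgroupOf]
        obtain ⟨g', hg', hDg⟩ := id hD
        have hg'D : g' ∈ D := by rw [hDg]; exact Subgroup.mem_centralizer_singleton_iff.2 rfl
        have h9 : ∀ x, x ∈ D ↔ x ∈ Subgroup.centralizer {g'} := fun x => by rw [hDg]
        rw [h9, Subgroup.mem_centralizer_singleton_iff]
        rw [hg] at hg'D
        obtain ⟨r, rfl⟩ := Subgroup.mem_zpowers_iff.1 hg'D
        have e3 : (((b * a)⁻¹ * (a * b) : Subgroup.normalizer (D : Set N)) : N) * g = 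
            g * (((b * a)⁻¹ * (a * b) : Subgroup.normalizer (D : Set N)) : N) := by
          push_cast
          have h10 := congrArg (fun y => (b * a : N)⁻¹ * y * (a * b : N)) hab
          simpa [mul_assoc] using h10
        exact (Commute.zpow_right (show Commute _ g from e3) r)
      rw [map_inv, inv_mul_eq_one, map_mul, map_mul] at this
      exact this.symm
    have hne : ∃ σ τ : Equiv.Perm (Fin 3), σ * τ ≠ τ * σ := by decide
    obtain ⟨σ, τ, hst⟩ := hne
    obtain ⟨a, rfl⟩ : σ ∈ φ.range := by rw [htop]; trivial
    obtain ⟨b, rfl⟩ : τ ∈ φ.range := by rw [htop]; trivial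
    exact hst (hcomm a b)

theorem orderOf_ge {g : N} (hg : g ^ 2 ≠ 1) : 3 ≤ orderOf g := by
  have h0 := orderOf_pos g
  by_contra hc
  have : orderOf g = 1 ∨ orderOf g = 2 := by omega
  rcases this with h | h
  · rw [orderOf_eq_one_iff] at h; simp [h] at hg
  · exact hg (by rw [← h, pow_orderOf_eq_one])

theorem card_ge {D : Subgroup N} (hD : IsTor D) : 3 ≤ Nat.card D := by
  obtain ⟨g, hg, rfl⟩ := hD
  have h := Subgroup.orderOf_dvd_natCard (Subgroup.centralizer {g}) (x := g) 
    (Subgroup.mem_centralizer_singleton_iff.2 rfl)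
  exact (orderOf_ge hg).trans (Nat.le_of_dvd Nat.card_pos h)

theorem eq_zpowers {D : Subgroup N} {g : N} (hgD : g ∈ D) (hg : g ^ 2 ≠ 1)
    (hc : Nat.card D ∈ ({3, 4, 5, 7} : Set ℕ)) : D = Subgroup.zpowers g ∧ orderOf g = Nat.card D := by
  have h := Subgroup.orderOf_dvd_natCard D hgD
  have h3 := orderOf_ge hg
  have h7 : orderOf g ≤ Nat.card D := Nat.le_of_dvd Nat.card_pos h
  have : orderOf g = Nat.card D := by
    generalize orderOf g = a at *
    generalize Nat.card D = b at *
    simp only [Set.mem_insert_iff, Set.mem_singleton_iff] at hc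
    rcases hc with rfl | rfl | rfl | rfl <;> interval_cases a <;> simp_all
  refine ⟨?_, this⟩
  symm
  apply Subgroup.eq_of_le_of_card_ge
  · rwa [Subgroup.zpowers_le]
  · rw [Nat.card_zpowers, this]

theorem tor_gen {D : Subgroup N} (hD : IsTor D) : ∃ g ∈ D, g ^ 2 ≠ 1 := by
  obtain ⟨g, hg, rfl⟩ := hD
  exact ⟨g, Subgroup.mem_centralizer_singleton_iff.2 rfl, hg⟩

theorem small_z (S : Setup N χ) {D : Subgroup N} (hD : IsTor D) 
    (hc : Nat.card D = 3 ∨ Nat.card D = 4 ∨ Nat.card D = 5) : Zt χ D := by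
  obtain ⟨l, h1, h2, h3, h4⟩ := S.tor_data hD
  obtain ⟨g, hgD, hg⟩ := tor_gen hD
  obtain ⟨hz, ho⟩ := eq_zpowers hgD hg (by rcases hc with h | h | h <;> simp [h])
  rw [zt_iff h1 h2]
  set m := Nat.card D with hm
  have hm0 : NeZero m := ⟨by omega⟩
  have hζ := Complex.isPrimitiveRoot_exp m hm0.1
  set ζ := Complex.exp (2 * Real.pi * Complex.I / m)
  have hgm : (⟨g, hgD⟩ : D) ^ m = 1 := by
    apply Subtype.ext
    simp [← ho, pow_orderOf_eq_one]
  have hgen : ∀ d : D, ∃ k : ℕ, d = (⟨g, hgD⟩ : D) ^ k := by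
    intro d
    obtain ⟨k, hk⟩ := mem_powers_iff_mem_zpowers.2 (hz.le d.2)
    exact ⟨k, Subtype.ext (by simpa using hk.symm)⟩
  have hext : ∀ a b : D →* ℂ, a ⟨g, hgD⟩ = b ⟨g, hgD⟩ → a = b := by
    intro a b hab
    ext d
    obtain ⟨k, rfl⟩ := hgen d
    rw [map_pow, map_pow, hab]
  have hp : ∀ i, ∃ a : Fin m, ζ ^ (a : ℕ) = l i ⟨g, hgD⟩ := by
    intro i
    obtain ⟨k, hk, h⟩ := hζ.eq_pow_of_pow_eq_one (ξ := l i ⟨g, hgD⟩) (by rw [← map_pow, hgm, map_one])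
    exact ⟨⟨k, hk⟩, h⟩
  choose a ha using hp
  have hinj : Function.Injective a := by
    intro i j hij
    apply h2
    apply hext
    rw [← ha, ← ha, hij]
  have hsum : m ∣ (a 0 : ℕ) + a 1 + a 2 := by
    rw [← hζ.pow_eq_one_iff_dvd, pow_add, pow_add, ha, ha, ha]
    have := h3 ⟨g, hgD⟩
    rwa [Fin.prod_univ_three] at this
  have hfin : ∃ i, (a i : ℕ) = 0 := by
    by_contra hcon
    push Not at hcon
    have i1 := hcon 0
    have i2 := hcon 1
    have i3 := hcon 2
    have j1 : (a 0 : ℕ) ≠ a 1 := fun h => by simpa using hinj (Fin.ext h)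
    have j2 : (a 0 : ℕ) ≠ a 2 := fun h => by simpa using hinj (Fin.ext h)
    have j3 : (a 1 : ℕ) ≠ a 2 := fun h => by simpa using hinj (Fin.ext h)
    have k1 := (a 0).2
    have k2 := (a 1).2
    have k3 := (a 2).2
    generalize (a 0 : ℕ) = u at *
    generalize (a 1 : ℕ) = v at *
    generalize (a 2 : ℕ) = w at *
    rcases hc with h | h | h <;> rw [h] at hsum k1 k2 k3 <;> interval_cases u <;> interval_cases v <;> omega
  obtain ⟨i, hi⟩ := hfin
  refine ⟨i, hext _ _ ?_⟩
  rw [← ha, hi]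
  simp

end Setup

namespace Setup
variable {N : Type} [Group N]

theorem perf_comm (hp : commutator N = ⊤) {A : Type*} [Group A] (f : N →* A)
    (h : ∀ x y, f x * f y = f y * f x) (x : N) : f x = 1 := by
  have : commutator N ≤ f.ker := by
    rw [commutator_def, Subgroup.commutator_le]
    intro a _ b _
    rw [MonoidHom.mem_ker, map_commutatorElement, commutatorElement_eq_one_iff_mul_comm]
    exact h a b
  rw [hp] at this
  exact this (Subgroup.mem_top x)

theorem perf_perm3 (hp : commutator N = ⊤) (f : N →* Equiv.Perm (Fin 3)) (x : N) : f x = 1 := by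
  have h1 : ∀ x, Equiv.Perm.sign (f x) = 1 := fun x =>
    perf_comm hp ((Equiv.Perm.sign).comp f) (fun a b => mul_comm _ _) x
  have h2 : ∀ σ τ : Equiv.Perm (Fin 3), Equiv.Perm.sign σ = 1 → Equiv.Perm.sign τ = 1 →
    σ * τ = τ * σ := by decide
  exact perf_comm hp f (fun a b => h2 _ _ (h1 a) (h1 b)) x

theorem perf_perm3' (hp : commutator N = ⊤) {α : Type*} (e : α ≃ Fin 3) (f : N →* Equiv.Perm α)
    (x : N) : f x = 1 := by
  have h := perf_perm3 hp ((e.permCongrHom).toMonoidHom.comp f) x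
  exact (MulEquiv.map_eq_one_iff (e.permCongrHom)).1 h

theorem no_index3 [Finite N] (hp : commutator N = ⊤) (K : Subgroup N) (hK : K.index = 3) : False := by
  have hc : Nat.card (N ⧸ K) = 3 := hK
  let e : (N ⧸ K) ≃ Fin 3 := Finite.equivFinOfCardEq hc
  have h := perf_perm3' hp e (MulAction.toPermHom N (N ⧸ K))
  have : Subsingleton (N ⧸ K) := by
    constructor
    intro a b
    obtain ⟨g, rfl⟩ := MulAction.exists_smul_eq N a b
    have := congrArg (fun f : Equiv.Perm (N ⧸ K) => f a) (h g)
    exact this.symm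
  have := Nat.card_of_subsingleton (α := N ⧸ K) (QuotientGroup.mk 1)
  omega

theorem burnside [Finite N] (hp : commutator N = ⊤) {p : ℕ} [Fact p.Prime] (P : Sylow p N)
    (h : Subgroup.normalizer (P : Set N) ≤ Subgroup.centralizer (P : Set N)) : Nat.card P = 1 := by
  have h1 := MonoidHom.ker_transferSylow_isComplement' P h
  have h2 : (MonoidHom.transferSylow P h).ker = ⊤ := by
    rw [eq_top_iff]
    intro x _
    exact perf_comm hp _ (fun a b => Subtype.ext
      (h (Subgroup.le_normalizer (MonoidHom.transferSylow P h b).2) _ 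
        (MonoidHom.transferSylow P h a).2)) x
  have h3 := h1.card_mul_card
  rw [h2, Subgroup.card_top] at h3
  have : 0 < Nat.card N := Nat.card_pos
  exact Nat.eq_of_mul_eq_mul_left this (by rw [h3, mul_one])

variable [Fintype N] {χ : N → ℂ}

/-- a torus of order `p` is Sylow -/
theorem prime_sylow (S : Setup N χ) {P : Subgroup N} (hP : IsTor P) {p : ℕ} [hp : Fact p.Prime]
    (hp2 : p ≠ 2) (hc : Nat.card P = p) : ∃ Q : Sylow p N, (Q : Subgroup N) = P := by
  have hpg : IsPGroup p P := IsPGroup.of_card (n := 1) (by simpa using hc)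
  obtain ⟨Q, hQ⟩ := hpg.exists_le_sylow
  refine ⟨Q, le_antisymm ?_ hQ⟩
  have : Nontrivial Q := by
    rw [← Finite.one_lt_card_iff_nontrivial]
    have := Subgroup.card_le_of_le hQ
    have := hp.1.one_lt
    have h4 : Nat.card Q = Nat.card (Q : Subgroup N) := rfl
    omega
  have hcen := Q.2.center_nontrivial
  obtain ⟨z, hz⟩ := exists_ne (1 : Subgroup.center Q)
  have hzc := Subgroup.mem_center_iff.1 z.2
  obtain ⟨g, hg, hPg⟩ := id hP
  have hgP : g ∈ P := by rw [hPg]; exact Subgroup.mem_centralizer_singleton_iff.2 rfl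
  have hzP : ((z : Q) : N) ∈ P := by
    rw [hPg, Subgroup.mem_centralizer_singleton_iff]
    exact (congrArg Subtype.val (hzc ⟨g, hQ hgP⟩)).symm
  have hz1 : ((z : Q) : N) ≠ 1 := by
    intro h
    apply hz
    exact Subtype.ext (Subtype.ext h)
  have hz2 : ((z : Q) : N) ^ 2 ≠ 1 := by
    intro h
    have h1 := orderOf_dvd_of_pow_eq_one h
    have h2 := Subgroup.orderOf_dvd_natCard P hzP
    rw [hc] at h2
    rcases (Nat.dvd_prime hp.1).1 h2 with h3 | h3
    · exact hz1 (orderOf_eq_one_iff.1 h3)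
    · rw [h3] at h1
      exact hp2 ((Nat.prime_dvd_prime_iff_eq hp.1 Nat.prime_two).1 h1)
  rw [S.tor_eq hP hzP hz2]
  intro y hy
  rw [Subgroup.mem_centralizer_singleton_iff]
  exact congrArg Subtype.val (hzc ⟨y, hy⟩)

theorem prime_conj (S : Setup N χ) {P D : Subgroup N} (hP : IsTor P) (hD : IsTor D) {p : ℕ} 
    [hp : Fact p.Prime] (hp2 : p ≠ 2) (hc : Nat.card P = p) (hd : p ∣ Nat.card D) : D ∈ orb P := by
  obtain ⟨Q, hQ⟩ := S.prime_sylow hP hp2 hc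
  obtain ⟨x, hx⟩ := exists_prime_orderOf_dvd_card' p hd
  rw [← Subgroup.orderOf_coe] at hx
  have hx2 : (x : N) ^ 2 ≠ 1 := by
    intro h
    have h1 := orderOf_dvd_of_pow_eq_one h
    rw [hx] at h1
    exact hp2 ((Nat.prime_dvd_prime_iff_eq hp.1 Nat.prime_two).1 h1)
  have hpg : IsPGroup p (Subgroup.zpowers (x : N)) := 
    IsPGroup.of_card (n := 1) (by rw [Nat.card_zpowers, hx, pow_one])
  obtain ⟨R, hR⟩ := hpg.exists_le_sylow
  obtain ⟨n, hn⟩ := MulAction.exists_smul_eq N Q R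
  have hRP : (R : Subgroup N) = cj n P := by
    rw [← hn, ← hQ]
    rfl
  have hxP : (x : N) ∈ cj n P := by
    rw [← hRP]
    exact hR (Subgroup.mem_zpowers _)
  rw [mem_orb]
  exact ⟨n, (S.tor_eq (cj_tor hP) hxP hx2).trans (S.tor_eq hD x.2 hx2).symm⟩

theorem prime_weyl (S : Setup N χ) {P : Subgroup N} (hP : IsTor P) {p : ℕ} [hp : Fact p.Prime]
    (hp2 : p ≠ 2) (hc : Nat.card P = p) : 
    Nat.card (Subgroup.normalizer (P : Set N)) ≠ Nat.card P := by
  intro h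
  obtain ⟨Q, hQ⟩ := S.prime_sylow hP hp2 hc
  have h1 : P = Subgroup.normalizer (P : Set N) :=
    Subgroup.eq_of_le_of_card_ge (le_normalizer_tor P) h.le
  have h2 := burnside S.perf Q (by
    have : (Q : Set N) = (P : Set N) := by rw [← hQ]; rfl
    rw [this]
    intro x hx
    have hx := h1.ge hx
    rw [Subgroup.mem_centralizer_iff]
    intro y hy
    exact S.comm_tor hP hy hx)
  have h3 : Nat.card Q = Nat.card (Q : Subgroup N) := rfl
  rw [h3, hQ, hc] at h2
  exact hp.1.one_lt.ne' h2

end Setup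

namespace Setup
variable {N : Type} [Group N] [Fintype N] {χ : N → ℂ}

theorem orb_sum (D : Subgroup N) (F : Subgroup N → ℚ) (hF : ∀ n, F (cj n D) = F D) :
    ∑ E ∈ orb D, F E = (orb D).card * F D := by
  rw [Finset.sum_congr rfl (g := fun _ => F D)]
  · simp
  · intro E hE
    obtain ⟨n, rfl⟩ := mem_orb.1 hE
    exact hF n

theorem orb_q {D : Subgroup N} {w : ℕ}
    (h : Nat.card (Subgroup.normalizer (D : Set N)) = w * Nat.card D) :
    ((orb D).card : ℚ) * (w * Nat.card D) = Nat.card N := by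
  have := orb_card D
  rw [h] at this
  exact_mod_cast this

theorem normal_of_orb {D : Subgroup N} (h : (orb D).card = 1) : D.Normal := by
  rw [Finset.card_eq_one] at h
  obtain ⟨E, hE⟩ := h
  have h1 : ∀ n, cj n D = D := by
    intro n
    have h2 : cj n D ∈ orb D := mem_orb.2 ⟨n, rfl⟩
    have h3 := self_mem_orb D
    rw [hE, Finset.mem_singleton] at h2 h3
    rw [h2, h3]
  constructor
  intro x hx g
  rw [← h1 g, mem_cj]
  simpa [mul_assoc] using hx

theorem not_normal (S : Setup N χ) {D : Subgroup N} (hD : IsTor D) : ¬ D.Normal := by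
  intro h
  have h1 := S.abel D h (fun x hx y hy => S.comm_tor hD hx hy)
  have := card_ge hD
  rw [h1, Subgroup.card_bot] at this
  omega

theorem exists3 (S : Setup N χ) : ∃ P : Subgroup N, IsTor P ∧ Nat.card P = 3 := by
  by_contra hc
  push Not at hc
  have h := S.star
  have : 0 ≤ ∑ D ∈ tori N, ((Nat.card D : ℚ) - 4) := by
    apply Finset.sum_nonneg
    intro D hD
    have h1 := card_ge (mem_tori.1 hD)
    have h2 := hc D (mem_tori.1 hD)
    have : 4 ≤ Nat.card D := by omega
    have : (4 : ℚ) ≤ Nat.card D := by exact_mod_cast this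
    linarith
  linarith

theorem weyl3 (S : Setup N χ) {P : Subgroup N} (hP : IsTor P) (hc : Nat.card P = 3) :
    Nat.card (Subgroup.normalizer (P : Set N)) = 2 * Nat.card P := by
  obtain ⟨w, hw, -, hz, -⟩ := S.weyl_card hP
  have := hz (S.small_z hP (Or.inl hc))
  have hw2 := Nat.le_of_dvd (by norm_num) this
  have : Fact (Nat.Prime 3) := ⟨by norm_num⟩
  have h3 := S.prime_weyl hP (p := 3) (by norm_num) hc
  have : 0 < Nat.card (Subgroup.normalizer (P : Set N)) := Nat.card_pos
  interval_cases w <;> simp_all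

theorem q1 {n c d : ℚ} (h : n ≤ c * (6 * d)) (hc : 0 ≤ c) (hd : 7 ≤ d) : n / 14 ≤ c * (d - 4) := by
  nlinarith
theorem q2 {n c d : ℚ} (h : n ≤ c * (6 * d)) (hc : 0 ≤ c) (hd : 8 ≤ d) : n / 12 ≤ c * (d - 4) := by
  nlinarith
theorem q3 {n c d s : ℚ} (h : c * d = n / 2) (hc : 0 ≤ c) (hd : 7 ≤ d) (hs : 0 ≤ s) 
    (h2 : s = -4 + n / 6 - (n / 2 - c * 4)) : False := by
  nlinarith
theorem q4 {n c d w s : ℚ} (h : c * (w * d) = n) (hn : 0 < n) (hc : 0 ≤ c) (hd : 7 ≤ d)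
    (hw : w = 1 ∨ w = 2) (hs : s = -4 + n / 6) (h2 : c * (d - 4) ≤ s) : False := by
  rcases hw with rfl | rfl <;> nlinarith
theorem q5 {n c d s : ℚ} (h : c * (3 * d) = n) (hn : 0 < n) (hc : 0 ≤ c) (hd : 8 ≤ d)
    (hs : s = -4 + n / 6) (h2 : c * (d - 4) ≤ s) : False := by
  nlinarith

theorem dvd_six {w : ℕ} (h : w ∣ 6) : w = 1 ∨ w = 2 ∨ w = 3 ∨ w = 6 := by
  have := Nat.le_of_dvd (by norm_num) h
  interval_cases w <;> omega

set_option maxHeartbeats 2000000 in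
theorem numerics (S : Setup N χ) :
    (Nat.card N = 60 ∧ ∀ D : Subgroup N, IsTor D → Nat.card D = 3 ∨ Nat.card D = 5) ∨
    (Nat.card N = 168 ∧ ∃ P : Subgroup N, IsTor P ∧ Nat.card P = 7 ∧ 
      Nat.card (Subgroup.normalizer (P : Set N)) = 21) := by
  classical
  obtain ⟨P, hP, hP3⟩ := S.exists3
  have hPw := S.weyl3 hP hP3
  have : Fact (Nat.Prime 3) := ⟨by norm_num⟩
  have h3 : ∀ D : Subgroup N, IsTor D → D ∉ orb P → ¬ 3 ∣ Nat.card D := fun D hD h h' =>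
    h (S.prime_conj hP hD (by norm_num) hP3 h')
  set n : ℚ := ((Nat.card N : ℕ) : ℚ) with hn
  have hn0 : 0 < n := by
    have : 0 < Nat.card N := Nat.card_pos
    rw [hn]
    exact_mod_cast this
  have hoP := orb_q hPw
  rw [hP3] at hoP
  have hoP' : ((orb P).card : ℚ) = n / 6 := by
    push_cast at hoP
    rw [← hn] at hoP
    linarith
  -- second equation
  set F : Subgroup N → ℚ := fun D => if Zt χ D then (Nat.card D : ℚ) else 0 with hF
  have hFc : ∀ D m, F (cj m D) = F D := fun D m => by
    simp only [hF, S.zt_cj, card_cj]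
  have hs2 := S.star2
  have hFP : ∑ D ∈ orb P, F D = n / 2 := by
    rw [orb_sum P F (hFc P), hoP', hF]
    simp only
    rw [if_pos (S.small_z hP (Or.inl hP3)), hP3]
    push_cast
    ring
  have hrest : ∑ D ∈ tori N \ orb P, F D = n / 2 := by
    have := Finset.sum_sdiff (f := F) (orb_sub hP)
    rw [hFP] at this
    linarith
  have hFnn : ∀ D, 0 ≤ F D := fun D => by
    simp only [hF]
    split_ifs <;> positivity
  obtain ⟨Q, hQm, hQF⟩ : ∃ Q ∈ tori N \ orb P, F Q ≠ 0 := by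
    apply Finset.exists_ne_zero_of_sum_ne_zero
    rw [hrest]
    positivity
  rw [Finset.mem_sdiff, mem_tori] at hQm
  obtain ⟨hQ, hQP⟩ := hQm
  have hQz : Zt χ Q := by
    by_contra hc
    apply hQF
    simp only [hF]
    rw [if_neg hc]
  obtain ⟨w, hw, -, hwz, -⟩ := S.weyl_card hQ
  have hw2 := Nat.le_of_dvd (by norm_num) (hwz hQz)
  have horbQ := orb_q hw
  rw [← hn] at horbQ
  have disj : ∀ D E : Subgroup N, E ∉ orb D → Disjoint (orb D) (orb E) := fun D E h =>
    (orb_cases D E).resolve_left h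
  have subs : ∀ D E : Subgroup N, IsTor E → E ∉ orb D → orb E ⊆ tori N \ orb D := 
    fun D E hE h F hF => Finset.mem_sdiff.2 
      ⟨orb_sub hE hF, fun h' => Finset.disjoint_left.1 (disj D E h) h' hF⟩
  have hQsub := subs P Q hQ hQP
  have hFQ : ∑ D ∈ orb Q, F D = (orb Q).card * Nat.card Q := by
    rw [orb_sum Q F (hFc Q)]
    simp only [hF]
    rw [if_pos hQz]
  have hle := Finset.sum_le_sum_of_subset_of_nonneg (f := F) hQsub (fun D _ _ => hFnn D)
  rw [hFQ, hrest] at hle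
  set q : ℚ := ((Nat.card Q : ℕ) : ℚ) with hq
  have hw_eq : w = 2 := by
    have hw0 : w ≠ 0 := by
      rintro rfl
      simp at horbQ
      linarith
    by_contra hne
    have : w = 1 := by omega
    subst this
    push_cast at horbQ
    linarith
  subst hw_eq
  push_cast at horbQ
  have hrestQ : ∀ D, IsTor D → D ∉ orb P → D ∉ orb Q → ¬ Zt χ D := by
    intro D hD h1 h2 hz
    have h4 := Finset.sum_sdiff (f := F) hQsub
    rw [hrest, hFQ] at h4
    have h5 : ∑ D ∈ (tori N \ orb P) \ orb Q, F D = 0 := by linarith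
    rw [Finset.sum_eq_zero_iff_of_nonneg (fun D _ => hFnn D)] at h5
    have h6 := h5 D (by simp [mem_tori, hD, h1, h2])
    simp only [hF] at h6
    rw [if_pos hz] at h6
    have : 0 < Nat.card D := Nat.card_pos
    have : (0 : ℚ) < Nat.card D := by exact_mod_cast this
    linarith
  -- first equation
  set f : Subgroup N → ℚ := fun D => (Nat.card D : ℚ) - 4 with hf
  have hfc : ∀ D m, f (cj m D) = f D := fun D m => by
    simp only [hf, card_cj]
  have hs1 := S.star
  set R := (tori N \ orb P) \ orb Q with hR
  have hRm : ∀ D, D ∈ R ↔ IsTor D ∧ D ∉ orb P ∧ D ∉ orb Q := fun D => by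
    simp [hR, mem_tori, and_assoc]
  have e1 : ∑ D ∈ R, f D = -4 + n / 6 - (orb Q).card * (q - 4) := by
    have h4 := Finset.sum_sdiff (f := f) hQsub
    have h5 := Finset.sum_sdiff (f := f) (orb_sub hP)
    have h6 := orb_sum P f (hfc P)
    have h7 := orb_sum Q f (hfc Q)
    have h8 : f P = -1 := by simp only [hf]; rw [hP3]; norm_num
    rw [h8, hoP'] at h6
    change _ = (orb Q).card * (q - 4) at h7
    linarith
  have hR7 : ∀ D ∈ R, 7 ≤ Nat.card D := by
    intro D hD
    obtain ⟨h1, h2, h4⟩ := (hRm D).1 hD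
    have h5 := card_ge h1
    have h6 := hrestQ D h1 h2 h4
    have h7 : ¬ (Nat.card D = 3 ∨ Nat.card D = 4 ∨ Nat.card D = 5) := fun h => h6 (S.small_z h1 h)
    have h8 := h3 D h1 h2
    omega
  have hRf : ∀ D ∈ R, 0 ≤ f D := by
    intro D hD
    have := hR7 D hD
    have : (7 : ℚ) ≤ Nat.card D := by exact_mod_cast this
    simp only [hf]; linarith
  have hRo : ∀ D ∈ R, orb D ⊆ R := by
    intro D hD E hE
    obtain ⟨h1, h2, h4⟩ := (hRm D).1 hD
    rw [hRm]
    exact ⟨mem_tori.1 (orb_sub h1 hE), fun h => Finset.disjoint_left.1 (disj P D h2) h hE,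
      fun h => Finset.disjoint_left.1 (disj Q D h4) h hE⟩
  have hQ3 := h3 Q hQ hQP
  have hQge := card_ge hQ
  have hqpos : 0 < q := by rw [hq]; exact_mod_cast (by omega : 0 < Nat.card Q)
  -- weyl data on R
  have hRw : ∀ D ∈ R, ∃ w : ℕ, Nat.card (Subgroup.normalizer (D : Set N)) = w * Nat.card D ∧
      (w = 1 ∨ w = 2 ∨ w = 3 ∨ w = 6) ∧ (Nat.card D = 7 → w ≠ 6) ∧ 
      ((orb D).card : ℚ) * (w * Nat.card D) = n := by
    intro D hD
    obtain ⟨h1, h2, h4⟩ := (hRm D).1 hD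
    obtain ⟨w, hw, h6, -, h66⟩ := S.weyl_card h1
    refine ⟨w, hw, ?_, ?_, orb_q hw⟩
    · exact dvd_six h6
    · intro h7
      obtain ⟨g, hgD, hg⟩ := tor_gen h1
      exact h66 g (eq_zpowers hgD hg (by rw [h7]; simp)).1
  have hRle : ∀ D ∈ R, ((orb D).card : ℚ) * (Nat.card D - 4) ≤ ∑ D ∈ R, f D := by
    intro D hD
    rw [← orb_sum D f (hfc D)]
    exact Finset.sum_le_sum_of_subset_of_nonneg (hRo D hD) (fun D hD _ => hRf D hD)
  have hsum0 : 0 ≤ ∑ D ∈ R, f D := Finset.sum_nonneg hRf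
  have hoQ : ((orb Q).card : ℚ) * q = n / 2 := by linarith
  rw [mul_sub, hoQ] at e1
  -- lower bound for an orbit in R
  have hRn : ∀ D ∈ R, n / 14 ≤ ((orb D).card : ℚ) * (Nat.card D - 4) := by
    intro D hD
    obtain ⟨w, -, hw, -, ho⟩ := hRw D hD
    have h7 : (7 : ℚ) ≤ Nat.card D := by exact_mod_cast hR7 D hD
    have hc0 : (0 : ℚ) ≤ (orb D).card := Nat.cast_nonneg _
    have hw6 : (w : ℚ) ≤ 6 := by
      have : w ≤ 6 := by omega
      exact_mod_cast this
    have : n ≤ (orb D).card * (6 * Nat.card D) := by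
      rw [← ho]
      exact mul_le_mul_of_nonneg_left (mul_le_mul_of_nonneg_right hw6 (by linarith only [h7])) hc0
    exact q1 this hc0 h7
  have hd : Nat.card Q = 4 ∨ Nat.card Q = 5 := by
    by_contra hc
    have : 7 ≤ Nat.card Q := by omega
    have h7 : (7 : ℚ) ≤ q := by rw [hq]; exact_mod_cast this
    have hc0 : (0 : ℚ) ≤ (orb Q).card := Nat.cast_nonneg _
    exact q3 hoQ hc0 h7 hsum0 e1
  rcases hd with hd | hd
  · right
    have hq4 : q = 4 := by rw [hq, hd]; norm_num
    rw [hq4] at hoQ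
    have e2 : ∑ D ∈ R, f D = -4 + n / 6 := by linarith
    by_cases hRe : R = ∅
    · exfalso
      rw [hRe] at e2
      simp at e2
      have h24 : n = 24 := by linarith
      rw [hn] at h24
      have h24' : Nat.card N = 24 := by exact_mod_cast h24
      have : Fact (Nat.Prime 2) := ⟨by norm_num⟩
      obtain ⟨K, hK⟩ := Sylow.exists_subgroup_card_pow_prime 2 (n := 3) (G := N) (by rw [h24']; norm_num)
      apply no_index3 S.perf K
      have := Subgroup.card_mul_index K
      rw [hK, h24'] at this
      omega
    obtain ⟨D, hD⟩ := Finset.nonempty_iff_ne_empty.2 hRe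
    obtain ⟨w, hwn, hw, hw7, ho⟩ := hRw D hD
    have h7 := hR7 D hD
    have h7q : (7 : ℚ) ≤ Nat.card D := by exact_mod_cast h7
    have hc0 : (0 : ℚ) ≤ (orb D).card := Nat.cast_nonneg _
    have hle := hRle D hD
    have hDtor := ((hRm D).1 hD).1
    have htwo : ∀ E ∈ R, E ∉ orb D → ((orb D).card : ℚ) * (Nat.card D - 4) + 
        (orb E).card * (Nat.card E - 4) ≤ ∑ D ∈ R, f D := by
      intro E hE hED
      have a1 := orb_sum D f (hfc D)
      have a2 := orb_sum E f (hfc E)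
      change _ = ((orb D).card : ℚ) * (Nat.card D - 4) at a1
      change _ = ((orb E).card : ℚ) * (Nat.card E - 4) at a2
      rw [← a1, ← a2, ← Finset.sum_union (disj D E hED)]
      exact Finset.sum_le_sum_of_subset_of_nonneg (Finset.union_subset (hRo D hD) (hRo E hE)) 
        (fun D hD _ => hRf D hD)
    have hone : (∀ E ∈ R, E ∈ orb D) → ((orb D).card : ℚ) * (Nat.card D - 4) = -4 + n / 6 := by
      intro h
      have : R = orb D := le_antisymm h (hRo D hD)
      rw [← e2, this]
      exact (orb_sum D f (hfc D)).symm
    rcases hw with rfl | rfl | rfl | rfl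
    · exact (q4 ho hn0 hc0 h7q (by simp) e2 hle).elim
    · exact (q4 ho hn0 hc0 h7q (by simp) e2 hle).elim
    · have hlt : Nat.card D < 8 := by
        by_contra hc
        have h8 : (8 : ℚ) ≤ Nat.card D := by exact_mod_cast (not_lt.1 hc)
        exact q5 (by exact_mod_cast ho) hn0 hc0 h8 e2 hle
      have hD7 : Nat.card D = 7 := by omega
      have hall : ∀ E ∈ R, E ∈ orb D := by
        intro E hE
        by_contra hED
        have b1 := htwo E hE hED
        have b2 := hRn E hE
        rw [hD7] at ho b1
        push_cast at ho b1
        linarith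
      have b3 := hone hall
      rw [hD7] at ho b3
      push_cast at ho b3
      refine ⟨?_, D, hDtor, hD7, by rw [hwn, hD7]⟩
      have : n = 168 := by linarith
      rw [hn] at this
      exact_mod_cast this
    · exfalso
      have hlb : ∀ E ∈ R, Nat.card E ≠ 7 → n / 12 ≤ ((orb E).card : ℚ) * (Nat.card E - 4) := by
        intro E hE hE7
        obtain ⟨w, -, hw, -, ho⟩ := hRw E hE
        have h7 : (8 : ℚ) ≤ Nat.card E := by
          have : 8 ≤ Nat.card E := by have := hR7 E hE; omega
          exact_mod_cast this
        have hc0 : (0 : ℚ) ≤ (orb E).card := Nat.cast_nonneg _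
        have hw6 : (w : ℚ) ≤ 6 := by
          have : w ≤ 6 := by omega
          exact_mod_cast this
        have : n ≤ (orb E).card * (6 * Nat.card E) := by
          rw [← ho]
          exact mul_le_mul_of_nonneg_left (mul_le_mul_of_nonneg_right hw6 (by linarith only [h7])) hc0
        exact q2 this hc0 h7
      have hD7 : Nat.card D ≠ 7 := fun h => hw7 h rfl
      have hall : ∀ E ∈ R, E ∈ orb D := by
        intro E hE
        by_contra hED
        have b1 := htwo E hE hED
        have b2 := hlb D hD hD7
        by_cases hE7 : Nat.card E = 7
        · obtain ⟨w', -, hw', hw7', ho'⟩ := hRw E hE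
          have c6 := hw7' hE7
          have hw6 : (w' : ℚ) ≤ 3 := by
            have : w' ≤ 3 := by omega
            exact_mod_cast this
          have : n ≤ (orb E).card * (3 * Nat.card E) := by
            rw [← ho']
            exact mul_le_mul_of_nonneg_left (mul_le_mul_of_nonneg_right hw6 (Nat.cast_nonneg _)) (Nat.cast_nonneg _)
          rw [hE7] at this b1
          push_cast at this b1
          linarith
        · have b3 := hlb E hE hE7
          linarith
      have b3 := hone hall
      push_cast at ho
      have : ((orb D).card : ℚ) = 1 := by linarith
      exact S.not_normal hDtor (normal_of_orb (by exact_mod_cast this))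
  · left
    have hq5 : q = 5 := by rw [hq, hd]; norm_num
    rw [hq5] at hoQ
    have hRe : R = ∅ := by
      by_contra hne
      obtain ⟨D, hD⟩ := Finset.nonempty_iff_ne_empty.2 hne
      have b1 := hRn D hD
      have b2 := hRle D hD
      linarith
    rw [hRe, Finset.sum_empty] at e1
    constructor
    · have : n = 60 := by linarith
      rw [hn] at this
      exact_mod_cast this
    · intro D hD
      by_cases h1 : D ∈ orb P
      · left
        obtain ⟨m, rfl⟩ := mem_orb.1 h1
        rw [card_cj, hP3]
      · by_cases h2 : D ∈ orb Q
        · right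
          obtain ⟨m, rfl⟩ := mem_orb.1 h2
          rw [card_cj, hd]
        · have := (hRm D).2 ⟨hD, h1, h2⟩
          rw [hRe] at this
          simp at this

end Setup

namespace Setup
variable {N : Type} [Group N] [Fintype N] {χ : N → ℂ}

theorem iso_of_inj (hp : commutator N = ⊤) (hn : Nat.card N = 60) {α : Type} (e : α ≃ Fin 5)
    (f : N →* Equiv.Perm α) (hf : Function.Injective f) :
    Nonempty (N ≃* alternatingGroup (Fin 5)) := by
  let g : N →* Equiv.Perm (Fin 5) := (e.permCongrHom).toMonoidHom.comp f
  have hg : Function.Injective g := (e.permCongrHom).injective.comp hf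
  have hs : ∀ x, g x ∈ alternatingGroup (Fin 5) := fun x => by
    rw [Equiv.Perm.mem_alternatingGroup]
    exact perf_comm hp ((Equiv.Perm.sign).comp g) (fun a b => mul_comm _ _) x
  let k : N →* alternatingGroup (Fin 5) := g.codRestrict _ hs
  have hk : Function.Injective k := fun a b hab => hg (congrArg Subtype.val hab)
  refine ⟨MulEquiv.ofBijective k ((Nat.bijective_iff_injective_and_card k).2 ⟨hk, ?_⟩)⟩
  rw [hn, nat_card_alternatingGroup, Nat.card_fin]
  rfl

theorem case60 (S : Setup N χ) (hn : Nat.card N = 60) 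
    (hD : ∀ D : Subgroup N, IsTor D → Nat.card D = 3 ∨ Nat.card D = 5) :
    Nonempty (N ≃* alternatingGroup (Fin 5)) := by
  classical
  have : Fact (Nat.Prime 2) := ⟨by norm_num⟩
  -- no even order elements in tori
  have hodd : ∀ g : N, g ^ 2 ≠ 1 → ∀ x, x ^ 4 = 1 → x * g = g * x → x = 1 := by
    intro g hg x hx hxg
    have h1 := Subgroup.orderOf_dvd_natCard (Subgroup.centralizer {g}) (x := x)
      (Subgroup.mem_centralizer_singleton_iff.2 hxg)
    have h2 := orderOf_dvd_of_pow_eq_one hx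
    rw [← orderOf_eq_one_iff]
    rcases hD _ ⟨g, hg, rfl⟩ with h | h <;> rw [h] at h1 <;>
    · have := Nat.dvd_gcd h1 h2
      simpa using this
  have hcard : ∀ V : Sylow 2 N, Nat.card V = 4 := by
    intro V
    rw [V.card_eq_multiplicity, hn]
    have : (60 : ℕ).factorization 2 = 2 := by
      rw [Nat.factorization_def _ (by norm_num)]
      have : (60 : ℕ) = 2 ^ 2 * 15 := by norm_num
      rw [this, padicValNat.mul (by norm_num) (by norm_num), padicValNat.prime_pow, 
        padicValNat.eq_zero_of_not_dvd (by norm_num)]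
    rw [this]
    norm_num
  have hsq : ∀ (V : Sylow 2 N) (v : N), v ∈ V → v ^ 2 = 1 := by
    intro V v hv
    by_contra hc
    have h4 : v ^ 4 = 1 := by
      have h := Subgroup.orderOf_dvd_natCard (V : Subgroup N) hv
      have h' : Nat.card (V : Subgroup N) = 4 := hcard V
      rw [h'] at h
      exact orderOf_dvd_iff_pow_eq_one.1 h
    have := hodd v hc v h4 rfl
    rw [this] at hc
    simp at hc
  have hcomm : ∀ (V : Sylow 2 N) (v w : N), v ∈ V → w ∈ V → v * w = w * v := by
    intro V v w hv hw
    have h1 := hsq V v hv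
    have h2 := hsq V w hw
    have h3 := hsq V (v * w) (mul_mem hv hw)
    rw [sq] at h1 h2 h3
    have i1 := eq_inv_of_mul_eq_one_left h1
    have i2 := eq_inv_of_mul_eq_one_left h2
    have i3 := eq_inv_of_mul_eq_one_left h3
    rw [mul_inv_rev, ← i1, ← i2] at i3
    exact i3
  have hC : ∀ (V : Sylow 2 N) (t : N), t ∈ V → t ≠ 1 → Subgroup.centralizer {t} = V := by
    intro V t ht ht1
    apply V.3
    · intro x
      refine ⟨1, Subtype.ext ?_⟩
      by_contra hc
      have hx := Subgroup.mem_centralizer_singleton_iff.1 x.2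
      refine ht1 (hodd x (by simpa using hc) t ?_ hx.symm)
      have := hsq V t ht
      rw [show 4 = 2 * 2 from rfl, pow_mul, this, one_pow]
    · intro v hv
      rw [Subgroup.mem_centralizer_singleton_iff]
      exact hcomm V v t hv ht
  obtain ⟨V⟩ : Nonempty (Sylow 2 N) := inferInstance
  have hV4 : Nat.card (V : Subgroup N) = 4 := hcard V
  have hidx : (V : Subgroup N).index = 15 := by
    have := Subgroup.card_mul_index (V : Subgroup N)
    rw [hV4, hn] at this
    omega
  have hdvd := V.card_dvd_index
  rw [hidx] at hdvd
  have hni := V.card_eq_index_normalizer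
  have hni2 := Subgroup.card_mul_index (Subgroup.normalizer (V : Set N))
  have hnn : Nat.card (Sylow 2 N) ≠ 1 := by
    intro h
    rw [h] at hni
    have h1 := Subgroup.index_eq_one.1 hni.symm
    have h2 : (V : Subgroup N).Normal := Subgroup.normalizer_eq_top_iff.1 h1
    have h3 := S.abel V h2 (fun x hx y hy => hcomm V x y hx hy)
    rw [h3, Subgroup.card_bot] at hV4
    omega
  have h5 : Nat.card (Sylow 2 N) = 5 := by
    have h3 : Nat.card (Sylow 2 N) ≠ 3 := by
      intro h
      exact no_index3 S.perf _ (hni.symm.trans h)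
    have h15 : Nat.card (Sylow 2 N) ≠ 15 := by
      intro h
      rw [← hni, h, hn] at hni2
      have h1 : (V : Subgroup N) = Subgroup.normalizer (V : Set N) := by
        apply Subgroup.eq_of_le_of_card_ge
        · exact Subgroup.le_normalizer
        · rw [hV4]; omega
      have h2 := burnside S.perf V (by
        intro x hx
        have hx := h1.ge hx
        rw [Subgroup.mem_centralizer_iff]
        intro y hy
        exact hcomm V y x hy hx)
      have h6 := hcard V
      omega
    have hle := Nat.le_of_dvd (by norm_num) hdvd
    generalize Nat.card (Sylow 2 N) = m at *
    clear hni hni2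
    interval_cases m <;> omega
  refine iso_of_inj S.perf hn (Finite.equivFinOfCardEq h5) (MulAction.toPermHom N (Sylow 2 N)) ?_
  rw [injective_iff_map_eq_one]
  have hk0 : ∀ a : N, MulAction.toPermHom N (Sylow 2 N) a = 1 → ∀ P : Sylow 2 N, a • P = P := by
    intro a ha P
    exact congrArg (fun f : Equiv.Perm (Sylow 2 N) => f P) ha
  have hKV : ∀ a : N, MulAction.toPermHom N (Sylow 2 N) a = 1 → a ∈ V → a = 1 := by
    intro a ha haV
    by_contra hc
    apply hnn
    have hall : ∀ P : Sylow 2 N, a ∈ P := by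
      intro P
      have h1 := Sylow.smul_eq_iff_mem_normalizer.1 (hk0 a ha P)
      have hpg : IsPGroup 2 (Subgroup.zpowers a) := V.2.to_le (by
        rwa [Subgroup.zpowers_le])
      have h2 := hpg.inf_normalizer_sylow P
      have h3 : a ∈ Subgroup.zpowers a ⊓ Subgroup.normalizer (P : Set N) := ⟨Subgroup.mem_zpowers a, h1⟩
      rw [h2] at h3
      exact h3.2
    have : Subsingleton (Sylow 2 N) := ⟨fun P Q => Sylow.ext (by
      rw [← hC P a (hall P) hc, ← hC Q a (hall Q) hc])⟩
    exact Nat.card_of_subsingleton V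
  intro a ha
  apply hKV a ha
  obtain ⟨v, hv⟩ : ∃ v : V, v ≠ 1 := by
    have : Nontrivial V := by
      rw [← Finite.one_lt_card_iff_nontrivial, hcard V]
      norm_num
    exact exists_ne 1
  have hv1 : (v : N) ≠ 1 := fun h => hv (Subtype.ext h)
  have h1 := Sylow.smul_eq_iff_mem_normalizer.1 (hk0 a ha V)
  have h2 : a * v * a⁻¹ * (v : N)⁻¹ = 1 := by
    apply hKV
    · rw [map_mul, map_mul, map_mul, map_inv, map_inv, ha, one_mul, inv_one, mul_one, mul_inv_cancel]
    · apply mul_mem _ (inv_mem v.2)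
      exact (Subgroup.mem_normalizer_iff.1 h1 v).1 v.2
  have h3 : a ∈ Subgroup.centralizer {(v : N)} := by
    rw [Subgroup.mem_centralizer_singleton_iff]
    rw [mul_inv_eq_one, mul_inv_eq_iff_eq_mul] at h2
    exact h2
  rw [hC V v v.2 hv1] at h3
  exact h3

end Setup

namespace Setup

abbrev SL7 := Matrix.SpecialLinearGroup (Fin 2) (ZMod 7)

instance fact7 : Fact (Nat.Prime 7) := ⟨by norm_num⟩

theorem sl7_le : Nat.card SL7 ≤ 336 := by
  let s : Finset (ZMod 7 × ZMod 7 × ZMod 7) := Finset.univ.filter (fun p => ¬ (p.1 = 0 ∧ p.2.1 = 0))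
  have hs : s.card = 336 := by decide +kernel
  rw [← hs, ← Nat.card_eq_finsetCard]
  have hd : ∀ M : SL7, M 0 0 * M 1 1 - M 0 1 * M 1 0 = 1 := fun M => by
    have := M.2
    rwa [Matrix.det_fin_two] at this
  let f : SL7 → s := fun M => ⟨(M 0 0, M 1 0, if M 0 0 = 0 then M 1 1 else M 0 1), by
    simp only [s, Finset.mem_filter, Finset.mem_univ, true_and]
    rintro ⟨h1, h2⟩
    have := hd M
    rw [h1, h2] at this
    simp at this⟩
  apply Nat.card_le_card_of_injective f
  intro M M' h
  have h := congrArg Subtype.val h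
  simp only [f, Prod.mk.injEq] at h
  obtain ⟨h1, h2, h3⟩ := h
  have d1 := hd M
  have d2 := hd M'
  have h4 : M 0 1 = M' 0 1 ∧ M 1 1 = M' 1 1 := by
    rw [← h1] at h3
    split_ifs at h3 with h0
    · refine ⟨?_, h3⟩
      rw [← h1, ← h2] at d2
      have hc : M 1 0 ≠ 0 := by
        intro hc
        rw [h0, hc] at d1
        simp at d1
      apply mul_right_cancel₀ hc
      linear_combination d2 - d1 - (M' 1 1 - M 1 1) * h0
    · refine ⟨h3, ?_⟩
      rw [← h1, ← h2, ← h3] at d2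
      apply mul_left_cancel₀ h0
      linear_combination d1 - d2
  ext i j
  fin_cases i <;> fin_cases j
  · exact h1
  · exact h4.1
  · exact h2
  · exact h4.2

def slHom : SL7 →* Equiv.Perm (OnePoint (ZMod 7)) :=
  (MulAction.toPermHom (GL (Fin 2) (ZMod 7)) (OnePoint (ZMod 7))).comp
    Matrix.SpecialLinearGroup.toGL

theorem slHom_inf (g : SL7) : slHom g OnePoint.infty = 
    if g 1 0 = 0 then OnePoint.infty else ((g 0 0 / g 1 0 : ZMod 7) : OnePoint (ZMod 7)) := by
  exact OnePoint.smul_infty_eq_ite _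

theorem slHom_coe (g : SL7) (k : ZMod 7) : slHom g (k : OnePoint (ZMod 7)) = 
    if g 1 0 * k + g 1 1 = 0 then OnePoint.infty else 
    (((g 0 0 * k + g 0 1) / (g 1 0 * k + g 1 1) : ZMod 7) : OnePoint (ZMod 7)) := by
  exact OnePoint.smul_some_eq_ite

theorem center_le : Subgroup.center SL7 ≤ slHom.ker := by
  intro A hA
  rw [Matrix.SpecialLinearGroup.mem_center_iff] at hA
  obtain ⟨r, hr, hA⟩ := hA
  have h00 : A 0 0 = r := by rw [← hA]; simp
  have h01 : A 0 1 = 0 := by rw [← hA]; simp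
  have h10 : A 1 0 = 0 := by rw [← hA]; simp
  have h11 : A 1 1 = r := by rw [← hA]; simp
  have hr0 : r ≠ 0 := by
    rintro rfl
    simp at hr
  rw [MonoidHom.mem_ker]
  ext p
  induction p using OnePoint.rec with
  | infty => rw [slHom_inf, h10]; simp
  | coe k =>
    rw [slHom_coe, h10, h00, h01, h11]
    simp [hr0]

theorem two_le_center : 2 ≤ Nat.card (Subgroup.center SL7) := by
  have h : (-1 : SL7) ∈ Subgroup.center SL7 := by
    rw [Matrix.SpecialLinearGroup.mem_center_iff]
    refine ⟨-1, by simp, ?_⟩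
    ext i j
    fin_cases i <;> fin_cases j <;> simp
  have : Nontrivial (Subgroup.center SL7) := by
    refine ⟨⟨1, ⟨-1, h⟩, ?_⟩⟩
    intro hc
    have h1 := congrArg (fun z : Subgroup.center SL7 => (z : SL7) 0 0) hc
    simp at h1
    revert h1
    decide
  exact Finite.one_lt_card

theorem mem_slr (a b c d : ZMod 7) (h : a * d - b * c = 1) (σ : Equiv.Perm (OnePoint (ZMod 7)))
    (hi : σ OnePoint.infty = if c = 0 then OnePoint.infty else ((a / c : ZMod 7) : OnePoint (ZMod 7)))
    (hk : ∀ k : ZMod 7, σ (k : OnePoint (ZMod 7)) = if c * k + d = 0 then OnePoint.infty else 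
    (((a * k + b) / (c * k + d) : ZMod 7) : OnePoint (ZMod 7))) : σ ∈ slHom.range := by
  refine ⟨⟨!![a, b; c, d], by rw [Matrix.det_fin_two]; exact h⟩, ?_⟩
  ext p
  induction p using OnePoint.rec with
  | infty => rw [hi]; exact slHom_inf _
  | coe k => rw [hk]; exact slHom_coe _ k

theorem psl_core {N : Type} [Group N] [Fintype N] (hn : Nat.card N = 168)
    (f : N →* Equiv.Perm (OnePoint (ZMod 7))) (hf : Function.Injective f)
    (x y t : N) (hx : orderOf x = 7) (hy : orderOf y = 3) (c : ZMod 7) (hc : c = 3 ∨ c = 5 ∨ c = 6)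
    (hxi : f x OnePoint.infty = OnePoint.infty) (hxk : ∀ k : ZMod 7, f x k = ((k + 1 : ZMod 7) : OnePoint (ZMod 7)))
    (hyi : f y OnePoint.infty = OnePoint.infty) (hyk : ∀ k : ZMod 7, f y k = ((2 * k : ZMod 7) : OnePoint (ZMod 7)))
    (hti : f t OnePoint.infty = ((0 : ZMod 7) : OnePoint (ZMod 7))) (ht0 : f t ((0 : ZMod 7) : OnePoint (ZMod 7)) = OnePoint.infty)
    (htk : ∀ k : ZMod 7, k ≠ 0 → f t k = ((c / k : ZMod 7) : OnePoint (ZMod 7))) :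
    Nonempty (N ≃* PSL27) := by
  obtain ⟨d, hd⟩ : ∃ d : ZMod 7, - (c * d ^ 2) = 1 := by
    rcases hc with rfl | rfl | rfl <;> decide
  have hd0 : d ≠ 0 := by rintro rfl; simp at hd
  have hc0 : c ≠ 0 := by rintro rfl; simp at hd
  have mx : f x ∈ slHom.range := by
    apply mem_slr 1 1 0 1 (by simp)
    · rw [hxi]; simp
    · intro k; rw [hxk]; simp
  have my : f y ∈ slHom.range := by
    apply mem_slr 4 0 0 2 (by decide)
    · rw [hyi]; simp
    · intro k
      rw [hyk]
      have : (2 : ZMod 7) ≠ 0 := by decide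
      simp only [zero_mul, zero_add, this, if_false, add_zero]
      have : (4 : ZMod 7) = 2 * 2 := by decide
      congr 1
      rw [this]
      field_simp
  have mt : f t ∈ slHom.range := by
    apply mem_slr 0 (c * d) d 0 (by linear_combination hd)
    · rw [hti]; simp [hd0]
    · intro k
      by_cases hk : k = 0
      · subst hk; rw [ht0]; simp
      · rw [htk k hk]
        simp only [add_zero, mul_eq_zero, hd0, hk, or_self, if_false, zero_mul, zero_add]
        congr 1
        field_simp
  let A := slHom.range.comap f
  have hA7 : 7 ∣ Nat.card A := hx ▸ Subgroup.orderOf_dvd_natCard A (x := x) mx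
  have hA3 : 3 ∣ Nat.card A := hy ▸ Subgroup.orderOf_dvd_natCard A (x := y) my
  have hA8 : 8 ∣ Nat.card A := by
    let _ : MulAction A (OnePoint (ZMod 7)) := MulAction.compHom _ (f.comp A.subtype)
    have hs : ∀ (a : A) (p : OnePoint (ZMod 7)), a • p = f a p := fun a p => rfl
    have h1 : MulAction.orbit A (OnePoint.infty : OnePoint (ZMod 7)) = Set.univ := by
      rw [Set.eq_univ_iff_forall]
      have h0 : ((0 : ZMod 7) : OnePoint (ZMod 7)) ∈ MulAction.orbit A (OnePoint.infty : OnePoint (ZMod 7)) :=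
        ⟨⟨t, mt⟩, hti⟩
      have hk : ∀ k : ℕ, ((k : ZMod 7) : OnePoint (ZMod 7)) ∈ MulAction.orbit A (OnePoint.infty : OnePoint (ZMod 7)) := by
        intro k
        induction k with
        | zero => simpa using h0
        | succ k ih =>
          have h := MulAction.mem_orbit_of_mem_orbit (⟨x, mx⟩ : A) ih
          rw [hs, hxk] at h
          push_cast
          exact h
      intro p
      induction p using OnePoint.rec with
      | infty => exact MulAction.mem_orbit_self _
      | coe k => 
        have := hk k.val
        rwa [ZMod.natCast_zmod_val] at this
    have h2 := MulAction.index_stabilizer A (OnePoint.infty : OnePoint (ZMod 7))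
    rw [h1, Set.ncard_univ] at h2
    have h3 : Nat.card (OnePoint (ZMod 7)) = 8 := by
      have : Nat.card (Option (ZMod 7)) = 8 := by
        rw [Finite.card_option, Nat.card_zmod]
      exact this
    rw [← h3, ← h2]
    exact Subgroup.index_dvd_card _
  have hAle : Nat.card A ≤ 168 := hn ▸ Subgroup.card_le_card_group A
  have hpos : 0 < Nat.card A := Nat.card_pos
  have hA : Nat.card A = 168 := by omega
  have hAt : A = ⊤ := Subgroup.eq_top_of_card_eq A (hA.trans hn.symm)
  have hle : f.range ≤ slHom.range := by
    rintro _ ⟨a, rfl⟩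
    have : a ∈ A := hAt ▸ Subgroup.mem_top a
    exact this
  have hfr : Nat.card f.range = 168 := by
    rw [← hn]
    exact (Nat.card_congr (MonoidHom.ofInjective hf).toEquiv).symm
  have h1 : 168 ≤ Nat.card slHom.range := hfr ▸ Subgroup.card_le_of_le hle
  have h2 : Nat.card slHom.ker * Nat.card slHom.range ≤ 336 := by
    rw [← Subgroup.index_ker, Subgroup.card_mul_index]
    exact sl7_le
  have h3 := two_le_center
  have h4 : Nat.card (Subgroup.center SL7) ≤ Nat.card slHom.ker := Subgroup.card_le_of_le center_le
  have h5 : Nat.card slHom.ker ≤ 2 := by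
    by_contra hcon
    have : 3 * 168 ≤ Nat.card slHom.ker * Nat.card slHom.range := Nat.mul_le_mul (by omega) h1
    omega
  have h6 : Nat.card slHom.range ≤ 168 := by
    have : 2 * Nat.card slHom.range ≤ Nat.card slHom.ker * Nat.card slHom.range := Nat.mul_le_mul (by omega) le_rfl
    omega
  have e1 : f.range = slHom.range := Subgroup.eq_of_le_of_card_ge hle (by omega)
  have e2 : Subgroup.center SL7 = slHom.ker := Subgroup.eq_of_le_of_card_ge center_le (by omega)
  exact ⟨(MonoidHom.ofInjective hf).trans ((MulEquiv.subgroupCongr e1).trans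
    ((QuotientGroup.quotientKerEquivRange slHom).symm.trans
      (QuotientGroup.quotientMulEquivOfEq e2.symm)))⟩

end Setup

namespace Setup
variable {N : Type} [Group N] [Fintype N] {χ : N → ℂ}

theorem involution_formula (h : ZMod 7 → ZMod 7) (h0 : ∀ k, k ≠ 0 → h k ≠ 0)
    (h1 : ∀ k, k ≠ 0 → h k ≠ k) (h2 : ∀ k, k ≠ 0 → h (h k) = k) 
    (h3 : ∀ k, k ≠ 0 → h (2 * k) = 4 * h k) : 
    ∃ c : ZMod 7, (c = 3 ∨ c = 5 ∨ c = 6) ∧ ∀ k, k ≠ 0 → h k = c / k := by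
  have e2 := h3 1 (by decide)
  have e4 := h3 2 (by decide)
  have e1' := h2 1 (by decide)
  have n1 := h1 1 (by decide)
  have n2 := h1 2 (by decide)
  have n4 := h1 4 (by decide)
  have hc0 := h0 1 (by decide)
  set c := h 1 with hc
  have ec2 := h3 c hc0
  have ec4 := h3 (2 * c) (by intro hh; apply hc0; revert hh; generalize c = z; revert z; decide)
  rw [show (2 : ZMod 7) * 1 = 2 by decide] at e2
  rw [show (2 : ZMod 7) * 2 = 4 by decide, e2, show 4 * (4 * c) = 2 * c by
    generalize c = z; revert z; decide] at e4
  rw [e1'] at ec2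
  rw [ec2] at ec4
  rw [e2] at n2
  rw [e4] at n4
  have key : c = 3 ∨ c = 5 ∨ c = 6 := by
    clear_value c
    clear hc h0 h1 h2 h3 e2 e4 e1' ec2 ec4
    revert c
    decide
  refine ⟨c, key, fun k hk => ?_⟩
  have hk' : k = 1 ∨ k = 2 ∨ k = 4 ∨ k = c ∨ k = 2 * c ∨ k = 2 * (2 * c) := by
    clear_value c
    clear hc h0 h1 h2 h3 e2 e4 e1' ec2 ec4 n1 n2 n4
    revert c k
    decide
  rcases hk' with rfl | rfl | rfl | rfl | rfl | rfl
  · rw [div_one]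
  · rw [e2, eq_div_iff hk]; generalize c = z; revert z; decide
  · rw [e4, eq_div_iff hk]; generalize c = z; revert z; decide
  · rw [div_self hc0, e1']
  · rw [ec2, eq_div_iff hk]; clear_value c; clear hc h0 h1 h2 h3 e2 e4 e1' ec2 ec4 n1 n2 n4 hk; revert c; decide
  · rw [ec4, eq_div_iff hk]; clear_value c; clear hc h0 h1 h2 h3 e2 e4 e1' ec2 ec4 n1 n2 n4 hk; revert c; decide

theorem exists_y (S : Setup N χ) (P : Sylow 7 N) (hP : IsTor (P : Subgroup N)) {x : N}
    (hxP : (P : Subgroup N) = Subgroup.zpowers x)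
    (hx : orderOf x = 7) (h21 : Nat.card (Subgroup.normalizer (P : Set N)) = 21) :
    ∃ y : N, y ∈ Subgroup.normalizer (P : Set N) ∧ orderOf y = 3 ∧ y * x * y⁻¹ = x ^ 2 := by
  have hxm : x ∈ (P : Subgroup N) := hxP ▸ Subgroup.mem_zpowers x
  have hx2 : x ^ 2 ≠ 1 := by
    intro h
    have := orderOf_dvd_of_pow_eq_one h
    rw [hx] at this
    omega
  have : Fact (Nat.Prime 3) := ⟨by norm_num⟩
  obtain ⟨y, hy⟩ := exists_prime_orderOf_dvd_card' (G := Subgroup.normalizer (P : Set N)) 3 (by rw [h21]; norm_num)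
  have hy3 : orderOf (y : N) = 3 := by rw [Subgroup.orderOf_coe, hy]
  obtain ⟨y, hyN⟩ := y
  simp only at hy3
  have h1 : y * x * y⁻¹ ∈ (P : Subgroup N) := (Subgroup.mem_normalizer_iff.1 hyN x).1 hxm
  rw [hxP, ← mem_powers_iff_mem_zpowers] at h1
  obtain ⟨a, ha⟩ := h1
  simp only at ha
  have hpow : ∀ k : ℕ, y * x ^ k * y⁻¹ = x ^ (a * k) := by
    intro k
    rw [pow_mul, ha, conj_pow]
  have h2 : y ^ 2 * x * (y ^ 2)⁻¹ = x ^ (a * a) := by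
    rw [← hpow a, ha, sq, mul_inv_rev]
    simp only [mul_assoc]
  have h3 : x = x ^ (a * (a * a)) := by
    rw [← hpow, ← h2]
    have : y ^ 3 = 1 := by rw [← hy3, pow_orderOf_eq_one]
    calc x = y ^ 3 * x * (y ^ 3)⁻¹ := by rw [this]; simp
      _ = _ := by rw [pow_succ', mul_inv_rev]; simp only [mul_assoc]
  have h4 : 1 ≡ a * (a * a) [MOD 7] := by
    rw [← hx, ← pow_eq_pow_iff_modEq, pow_one]
    exact h3
  have h5 : ¬ a ≡ 1 [MOD 7] := by
    intro h
    rw [← hx, ← pow_eq_pow_iff_modEq, pow_one, ha] at h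
    have h6 : y ∈ (P : Subgroup N) := by
      rw [S.tor_eq hP hxm hx2, Subgroup.mem_centralizer_singleton_iff]
      exact mul_inv_eq_iff_eq_mul.1 h
    rw [hxP] at h6
    have h7 := Subgroup.orderOf_dvd_natCard _ h6
    rw [Nat.card_zpowers, hx, hy3] at h7
    omega
  have h6 : a ≡ 2 [MOD 7] ∨ a ≡ 4 [MOD 7] := by
    rw [← ZMod.natCast_eq_natCast_iff] at h4 h5 ⊢
    rw [← ZMod.natCast_eq_natCast_iff]
    push_cast at *
    generalize (a : ZMod 7) = z at *
    revert z
    decide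
  rcases h6 with h6 | h6
  · refine ⟨y, hyN, hy3, ?_⟩
    rw [← ha, pow_eq_pow_iff_modEq, hx]
    exact h6
  · refine ⟨y ^ 2, pow_mem hyN 2, ?_, ?_⟩
    · rw [orderOf_pow' _ (by norm_num), hy3]
      norm_num
    · rw [h2, pow_eq_pow_iff_modEq, hx]
      exact h6.mul h6

theorem exists_t (S : Setup N χ) {y : N} (hy : orderOf y = 3) : 
    ∃ t : N, orderOf t = 2 ∧ t * y * t⁻¹ = y ^ 2 := by
  have hy2 : y ^ 2 ≠ 1 := by
    intro h
    have := orderOf_dvd_of_pow_eq_one h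
    rw [hy] at this
    omega
  have : Fact (Nat.Prime 3) := ⟨by norm_num⟩
  have : Fact (Nat.Prime 2) := ⟨by norm_num⟩
  have hD : IsTor (Subgroup.centralizer {y}) := ⟨y, hy2, rfl⟩
  have hyD : y ∈ Subgroup.centralizer {y} := Subgroup.mem_centralizer_singleton_iff.2 rfl
  obtain ⟨P3, hP3, hc3⟩ := S.exists3
  have h1 := S.prime_conj (p := 3) hP3 hD (by norm_num) hc3 (hy ▸ Subgroup.orderOf_dvd_natCard _ hyD)
  obtain ⟨n, hn⟩ := mem_orb.1 h1
  have hcD : Nat.card (Subgroup.centralizer {y}) = 3 := by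
    rw [← hn, card_cj, hc3]
  have hz := (eq_zpowers hyD hy2 (by rw [hcD]; simp)).1
  have h6 := S.weyl3 hD hcD
  rw [hcD] at h6
  obtain ⟨t, ht⟩ := exists_prime_orderOf_dvd_card' (G := Subgroup.normalizer (Subgroup.centralizer {y} : Set N)) 2 (by rw [h6]; norm_num)
  have ht2 : orderOf (t : N) = 2 := by rw [Subgroup.orderOf_coe, ht]
  obtain ⟨t, htN⟩ := t
  simp only at ht2
  refine ⟨t, ht2, ?_⟩
  have h1 : t * y * t⁻¹ ∈ Subgroup.centralizer {y} := (Subgroup.mem_normalizer_iff.1 htN y).1 hyD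
  have h1 := hz.le h1
  rw [← mem_powers_iff_mem_zpowers] at h1
  obtain ⟨a, ha⟩ := h1
  simp only at ha
  have hr : y ^ a = y ^ (a % 3) := by rw [← hy, pow_mod_orderOf]
  have hlt := Nat.mod_lt a (show 3 > 0 by norm_num)
  rw [hr] at ha
  interval_cases a % 3
  · rw [pow_zero, eq_comm, mul_inv_eq_one, mul_eq_left] at ha
    rw [ha] at hy
    simp at hy
  · exfalso
    rw [pow_one, eq_comm, mul_inv_eq_iff_eq_mul] at ha
    have h7 := Subgroup.orderOf_dvd_natCard _ (Subgroup.mem_centralizer_singleton_iff.2 ha)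
    rw [hcD, ht2] at h7
    omega
  · exact ha.symm

end Setup

namespace Setup
variable {N : Type} [Group N] [Fintype N] {χ : N → ℂ}

theorem case168 (S : Setup N χ) (hn : Nat.card N = 168) 
    (hP : ∃ P : Subgroup N, IsTor P ∧ Nat.card P = 7 ∧ 
      Nat.card (Subgroup.normalizer (P : Set N)) = 21) :
    Nonempty (N ≃* PSL27) := by
  classical
  obtain ⟨P0, hP0, hc7, h21⟩ := hP
  obtain ⟨P, rfl⟩ := S.prime_sylow (p := 7) hP0 (by norm_num) hc7
  obtain ⟨x, hxP, hx2⟩ := tor_gen hP0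
  obtain ⟨hPz, hx⟩ := eq_zpowers hxP hx2 (by rw [hc7]; simp)
  rw [hc7] at hx
  obtain ⟨y, hyN, hy, hyx⟩ := S.exists_y P hP0 hPz hx h21
  obtain ⟨t, ht, hty⟩ := S.exists_t hy
  have hΩ : ∀ Q : Sylow 7 N, Nat.card (Sylow 7 N) * Nat.card (Subgroup.normalizer (Q : Set N)) = 168 := by
    intro Q
    rw [Q.card_eq_index_normalizer, mul_comm, Subgroup.card_mul_index, hn]
  have h8 : Nat.card (Sylow 7 N) = 8 := by
    have h1 := hΩ P
    have h1 : Nat.card (Sylow 7 N) * 21 = 168 := by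
      rw [← h21]; exact h1
    omega
  have hnorm : ∀ Q : Sylow 7 N, Nat.card (Subgroup.normalizer (Q : Set N)) = 21 := by
    intro Q
    have := hΩ Q
    rw [h8] at this
    omega
  have hQ7 : ∀ Q : Sylow 7 N, Nat.card (Q : Subgroup N) = 7 := by
    intro Q
    exact (Nat.card_congr (Sylow.equiv Q P).toEquiv).trans hc7
  -- elements of order 7 fixing a Sylow
  have hfix : ∀ (m : N) (Q : Sylow 7 N), m ∈ (P : Subgroup N) → m ≠ 1 → m • Q = Q → Q = P := by
    intro m Q hm hm1 hmQ
    have h1 := Sylow.smul_eq_iff_mem_normalizer.1 hmQ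
    have hpg : IsPGroup 7 (Subgroup.zpowers m) := P.2.to_le (by rwa [Subgroup.zpowers_le])
    have h2 := hpg.inf_normalizer_sylow Q
    have h3 : m ∈ Subgroup.zpowers m ⊓ Subgroup.normalizer (Q : Set N) := ⟨Subgroup.mem_zpowers m, h1⟩
    rw [h2] at h3
    have hmQ := h3.2
    have hom : orderOf m = 7 := by
      have h4 := Subgroup.orderOf_dvd_natCard _ hm
      rw [hc7] at h4
      rcases (Nat.dvd_prime (by norm_num)).1 h4 with h5 | h5
      · exact absurd (orderOf_eq_one_iff.1 h5) hm1
      · exact h5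
    have e : ∀ R : Sylow 7 N, m ∈ (R : Subgroup N) → Subgroup.zpowers m = R := by
      intro R hR
      apply Subgroup.eq_of_le_of_card_ge
      · rwa [Subgroup.zpowers_le]
      · rw [Nat.card_zpowers, hom, hQ7 R]
    exact Sylow.ext ((e Q hmQ).symm.trans (e P hm))
  have hPfix : ∀ m ∈ (P : Subgroup N), m • P = P := fun m hm => 
    Sylow.smul_eq_iff_mem_normalizer.2 (Subgroup.le_normalizer hm)
  have hyP : y • P = P := by
    exact Sylow.smul_eq_iff_mem_normalizer.2 hyN
  obtain ⟨Q, hQP, hyQ⟩ : ∃ Q : Sylow 7 N, Q ≠ P ∧ y • Q = Q := by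
    have : Fact (Nat.Prime 3) := ⟨by norm_num⟩
    have hpg : IsPGroup 3 (Subgroup.zpowers y) := IsPGroup.of_card (n := 1) (by
      rw [Nat.card_zpowers, hy, pow_one])
    have h1 := hpg.card_modEq_card_fixedPoints (Sylow 7 N)
    rw [h8] at h1
    by_contra hcon
    push Not at hcon
    have h2 : MulAction.fixedPoints (Subgroup.zpowers y) (Sylow 7 N) = {P} := by
      ext R
      rw [Set.mem_singleton_iff]
      constructor
      · intro h
        by_contra hR
        exact hcon R hR (h ⟨y, Subgroup.mem_zpowers y⟩)
      · rintro rfl ⟨m, hm⟩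
        have h3 : Subgroup.zpowers y ≤ MulAction.stabilizer N R := by
          rw [Subgroup.zpowers_le]; exact hyP
        exact h3 hm
    rw [h2] at h1
    have h4 : Nat.card ({P} : Set (Sylow 7 N)) = 1 := by simp
    rw [h4] at h1
    exact absurd h1 (by decide)
  have hxpow : ∀ i j : ℕ, (i : ZMod 7) = j → x ^ i = x ^ j := by
    intro i j h
    rw [pow_eq_pow_iff_modEq, hx]
    exact (ZMod.natCast_eq_natCast_iff _ _ _).1 h
  have hE1 : ∀ k : ℕ, x ^ k • Q ≠ P := by
    intro k h
    apply hQP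
    rw [← eq_inv_smul_iff] at h
    rw [h]
    exact hPfix _ (inv_mem (pow_mem hxP k))
  let E0 : OnePoint (ZMod 7) → Sylow 7 N := fun p => OnePoint.elim p P (fun k : ZMod 7 => x ^ k.val • Q)
  have hE0i : E0 OnePoint.infty = P := rfl
  have hE0k : ∀ k : ZMod 7, E0 k = x ^ k.val • Q := fun k => rfl
  have hE0n : ∀ k : ℕ, E0 ((k : ZMod 7) : OnePoint (ZMod 7)) = x ^ k • Q := fun k => by
    rw [hE0k, hxpow _ k]
    rw [ZMod.natCast_zmod_val]
  have hinj : Function.Injective E0 := by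
    intro p q hpq
    induction p using OnePoint.rec with
    | infty => 
      induction q using OnePoint.rec with
      | infty => rfl
      | coe k => exact absurd hpq.symm (hE1 _)
    | coe k => 
      induction q using OnePoint.rec with
      | infty => exact absurd hpq (hE1 _)
      | coe l =>
        rw [hE0k, hE0k, ← inv_smul_eq_iff, smul_smul] at hpq
        by_contra hkl
        apply hQP
        apply hfix _ _ _ _ hpq
        · exact mul_mem (inv_mem (pow_mem hxP _)) (pow_mem hxP _)
        · intro h1
          apply hkl
          rw [inv_mul_eq_one, pow_eq_pow_iff_modEq, hx, ← ZMod.natCast_eq_natCast_iff,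
            ZMod.natCast_zmod_val, ZMod.natCast_zmod_val] at h1
          rw [h1]
  have : Finite (OnePoint (ZMod 7)) := inferInstanceAs (Finite (Option (ZMod 7)))
  have hbij : Function.Bijective E0 := by
    rw [Nat.bijective_iff_injective_and_card]
    refine ⟨hinj, ?_⟩
    rw [h8]
    have : Nat.card (Option (ZMod 7)) = 8 := by rw [Finite.card_option, Nat.card_zmod]
    exact this
  let E : OnePoint (ZMod 7) ≃ Sylow 7 N := Equiv.ofBijective E0 hbij
  let f : N →* Equiv.Perm (OnePoint (ZMod 7)) :=
    (E.symm.permCongrHom).toMonoidHom.comp (MulAction.toPermHom N (Sylow 7 N))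
  have hfE : ∀ n p q, n • E0 p = E0 q → f n p = q := by
    intro n p q h
    change E.symm (n • E p) = q
    rw [Equiv.symm_apply_eq]
    exact h
  have hfaith : Function.Injective f := by
    rw [injective_iff_map_eq_one]
    have hk0 : ∀ a : N, f a = 1 → ∀ R : Sylow 7 N, a • R = R := by
      intro a ha R
      have := congrArg (fun g : Equiv.Perm (OnePoint (ZMod 7)) => g (E.symm R)) ha
      change E.symm (a • E (E.symm R)) = E.symm R at this
      rw [Equiv.apply_symm_apply] at this
      exact E.symm.injective this
    have hk1 : ∀ a : N, f a = 1 → a ∈ (P : Subgroup N) → a = 1 := by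
      intro a ha haP
      by_contra h
      exact hQP (hfix a Q haP h (hk0 a ha Q))
    intro a ha
    apply hk1 a ha
    rw [S.tor_eq hP0 hxP hx2, Subgroup.mem_centralizer_singleton_iff]
    have h1 := Sylow.smul_eq_iff_mem_normalizer.1 (hk0 a ha P)
    have h2 : a * x * a⁻¹ * x⁻¹ = 1 := by
      apply hk1
      · rw [map_mul, map_mul, map_mul, map_inv, map_inv, ha, one_mul, inv_one, mul_one, mul_inv_cancel]
      · apply mul_mem _ (inv_mem hxP)
        exact (Subgroup.mem_normalizer_iff.1 h1 x).1 hxP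
    rwa [mul_inv_eq_one, mul_inv_eq_iff_eq_mul] at h2
  -- action of y
  have hyk : ∀ k : ZMod 7, y • E0 k = E0 ((2 * k : ZMod 7) : OnePoint (ZMod 7)) := by
    intro k
    have h1 : (2 * k : ZMod 7) = ((2 * k.val : ℕ) : ZMod 7) := by
      push_cast
      rw [ZMod.natCast_zmod_val]
    rw [h1, hE0n, hE0k, pow_mul, ← hyx, conj_pow, mul_smul, mul_smul]
    congr 2
    rw [eq_inv_smul_iff, hyQ]
  have hyfix : ∀ R : Sylow 7 N, y • R = R → R = P ∨ R = Q := by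
    intro R hR
    obtain ⟨p, rfl⟩ := hbij.2 R
    induction p using OnePoint.rec with
    | infty => exact Or.inl rfl
    | coe k =>
      right
      rw [hyk] at hR
      have h1 := OnePoint.coe_injective (hinj hR)
      have h2 : k = 0 := by clear hR; revert k; decide
      rw [h2, hE0k]
      simp
  have ht1 : t * t = 1 := by rw [← sq, ← ht, pow_orderOf_eq_one]
  have htt : ∀ R : Sylow 7 N, t • t • R = R := fun R => by rw [smul_smul, ht1, one_smul]
  have htnf : ∀ R : Sylow 7 N, t • R ≠ R := by
    intro R h
    have h1 := Sylow.smul_eq_iff_mem_normalizer.1 h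
    have h2 := Subgroup.orderOf_dvd_natCard _ h1
    rw [hnorm R, ht] at h2
    omega
  have hyt : y * t = t * y ^ 2 := by
    rw [← hty]
    have : t⁻¹ = t := inv_eq_of_mul_eq_one_left ht1
    rw [this, ← mul_assoc, ← mul_assoc, ht1, one_mul]
  have hty' : t * y = y ^ 2 * t := mul_inv_eq_iff_eq_mul.1 hty
  have htP : t • P = Q := by
    refine (hyfix (t • P) ?_).resolve_left (htnf P)
    rw [smul_smul, hyt, sq, mul_smul, mul_smul, hyP, hyP]
  have htQ : t • Q = P := by rw [← htP, htt]
  have hQ0 : E0 ((0 : ZMod 7) : OnePoint (ZMod 7)) = Q := by rw [hE0k]; simp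
  have hh : ∀ k : ZMod 7, ∃ l : ZMod 7, k ≠ 0 → t • E0 k = E0 l := by
    intro k
    by_cases hk : k = 0
    · exact ⟨0, fun h => absurd hk h⟩
    obtain ⟨p, hp⟩ := hbij.2 (t • E0 k)
    induction p using OnePoint.rec with
    | infty => 
      exfalso
      rw [hE0i] at hp
      have h1 : t • P = E0 k := by rw [hp, htt]
      rw [htP, ← hQ0] at h1
      exact hk (OnePoint.coe_injective (hinj h1)).symm
    | coe l => exact ⟨l, fun _ => hp.symm⟩
  choose h hh using hh
  have hh0 : ∀ k, k ≠ 0 → h k ≠ 0 := by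
    intro k hk h0
    have h1 := hh k hk
    rw [h0, hQ0] at h1
    have h2 := htt (E0 k)
    rw [h1, htQ] at h2
    exact hE1 _ h2.symm
  obtain ⟨c, hc, hck⟩ := involution_formula h hh0
    (fun k hk he => htnf (E0 k) (by rw [hh k hk, he])) 
    (fun k hk => by
      have h1 := hh k hk
      have h2 := hh (h k) (hh0 k hk)
      rw [← h1, htt] at h2
      exact (OnePoint.coe_injective (hinj h2)).symm) 
    (fun k hk => by
      have hk2 : 2 * k ≠ 0 := by revert k; decide
      have h1 := hh (2 * k) hk2
      rw [← hyk, smul_smul, hty', mul_smul, hh k hk, sq, mul_smul, hyk, hyk] at h1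
      have h2 := OnePoint.coe_injective (hinj h1)
      rw [← h2, ← mul_assoc]
      congr 1)
  refine psl_core hn f hfaith x y t hx hy c hc ?_ ?_ ?_ ?_ ?_ ?_ ?_
  · exact hfE _ _ _ (hPfix x hxP)
  · intro k
    apply hfE
    have h1 : (k + 1 : ZMod 7) = ((k.val + 1 : ℕ) : ZMod 7) := by
      push_cast
      rw [ZMod.natCast_zmod_val]
    rw [h1, hE0n, hE0k, pow_succ', mul_smul]
  · exact hfE _ _ _ hyP
  · exact fun k => hfE _ _ _ (hyk k)
  · apply hfE
    rw [hQ0, hE0i, htP]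
  · apply hfE
    rw [hQ0, hE0i, htQ]
  · intro k hk
    apply hfE
    rw [hh k hk, hck k hk]

theorem classify (S : Setup N χ) : 
    Nonempty (N ≃* alternatingGroup (Fin 5)) ∨ Nonempty (N ≃* PSL27) := by
  rcases S.numerics with ⟨h1, h2⟩ | ⟨h1, h2⟩
  · exact Or.inl (S.case60 h1 h2)
  · exact Or.inr (S.case168 h1 h2)

end Setup


structure Lin {N V : Type} [Group N] [NormedAddCommGroup V] [InnerProductSpace ℂ V]
    (ρ : N →* Module.End ℂ V) : Prop where
  perf : commutator N = ⊤
  iso : ∀ g v w, inner ℂ (ρ g v) (ρ g w) = inner ℂ v w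
  dim : finrank ℂ V = 3
  irr : ∀ W : Submodule ℂ V, (∀ g, ∀ w ∈ W, ρ g w ∈ W) → W ≠ ⊥ → W = ⊤
  scal : ∀ (g : N) (c : ℂ), (∀ v, ρ g v = c • v) → g = 1

namespace Lin
variable {N V : Type} [Group N] [NormedAddCommGroup V] [InnerProductSpace ℂ V]
  {ρ : N →* Module.End ℂ V}

theorem fd (L : Lin ρ) : FiniteDimensional ℂ V := 
  FiniteDimensional.of_finrank_pos (by rw [L.dim]; norm_num)

theorem nrm (L : Lin ρ) (g : N) (v : V) : ‖ρ g v‖ = ‖v‖ := by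
  rw [norm_eq_sqrt_re_inner (𝕜 := ℂ), L.iso, ← norm_eq_sqrt_re_inner]

theorem mulv (g h : N) (v : V) : ρ (g * h) v = ρ g (ρ h v) := by rw [map_mul]; rfl

theorem inv_mulv (g : N) (v : V) : ρ g⁻¹ (ρ g v) = v := by
  rw [← mulv, inv_mul_cancel, map_one]; rfl

theorem mul_invv (g : N) (v : V) : ρ g (ρ g⁻¹ v) = v := by
  rw [← mulv, mul_inv_cancel, map_one]; rfl

theorem eig_norm (L : Lin ρ) {g : N} {v : V} {c : ℂ} (hv : v ≠ 0) (h : ρ g v = c • v) : ‖c‖ = 1 := by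
  have h1 := L.nrm g v
  rw [h, norm_smul] at h1
  have h2 : ‖v‖ ≠ 0 := norm_ne_zero_iff.2 hv
  exact (mul_eq_right₀ h2).1 h1

theorem eig_orth (L : Lin ρ) {g : N} {v w : V} {c d : ℂ} (h : ρ g v = c • v) (h' : ρ g w = d • w)
    (hcd : c ≠ d) : inner ℂ v w = (0 : ℂ) := by
  by_cases hv : v = 0
  · rw [hv, inner_zero_left]
  have hc := L.eig_norm hv h
  have h1 := L.iso g v w
  rw [h, h', inner_smul_left, inner_smul_right] at h1
  by_contra h0
  apply hcd
  have h2 : (starRingEnd ℂ) c * d = 1 := by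
    apply mul_right_cancel₀ h0
    rw [mul_assoc, h1, one_mul]
  have h3 : c * (starRingEnd ℂ) c = 1 := by
    rw [Complex.mul_conj, Complex.normSq_eq_norm_sq, hc]; simp
  calc c = c * ((starRingEnd ℂ) c * d) := by rw [h2, mul_one]
    _ = d := by rw [← mul_assoc, h3, one_mul]

theorem perf_small (hp : commutator N = ⊤) {α : Type} [Finite α] (h3 : Nat.card α ≤ 3)
    (f : N →* Equiv.Perm α) (x : N) : f x = 1 := by
  have : Fintype α := Fintype.ofFinite α
  obtain ⟨e⟩ : Nonempty (α ↪ Fin 3) := by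
    rw [Function.Embedding.nonempty_iff_card_le, Fintype.card_fin, ← Nat.card_eq_fintype_card]
    exact h3
  have h := Setup.perf_perm3 hp ((Equiv.Perm.viaEmbeddingHom e).comp f) x
  apply Equiv.Perm.viaEmbeddingHom_injective e
  rw [map_one]
  exact h

def wt (ρ : N →* Module.End ℂ V) (K : Subgroup N) (l : N → ℂ) : Submodule ℂ V where
  carrier := {u | ∀ k ∈ K, ρ k u = l k • u}
  add_mem' := by
    intro a b ha hb k hk
    rw [map_add, ha k hk, hb k hk, smul_add]
  zero_mem' := by
    intro k hk
    rw [map_zero, smul_zero]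
  smul_mem' := by
    intro c x hx k hk
    rw [map_smul, hx k hk, smul_comm]

def WtSp (ρ : N →* Module.End ℂ V) (K : Subgroup N) : Type := 
  {W : Submodule ℂ V // W ≠ ⊥ ∧ ∃ l, W = wt ρ K l}

theorem map_wt (K : Subgroup N) [hK : K.Normal] (l : N → ℂ) (n : N) : 
    (wt ρ K l).map (ρ n) = wt ρ K (fun k => l (n⁻¹ * k * n)) := by
  ext u
  rw [Submodule.mem_map]
  constructor
  · rintro ⟨w, hw, rfl⟩ k hk
    have := hw (n⁻¹ * k * n) (by simpa using hK.conj_mem k hk n⁻¹)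
    simp only
    rw [← map_smul, ← this, ← mulv, ← mulv]
    congr 2
    group
  · intro hu
    refine ⟨ρ n⁻¹ u, fun k hk => ?_, mul_invv n u⟩
    have := hu (n * k * n⁻¹) (hK.conj_mem k hk n)
    simp only at this
    rw [show n⁻¹ * (n * k * n⁻¹) * n = k by group] at this
    rw [← map_smul, ← this, ← mulv, ← mulv]
    congr 2
    group

@[reducible] def wtAct (ρ : N →* Module.End ℂ V) (K : Subgroup N) [K.Normal] : MulAction N (WtSp ρ K) where
  smul n W := ⟨W.1.map (ρ n), by
    obtain ⟨W, hW, l, hl⟩ := W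
    refine ⟨?_, ?_⟩
    · intro h
      apply hW
      rw [eq_bot_iff]
      intro w hw
      have h2 : ρ n w ∈ Submodule.map (ρ n) W := Submodule.mem_map_of_mem hw
      have this : ρ n w ∈ (⊥ : Submodule ℂ V) := h.le h2
      rw [Submodule.mem_bot] at this
      rw [Submodule.mem_bot, ← inv_mulv (ρ := ρ) n w, this, map_zero]
    · subst hl; exact ⟨_, map_wt K l n⟩⟩
  one_smul W := by
    apply Subtype.ext
    change W.1.map (ρ 1) = W.1
    rw [map_one]
    exact Submodule.map_id _
  mul_smul a b W := by
    apply Subtype.ext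
    change W.1.map (ρ (a * b)) = (W.1.map (ρ b)).map (ρ a)
    rw [map_mul]
    exact Submodule.map_comp _ _ _

theorem wt_fin (L : Lin ρ) (K : Subgroup N) : Finite (WtSp ρ K) ∧ Nat.card (WtSp ρ K) ≤ 3 := by
  have := L.fd
  have hex : ∀ W : WtSp ρ K, ∃ u : V, u ∈ W.1 ∧ u ≠ 0 := fun W => 
    Submodule.exists_mem_ne_zero_of_ne_bot W.2.1
  choose u hu hu0 using hex
  have hli : LinearIndependent ℂ u := by
    apply linearIndependent_of_ne_zero_of_inner_eq_zero hu0
    intro W W' hne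
    obtain ⟨W, hW, l, rfl⟩ := W
    obtain ⟨W', hW', l', rfl⟩ := W'
    have hex : ∃ k ∈ K, l k ≠ l' k := by
      by_contra hcon
      push Not at hcon
      apply hne
      apply Subtype.ext
      ext w
      exact forall₂_congr fun k hk => by rw [hcon k hk]
    obtain ⟨k, hk, hkl⟩ := hex
    have h1 := hu ⟨wt ρ K l, ⟨hW, l, rfl⟩⟩
    have h2 := hu ⟨wt ρ K l', ⟨hW', l', rfl⟩⟩
    exact L.eig_orth (h1 k hk) (h2 k hk) hkl
  have hf : Finite (WtSp ρ K) := hli.finite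
  refine ⟨hf, ?_⟩
  have : Fintype (WtSp ρ K) := Fintype.ofFinite _
  rw [Nat.card_eq_fintype_card, ← L.dim]
  exact hli.fintype_card_le_finrank

theorem common_eig (L : Lin ρ) (K : Subgroup N) [K.Normal] {v : V} (hv : v ≠ 0)
    (h : ∀ k ∈ K, ∃ c : ℂ, ρ k v = c • v) : K = ⊥ := by
  classical
  choose! l hl using h
  let W : WtSp ρ K := ⟨wt ρ K l, by
    intro h
    apply hv
    have : v ∈ wt ρ K l := hl
    rw [h] at this
    exact this, l, rfl⟩
  obtain ⟨hf, hc⟩ := L.wt_fin K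
  let _ := wtAct ρ K
  have hW : ∀ n : N, n • W = W := fun n => by
    have := perf_small L.perf hc (MulAction.toPermHom N (WtSp ρ K)) n
    exact congrArg (fun f : Equiv.Perm (WtSp ρ K) => f W) this
  have htop := L.irr W.1 (fun g w hw => by
    have h1 := congrArg Subtype.val (hW g)
    change W.1.map (ρ g) = W.1 at h1
    rw [← h1]
    exact Submodule.mem_map_of_mem hw) W.2.1
  rw [eq_bot_iff]
  intro k hk
  rw [Subgroup.mem_bot]
  apply L.scal k (l k)
  intro u
  have : u ∈ W.1 := htop ▸ Submodule.mem_top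
  exact this k hk

/-- if `v` is an eigenvector of all conjugates of `g` then `g = 1` -/
theorem conj_eig (L : Lin ρ) (g : N) {v : V} (hv : v ≠ 0)
    (h : ∀ x, ∃ c : ℂ, ρ (x * g * x⁻¹) v = c • v) : g = 1 := by
  have h1 := L.common_eig (Subgroup.normalClosure {g}) hv (by
    intro k hk
    refine Subgroup.closure_induction (p := fun k _ => ∃ c : ℂ, ρ k v = c • v) ?_ ?_ ?_ ?_ hk
    · intro x hx
      rw [Group.mem_conjugatesOfSet_iff] at hx
      obtain ⟨a, ha, hx⟩ := hx
      rw [Set.mem_singleton_iff] at ha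
      subst ha
      obtain ⟨c, rfl⟩ := isConj_iff.1 hx
      exact h c
    · exact ⟨1, by rw [map_one, one_smul]; rfl⟩
    · rintro x y - - ⟨c, hc⟩ ⟨d, hd⟩
      exact ⟨d * c, by rw [mulv, hd, map_smul, hc, smul_smul]⟩
    · rintro x - ⟨c, hc⟩
      have hc0 : c ≠ 0 := by
        rintro rfl
        have := L.eig_norm hv hc
        simp at this
      refine ⟨c⁻¹, ?_⟩
      rw [eq_inv_smul_iff₀ hc0, ← map_smul, ← hc, inv_mulv])
  have h2 : g ∈ Subgroup.normalClosure {g} := Subgroup.subset_normalClosure rfl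
  rw [h1] at h2
  exact h2

end Lin


namespace Lin
variable {N V : Type} [Group N] [NormedAddCommGroup V] [InnerProductSpace ℂ V]
  {ρ : N →* Module.End ℂ V}

theorem norm_proj {v u : V} (hv : ‖v‖ = 1) (hu : ‖u‖ = 1) :
    ‖u - (inner ℂ v u : ℂ) • v‖ ^ 2 = 1 - ‖(inner ℂ v u : ℂ)‖ ^ 2 := by
  rw [norm_sub_sq (𝕜 := ℂ), inner_smul_right, norm_smul, hv, hu, ← inner_conj_symm u v]
  have : (inner ℂ v u : ℂ) * (starRingEnd ℂ) (inner ℂ v u : ℂ) = ((‖(inner ℂ v u : ℂ)‖ ^ 2 : ℝ) : ℂ) := by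
    rw [Complex.mul_conj, Complex.normSq_eq_norm_sq]
  rw [this]
  have h2 : RCLike.re (((‖(inner ℂ v u : ℂ)‖ ^ 2 : ℝ) : ℂ)) = ‖(inner ℂ v u : ℂ)‖ ^ 2 := Complex.ofReal_re _
  rw [h2]
  ring

def bF (g x : N) : N := g⁻¹ * x⁻¹ * g * x

theorem bF_norm (L : Lin ρ) {g : N} {v : V} (hgv : ρ g v = v) (x : N) :
    ‖ρ (bF g x) v - v‖ = ‖ρ g (ρ x v) - ρ x v‖ := by
  rw [← L.nrm (x * g) (ρ (bF g x) v - v), map_sub, ← mulv, ← mulv, mulv x g, hgv]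
  congr 3
  rw [show x * g * bF g x = g * x by unfold bF; group]

theorem b1 (L : Lin ρ) {g : N} {v : V} (hv : ‖v‖ = 1) (hgv : ρ g v = v) 
    (hsm : ∀ w, ‖ρ g w - w‖ ≤ ‖w‖) {u : V} (hu : ‖u‖ = 1) :
    ‖ρ g u - u‖ ^ 2 ≤ 1 - ‖(inner ℂ v u : ℂ)‖ ^ 2 := by
  rw [← norm_proj hv hu]
  have h := hsm (u - (inner ℂ v u : ℂ) • v)
  rw [map_sub, map_smul, hgv] at h
  have e : ρ g u - (inner ℂ v u : ℂ) • v - (u - (inner ℂ v u : ℂ) • v) = ρ g u - u := by abel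
  rw [e] at h
  exact pow_le_pow_left₀ (norm_nonneg _) h 2

theorem d1 {u v : V} (hv : ‖v‖ = 1) (hu : ‖u‖ = 1) : ‖u - v‖ ^ 2 = 2 - 2 * (inner ℂ v u : ℂ).re := by
  rw [norm_sub_rev, norm_sub_sq (𝕜 := ℂ), hv, hu]
  have : RCLike.re (inner ℂ v u : ℂ) = (inner ℂ v u : ℂ).re := rfl
  rw [this]
  ring

theorem blich (L : Lin ρ) [Finite N] (g : N) {v : V} (hv : ‖v‖ = 1) (hgv : ρ g v = v) 
    (hker : ∀ w, ρ g w = w → ∃ c : ℂ, w = c • v) (hsm : ∀ w, ‖ρ g w - w‖ ≤ ‖w‖) : g = 1 := by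
  have hv0 : v ≠ 0 := by rintro rfl; simp at hv
  have hux : ∀ x, ‖ρ x v‖ = 1 := fun x => (L.nrm x v).trans hv
  have hle1 : ∀ x, ‖ρ (bF g x) v - v‖ ^ 2 ≤ 1 := by
    intro x
    rw [L.bF_norm hgv]
    have := L.b1 hv hgv hsm (hux x)
    nlinarith [norm_nonneg (inner ℂ v (ρ x v) : ℂ)]
  have hdec : ∀ x, ρ x v ≠ v → ‖ρ (bF g x) v - v‖ ^ 2 < ‖ρ x v - v‖ ^ 2 := by
    intro x hx
    rw [L.bF_norm hgv, d1 hv (hux x)]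
    refine lt_of_le_of_lt (L.b1 hv hgv hsm (hux x)) ?_
    set c : ℂ := inner ℂ v (ρ x v) with hc
    rw [← Complex.normSq_eq_norm_sq, Complex.normSq_apply]
    have h2 : ‖ρ x v - v‖ ^ 2 = 2 - 2 * c.re := d1 hv (hux x)
    have h3 : 0 < ‖ρ x v - v‖ ^ 2 := by
      have := norm_pos_iff.2 (sub_ne_zero.2 hx)
      positivity
    have h4 : 0 < (1 - c.re) ^ 2 := by
      have : 1 - c.re ≠ 0 := by linarith
      positivity
    nlinarith [mul_self_nonneg c.im]
  have hfixed : ∀ x, ρ x v = v → ρ (bF g x) v = v := by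
    intro x hx
    have := L.bF_norm hgv x
    rw [hx, hgv, sub_self, norm_zero, norm_eq_zero, sub_eq_zero] at this
    exact this
  have hex : ∀ x, ∃ k : ℕ, ρ ((bF g)^[k] x) v = v := by
    intro x
    by_contra hcon
    push Not at hcon
    have hanti : StrictAnti (fun k : ℕ => ‖ρ ((bF g)^[k] x) v - v‖ ^ 2) := by
      apply strictAnti_nat_of_succ_lt
      intro k
      rw [Function.iterate_succ_apply']
      exact hdec _ (hcon k)
    have hinj : Function.Injective (fun k : ℕ => (bF g)^[k] x) := by
      intro i j hij
      apply hanti.injective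
      simp only at hij ⊢
      rw [hij]
    exact not_injective_infinite_finite _ hinj
  have hpar : ∀ x, ρ (bF g x) v = v → ∃ c : ℂ, ρ x v = c • v := by
    intro x hx
    apply hker
    have := L.bF_norm hgv x
    rw [hx, sub_self, norm_zero, eq_comm, norm_eq_zero, sub_eq_zero] at this
    exact this
  have heig : ∀ (x : N) (c : ℂ), ρ (bF g x) v = c • v → ρ g (ρ x v) = c • ρ x v := by
    intro x c hc
    have h1 : ρ (x * g) (ρ (bF g x) v) = ρ g (ρ x v) := by
      rw [← mulv, ← mulv]
      congr 2
      unfold bF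
      group
    rw [← h1, hc, map_smul, mulv, hgv]
  have hstep : ∀ x, ρ (bF g (bF g (bF g x))) v = v → ρ (bF g (bF g x)) v = v := by
    intro x hx
    obtain ⟨c, hc⟩ := hpar _ hx
    have h1 := heig _ c hc
    by_cases hc1 : c = 1
    · rw [hc, hc1, one_smul]
    · exfalso
      have h2 := L.eig_orth (v := v) (c := 1) (by rw [hgv, one_smul]) h1 (Ne.symm hc1)
      have h3 := d1 hv (hux (bF g x))
      rw [h2] at h3
      have h4 := hle1 x
      rw [h3] at h4
      norm_num at h4
  have hall : ∀ (k : ℕ) (x : N), ρ ((bF g)^[k] x) v = v → ρ (bF g (bF g x)) v = v := by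
    intro k
    induction k with
    | zero => 
      intro x hx
      exact hfixed _ (hfixed _ hx)
    | succ k ih =>
      intro x hx
      rw [Function.iterate_succ_apply] at hx
      exact hstep x (ih _ hx)
  apply L.conj_eig g hv0
  intro x
  obtain ⟨k, hk⟩ := hex x⁻¹
  have h1 := hall k _ hk
  obtain ⟨c, hc⟩ := hpar _ h1
  have h2 := heig _ c hc
  refine ⟨c, ?_⟩
  rw [mulv, mulv, h2, map_smul, mul_invv]

end Lin


namespace Lin
variable {N V : Type} [Group N] [NormedAddCommGroup V] [InnerProductSpace ℂ V]
  {ρ : N →* Module.End ℂ V}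

theorem proj_diff {r p : V} (hr : ‖r‖ = 1) (hp : ‖p‖ = 1) (u : V) :
    ‖(inner ℂ r u : ℂ) • r - (inner ℂ p u : ℂ) • p‖ ^ 2 ≤ (1 - ‖(inner ℂ r p : ℂ)‖ ^ 2) * ‖u‖ ^ 2 := by
  have hrr : (inner ℂ r r : ℂ) = 1 := by rw [inner_self_eq_norm_sq_to_K, hr]; simp
  have hcs := norm_inner_le_norm (𝕜 := ℂ) (p - (inner ℂ r p : ℂ) • r) (u - (inner ℂ r u : ℂ) • r)
  have h1 : (inner ℂ (p - (inner ℂ r p : ℂ) • r) (u - (inner ℂ r u : ℂ) • r) : ℂ) = 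
      inner ℂ p u - (starRingEnd ℂ) (inner ℂ r p) * inner ℂ r u := by
    simp only [inner_sub_left, inner_sub_right, inner_smul_left, inner_smul_right, hrr]
    rw [← inner_conj_symm p r]
    ring
  have h2 := norm_proj hr hp
  have h3 : ‖u - (inner ℂ r u : ℂ) • r‖ ^ 2 = ‖u‖ ^ 2 - ‖(inner ℂ r u : ℂ)‖ ^ 2 := by
    rw [norm_sub_sq (𝕜 := ℂ), inner_smul_right, norm_smul, hr, ← inner_conj_symm u r, Complex.mul_conj,
      Complex.normSq_eq_norm_sq]
    have : RCLike.re (((‖(inner ℂ r u : ℂ)‖ ^ 2 : ℝ) : ℂ)) = ‖(inner ℂ r u : ℂ)‖ ^ 2 := Complex.ofReal_re _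
    rw [this]
    ring
  have h4 := pow_le_pow_left₀ (norm_nonneg _) hcs 2
  rw [mul_pow, h1, h2, h3] at h4
  have h5 : ‖(inner ℂ r u : ℂ) • r - (inner ℂ p u : ℂ) • p‖ ^ 2 = ‖(inner ℂ r u : ℂ)‖ ^ 2 + 
      ‖(inner ℂ p u : ℂ)‖ ^ 2 - 2 * ((starRingEnd ℂ) (inner ℂ r u) * (inner ℂ p u * inner ℂ r p)).re := by
    rw [norm_sub_sq (𝕜 := ℂ), inner_smul_right, inner_smul_left, norm_smul, norm_smul, hr, hp]
    have e : ∀ z : ℂ, RCLike.re z = z.re := fun _ => rfl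
    rw [e, show (inner ℂ p u : ℂ) * ((starRingEnd ℂ) (inner ℂ r u) * inner ℂ r p) = 
      (starRingEnd ℂ) (inner ℂ r u) * (inner ℂ p u * inner ℂ r p) by ring]
    ring
  rw [h5]
  generalize (inner ℂ r u : ℂ) = α at *
  generalize (inner ℂ p u : ℂ) = β at *
  generalize (inner ℂ r p : ℂ) = z at *
  simp only [← Complex.normSq_eq_norm_sq, Complex.normSq_apply, Complex.mul_re, Complex.mul_im, 
    Complex.sub_re, Complex.sub_im, Complex.conj_re, Complex.conj_im] at h4 ⊢
  linarith

theorem homology (L : Lin ρ) [Finite N] {g : N} {r : V} {a ζ : ℂ} (hr : ‖r‖ = 1) (hζ : ‖ζ‖ = 1)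
    (h1 : ζ ≠ 1) (hre : 0 ≤ ζ.re) 
    (hg : ∀ w, ρ g w = a • (w + ((ζ - 1) * (inner ℂ r w : ℂ)) • r)) : False := by
  have := L.fd
  have hr0 : r ≠ 0 := by rintro rfl; simp at hr
  have hrr : (inner ℂ r r : ℂ) = 1 := by rw [inner_self_eq_norm_sq_to_K, hr]; simp
  have hgr : ρ g r = (a * ζ) • r := by
    rw [hg, hrr, smul_add, smul_smul, ← add_smul]
    congr 1; ring
  have ha : ‖a‖ = 1 := by
    have := L.eig_norm hr0 hgr
    rwa [norm_mul, hζ, mul_one] at this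
  have ha0 : a ≠ 0 := by rintro rfl; simp at ha
  have hux : ∀ x, ‖ρ x r‖ = 1 := fun x => (L.nrm x r).trans hr
  have hconj : ∀ x w, ρ (x * g * x⁻¹) w = a • (w + ((ζ - 1) * (inner ℂ (ρ x r) w : ℂ)) • ρ x r) := by
    intro x w
    have e : (inner ℂ (ρ x r) w : ℂ) = inner ℂ r (ρ x⁻¹ w) := by
      rw [← L.iso x r, mul_invv]
    rw [mulv, mulv, hg, map_smul, map_add, map_smul, mul_invv, e]
  have hex : ∃ x, ‖(inner ℂ r (ρ x r) : ℂ)‖ ≠ 0 ∧ ‖(inner ℂ r (ρ x r) : ℂ)‖ ^ 2 ≠ 1 := by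
    by_contra hcon
    push Not at hcon
    have hg1 : g = 1 := by
      apply L.conj_eig g hr0
      intro x
      by_cases h0 : ‖(inner ℂ r (ρ x r) : ℂ)‖ = 0
      · refine ⟨a, ?_⟩
        rw [hconj, ← inner_conj_symm, norm_eq_zero.1 h0]
        simp
      · have h2 := norm_proj hr (hux x)
        rw [hcon x h0, sub_self, sq_eq_zero_iff, norm_eq_zero, sub_eq_zero] at h2
        have h3 : ρ (x * g * x⁻¹) r = (a * (1 + (ζ - 1) * inner ℂ (ρ x r) r * inner ℂ r (ρ x r))) • r := by
          rw [hconj]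
          nth_rewrite 2 [h2]
          rw [smul_smul, mul_smul a, add_smul, one_smul]
        exact ⟨_, h3⟩
    subst hg1
    have hne : (ℂ ∙ r)ᗮ ≠ ⊥ := by
      intro hb
      rw [Submodule.orthogonal_eq_bot_iff] at hb
      have h3 := finrank_span_singleton (K := ℂ) hr0
      rw [hb, finrank_top, L.dim] at h3
      norm_num at h3
    obtain ⟨w, hw, hw0⟩ := Submodule.exists_mem_ne_zero_of_ne_bot hne
    rw [Submodule.mem_orthogonal_singleton_iff_inner_right] at hw
    have h3 := hg w
    rw [hw, mul_zero, zero_smul, add_zero, map_one] at h3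
    have ha1 : a = 1 := by
      have : (1 : ℂ) • w = a • w := by rw [one_smul]; exact h3
      exact (smul_left_injective ℂ hw0 this).symm
    rw [map_one, ha1, one_mul] at hgr
    have : (1 : ℂ) • r = ζ • r := by rw [one_smul]; exact hgr
    exact h1 (smul_left_injective ℂ hr0 this).symm
  obtain ⟨x, hc0, hc1⟩ := hex
  set p := ρ x r with hp
  have hpn : ‖p‖ = 1 := hux x
  have hrn : ‖ρ g p‖ = 1 := (L.nrm _ _).trans hpn
  have hpp : (inner ℂ p p : ℂ) = 1 := by rw [inner_self_eq_norm_sq_to_K, hpn]; simp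
  have hqq : (inner ℂ (ρ g p) (ρ g p) : ℂ) = 1 := by rw [L.iso]; exact hpp
  set C := ‖(inner ℂ r p : ℂ)‖ ^ 2 with hC
  have hC0 : 0 < C := by have := norm_nonneg (inner ℂ r p : ℂ); positivity
  have hC1 : C < 1 := by
    have := norm_inner_le_norm (𝕜 := ℂ) r p
    rw [hr, hpn, mul_one] at this
    have h2 : C ≤ 1 := by rw [hC]; nlinarith [norm_nonneg (inner ℂ r p : ℂ)]
    exact lt_of_le_of_ne h2 hc1
  have hζ2 : ζ.re * ζ.re + ζ.im * ζ.im = 1 := by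
    rw [← Complex.normSq_apply, Complex.normSq_eq_norm_sq, hζ]; norm_num
  have hκ : ζ.re < 1 := by
    by_contra hcon
    push Not at hcon
    have h2 : ζ.im = 0 := by nlinarith [mul_self_nonneg ζ.im]
    have h3 : ζ.re = 1 := by rw [h2] at hζ2; nlinarith
    exact h1 (Complex.ext h3 h2)
  set z : ℂ := inner ℂ (ρ g p) p with hz
  have hz2 : 1 - ‖z‖ ^ 2 = 2 * (1 - ζ.re) * (C * (1 - C)) := by
    have : z = (starRingEnd ℂ) a * (1 + (starRingEnd ℂ) (ζ - 1) * (C : ℝ)) := by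
      rw [hz, hg, inner_smul_left, inner_add_left, inner_smul_left, hpp, hC, ← Complex.normSq_eq_norm_sq,
        ← Complex.mul_conj, map_mul]
      ring
    rw [this, norm_mul, Complex.norm_conj, ha, one_mul, ← Complex.normSq_eq_norm_sq, Complex.normSq_apply]
    simp only [Complex.add_re, Complex.add_im, Complex.mul_re, Complex.mul_im, Complex.conj_re, Complex.conj_im,
      Complex.sub_re, Complex.sub_im, Complex.one_re, Complex.one_im, Complex.ofReal_re, Complex.ofReal_im]
    linear_combination (-C^2) * hζ2
  have hs0 : 0 < 1 - ‖z‖ ^ 2 := by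
    rw [hz2]
    have : 0 < 1 - ζ.re := by linarith
    have : 0 < 1 - C := by linarith
    positivity
  set q := (g * x) * g * (g * x)⁻¹ * (x * g * x⁻¹)⁻¹ with hq
  set h2 := x * g * x⁻¹ with hh2
  have hform : ∀ u, ρ q (ρ h2 u) - ρ h2 u = (a * (ζ - 1)) • ((inner ℂ (ρ g p) u : ℂ) • ρ g p - (inner ℂ p u : ℂ) • p) := by
    intro u
    rw [← mulv, hq, inv_mul_cancel_right, hconj, hh2, hconj, mulv, ← hp, ← smul_sub, add_sub_add_left_eq_sub,
      mul_smul a, smul_sub (ζ - 1), smul_smul, smul_smul]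
  have hζ1 : ζ - 1 ≠ 0 := sub_ne_zero.2 h1
  have hk : ∀ u, ρ q (ρ h2 u) = ρ h2 u → (inner ℂ (ρ g p) u : ℂ) = 0 ∧ (inner ℂ p u : ℂ) = 0 := by
    intro u hu
    have h3 := hform u
    rw [hu, sub_self, eq_comm, smul_eq_zero, or_iff_right (mul_ne_zero ha0 hζ1), sub_eq_zero] at h3
    have h4 := congrArg (fun w => (inner ℂ (ρ g p) w : ℂ)) h3
    have h5 := congrArg (fun w => (inner ℂ p w : ℂ)) h3
    simp only [inner_smul_right, hqq, hpp, ← hz, mul_one] at h4 h5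
    rw [← inner_conj_symm p, ← hz] at h5
    have h6 : (inner ℂ (ρ g p) u : ℂ) * ((1 - ‖z‖ ^ 2 : ℝ) : ℂ) = 0 := by
      rw [← Complex.normSq_eq_norm_sq]
      push_cast
      rw [← Complex.mul_conj]
      linear_combination h4 - z * h5
    have h7 : (inner ℂ (ρ g p) u : ℂ) = 0 := 
      (mul_eq_zero.1 h6).resolve_right (by exact_mod_cast hs0.ne')
    rw [h7, zero_mul] at h5
    exact ⟨h7, h5.symm⟩
  have hli : LinearIndependent ℂ ![ρ g p, p] := by
    rw [LinearIndependent.pair_iff]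
    intro s t hst
    have h4 := congrArg (fun w => (inner ℂ (ρ g p) w : ℂ)) hst
    have h5 := congrArg (fun w => (inner ℂ p w : ℂ)) hst
    simp only [inner_add_right, inner_smul_right, hqq, hpp, ← hz, mul_one, inner_zero_right] at h4 h5
    rw [← inner_conj_symm p, ← hz] at h5
    have h6 : s * ((1 - ‖z‖ ^ 2 : ℝ) : ℂ) = 0 := by
      rw [← Complex.normSq_eq_norm_sq]
      push_cast
      rw [← Complex.mul_conj]
      linear_combination h4 - z * h5
    have h7 : s = 0 := (mul_eq_zero.1 h6).resolve_right (by exact_mod_cast hs0.ne')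
    rw [h7, zero_mul, zero_add] at h5
    exact ⟨h7, h5⟩
  have hfr : finrank ℂ (Submodule.span ℂ (Set.range ![ρ g p, p]))ᗮ = 1 := by
    have h3 := finrank_span_eq_card hli
    have h4 := Submodule.finrank_add_finrank_orthogonal (Submodule.span ℂ (Set.range ![ρ g p, p]))
    rw [h3, L.dim, Fintype.card_fin] at h4
    omega
  have hperp : ∀ w, w ∈ (Submodule.span ℂ (Set.range ![ρ g p, p]))ᗮ ↔ 
      (inner ℂ (ρ g p) w : ℂ) = 0 ∧ (inner ℂ p w : ℂ) = 0 := by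
    intro w
    rw [Submodule.mem_orthogonal]
    constructor
    · intro h
      exact ⟨h _ (Submodule.subset_span ⟨0, rfl⟩), h _ (Submodule.subset_span ⟨1, rfl⟩)⟩
    · rintro ⟨ha, hb⟩ u hu
      rw [Matrix.range_cons, Matrix.range_cons, Matrix.range_empty, Set.union_empty, Set.singleton_union, 
        Submodule.mem_span_pair] at hu
      obtain ⟨s, t, rfl⟩ := hu
      rw [inner_add_left, inner_smul_left, inner_smul_left, ha, hb]
      simp
  obtain ⟨⟨v, hv⟩, hv0, hvs⟩ := finrank_eq_one_iff'.1 hfr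
  have hv0' : v ≠ 0 := fun h => hv0 (Subtype.ext h)
  have hv1 := (hperp v).1 hv
  have hh2v : ∀ u, (inner ℂ p u : ℂ) = 0 → ρ h2 u = a • u := by
    intro u hu
    rw [hh2, hconj, ← hp, hu]
    simp
  have hqv : ρ q v = v := by
    have h3 := hform v
    rw [hv1.1, hv1.2, hh2v v hv1.2, map_smul, ← smul_sub] at h3
    simp only [zero_smul, sub_self, smul_zero, smul_eq_zero, ha0, false_or] at h3
    exact sub_eq_zero.1 h3
  have hn0 : (‖v‖ : ℂ) ≠ 0 := by exact_mod_cast norm_ne_zero_iff.2 hv0'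
  have hq1 : q = 1 := by
    refine L.blich q (v := (‖v‖ : ℂ)⁻¹ • v) ?_ ?_ ?_ ?_
    · rw [norm_smul, norm_inv, Complex.norm_real, norm_norm, inv_mul_cancel₀ (norm_ne_zero_iff.2 hv0')]
    · rw [map_smul, hqv]
    · intro w hw
      have h3 := hk (ρ h2⁻¹ w) (by rw [mul_invv, hw])
      have h4 := hh2v _ h3.2
      rw [mul_invv] at h4
      obtain ⟨c, hc⟩ := hvs ⟨_, (hperp _).2 h3⟩
      have hc' : c • v = ρ h2⁻¹ w := congrArg Subtype.val hc
      refine ⟨a * c * ‖v‖, ?_⟩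
      rw [h4, ← hc', smul_smul, smul_smul, mul_assoc (a * c), mul_inv_cancel₀ hn0, mul_one]
    · intro w
      have h3 := hform (ρ h2⁻¹ w)
      rw [mul_invv] at h3
      have h4 := proj_diff hrn hpn (ρ h2⁻¹ w)
      rw [L.nrm, ← hz, hz2] at h4
      rw [h3, norm_smul, norm_mul, ha, one_mul]
      have h5 : ‖ζ - 1‖ ^ 2 = 2 * (1 - ζ.re) := by
        rw [← Complex.normSq_eq_norm_sq, Complex.normSq_apply]
        simp only [Complex.sub_re, Complex.sub_im, Complex.one_re, Complex.one_im]
        linear_combination hζ2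
      apply le_of_sq_le_sq _ (norm_nonneg _)
      rw [mul_pow, h5]
      have hκ0 : 0 ≤ 2 * (1 - ζ.re) := by linarith
      refine (mul_le_mul_of_nonneg_left h4 hκ0).trans ?_
      have h6 : 2 * (1 - ζ.re) * (2 * (1 - ζ.re) * (C * (1 - C))) ≤ 1 := by
        have h7 : 4 * (C * (1 - C)) ≤ 1 := by nlinarith [sq_nonneg (2 * C - 1)]
        have h8 : (1 - ζ.re) ^ 2 ≤ 1 := by nlinarith
        have h9 : 0 ≤ (1 - ζ.re) ^ 2 := sq_nonneg _
        nlinarith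
      rw [← mul_assoc]
      exact mul_le_of_le_one_left (sq_nonneg _) h6
  have := (hk (ρ g p) (by rw [hq1, map_one]; rfl)).1
  rw [hqq] at this
  exact one_ne_zero this

end Lin


namespace Lin
variable {N V : Type} [Group N] [NormedAddCommGroup V] [InnerProductSpace ℂ V]
  {ρ : N →* Module.End ℂ V}

theorem diag (L : Lin ρ) [Finite N] (g : N) : 
    ∃ (b : OrthonormalBasis (Fin 3) ℂ V) (μ : Fin 3 → ℂ), ∀ i, ρ g (b i) = μ i • b i := by
  classical
  have := L.fd
  have hss : (ρ g).IsSemisimple := by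
    refine Module.End.isSemisimple_of_squarefree_aeval_eq_zero 
      (p := Polynomial.X ^ (Nat.card N) - Polynomial.C 1) ?_ ?_
    · exact (Polynomial.separable_X_pow_sub_C (1 : ℂ) (by exact_mod_cast Nat.card_pos.ne') one_ne_zero).squarefree
    · rw [map_sub, map_pow, Polynomial.aeval_X, Polynomial.aeval_C, ← map_pow, pow_card_eq_one', map_one, map_one,
        sub_self]
  have htop := hss.iSup_eigenspace_eq_top
  have horth : OrthogonalFamily ℂ (fun μ : Module.End.Eigenvalues (ρ g) => Module.End.eigenspace (ρ g) (μ : ℂ))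
      (fun μ => (Module.End.eigenspace (ρ g) (μ : ℂ)).subtypeₗᵢ) := by
    apply OrthogonalFamily.of_pairwise
    intro i j hij
    rw [Function.onFun, Submodule.isOrtho_iff_inner_eq]
    intro u hu v hv
    rw [Module.End.mem_eigenspace_iff] at hu hv
    exact L.eig_orth hu hv (fun h => hij (Subtype.ext h))
  have hint : DirectSum.IsInternal (fun μ : Module.End.Eigenvalues (ρ g) => Module.End.eigenspace (ρ g) (μ : ℂ)) := by
    rw [horth.isInternal_iff, Submodule.orthogonal_eq_bot_iff, ← htop]
    exact iSup_ne_bot_subtype (fun μ : ℂ => Module.End.eigenspace (ρ g) μ)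
  refine ⟨hint.subordinateOrthonormalBasis L.dim horth, 
    fun i => ((hint.subordinateOrthonormalBasisIndex L.dim i horth : Module.End.Eigenvalues (ρ g)) : ℂ), fun i => ?_⟩
  exact Module.End.mem_eigenspace_iff.1 (hint.subordinateOrthonormalBasis_subordinate L.dim i horth)

theorem bb (b : OrthonormalBasis (Fin 3) ℂ V) (i j : Fin 3) : (inner ℂ (b i) (b j) : ℂ) = if i = j then 1 else 0 := 
  orthonormal_iff_ite.1 b.orthonormal i j

theorem tr_diag (L : Lin ρ) {g : N} {b : OrthonormalBasis (Fin 3) ℂ V} {μ : Fin 3 → ℂ}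
    (h : ∀ i, ρ g (b i) = μ i • b i) : LinearMap.trace ℂ V (ρ g) = ∑ i, μ i := by
  rw [LinearMap.trace_eq_sum_inner _ b]
  refine Finset.sum_congr rfl fun i _ => ?_
  rw [h, inner_smul_right, bb, if_pos rfl, mul_one]

theorem det_diag (L : Lin ρ) {g : N} {b : OrthonormalBasis (Fin 3) ℂ V} {μ : Fin 3 → ℂ}
    (h : ∀ i, ρ g (b i) = μ i • b i) : ∏ i, μ i = 1 := by
  have h1 : LinearMap.det (ρ g) = ∏ i, μ i := by
    rw [← LinearMap.det_toMatrix b.toBasis, ← Matrix.det_diagonal]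
    congr 1
    ext i j
    rw [LinearMap.toMatrix_apply]
    simp only [OrthonormalBasis.coe_toBasis, h, map_smul, Matrix.diagonal_apply]
    rw [← OrthonormalBasis.coe_toBasis, Finsupp.smul_apply, Basis.repr_self, Finsupp.single_apply]
    by_cases hij : i = j
    · subst hij; simp
    · simp [hij, Ne.symm hij]
  rw [← h1]
  have h2 := Setup.perf_comm L.perf ((LinearMap.det : Module.End ℂ V →* ℂ).comp ρ).toHomUnits (fun x y => mul_comm _ _) g
  exact congrArg Units.val h2

theorem pow_diag {g : N} {b : V} {μ : ℂ} (h : ρ g b = μ • b) (k : ℕ) : ρ (g ^ k) b = μ ^ k • b := by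
  induction k with
  | zero => simp
  | succ k ih => rw [pow_succ, mulv, h, map_smul, ih, smul_smul, pow_succ']

theorem scal_of (L : Lin ρ) {g : N} {b : OrthonormalBasis (Fin 3) ℂ V} {c : ℂ}
    (h : ∀ i, ρ g (b i) = c • b i) : g = 1 := by
  apply L.scal g c
  intro v
  have : ρ g = c • LinearMap.id := b.toBasis.ext (fun i => by simpa using h i)
  rw [this]; rfl

theorem scal_val (L : Lin ρ) {g : N} {b : OrthonormalBasis (Fin 3) ℂ V} {c : ℂ}
    (h : ∀ i, ρ g (b i) = c • b i) : c = 1 := by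
  have h1 := L.scal_of h
  have h2 := h 0
  rw [h1, map_one] at h2
  have h3 : (1 : ℂ) • b 0 = c • b 0 := by rw [one_smul]; exact h2
  exact (smul_left_injective ℂ (b.orthonormal.ne_zero 0) h3).symm

theorem nr_form {g : N} {b : OrthonormalBasis (Fin 3) ℂ V} {μ : Fin 3 → ℂ}
    (h : ∀ i, ρ g (b i) = μ i • b i) {i : Fin 3} {a ζ : ℂ} (h1 : ∀ j, j ≠ i → μ j = a) (h2 : μ i = a * ζ) (w : V) :
    ρ g w = a • (w + ((ζ - 1) * (inner ℂ (b i) w : ℂ)) • b i) := by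
  have key : ρ g = a • (LinearMap.id + (ζ - 1) • (innerₛₗ ℂ (b i)).smulRight (b i)) := by
    refine b.toBasis.ext (fun j => ?_)
    rw [OrthonormalBasis.coe_toBasis, h]
    simp only [LinearMap.smul_apply, LinearMap.add_apply, LinearMap.id_apply, LinearMap.smulRight_apply,
      innerₛₗ_apply_apply, bb]
    by_cases hj : j = i
    · subst hj
      rw [if_pos rfl, h2, one_smul, mul_smul]
      congr 1
      rw [sub_smul, one_smul]; abel
    · rw [if_neg (Ne.symm hj), h1 j hj]
      simp
  rw [key]
  simp [mul_smul]

theorem nonreg (L : Lin ρ) [Finite N] {g : N} (hg1 : g ≠ 1) {b : OrthonormalBasis (Fin 3) ℂ V} {μ : Fin 3 → ℂ}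
    (h : ∀ i, ρ g (b i) = μ i • b i) (hinj : ¬ Function.Injective μ) : 
    g ^ 2 = 1 ∧ ∑ i, μ i = -1 ∧ ∃ i, ∀ j, j ≠ i → μ j ≠ μ i := by
  obtain ⟨i, a, ha⟩ : ∃ (i : Fin 3) (a : ℂ), ∀ j, j ≠ i → μ j = a := by
    rw [Function.Injective] at hinj
    push Not at hinj
    obtain ⟨x, y, hxy, hne⟩ := hinj
    obtain ⟨z, hz⟩ : ∃ z : Fin 3, ∀ j, j ≠ z → j = x ∨ j = y := by
      clear hxy
      revert x y
      decide
    exact ⟨z, μ x, fun j hj => by rcases hz j hj with rfl | rfl <;> simp [hxy]⟩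
  have hna : μ i ≠ a := by
    intro hia
    apply hg1
    apply L.scal_of (b := b) (c := a)
    intro j
    rw [h]
    by_cases hj : j = i
    · rw [hj, hia]
    · rw [ha j hj]
  have hn : ∀ j, ‖μ j‖ = 1 := fun j => L.eig_norm (b.orthonormal.ne_zero j) (h j)
  obtain ⟨k, hk⟩ : ∃ k : Fin 3, k ≠ i := ⟨i + 1, by clear ha hna; revert i; decide⟩
  have ha1 : ‖a‖ = 1 := by rw [← ha k hk]; exact hn k
  have ha0 : a ≠ 0 := by rintro rfl; simp at ha1
  obtain ⟨ζ, hζ⟩ : ∃ ζ, μ i = a * ζ := ⟨μ i / a, by field_simp⟩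
  have hζn : ‖ζ‖ = 1 := by
    have := hn i
    rwa [hζ, norm_mul, ha1, one_mul] at this
  have hζ1 : ζ ≠ 1 := by rintro rfl; apply hna; rw [hζ, mul_one]
  have hpow : ∀ k : ℕ, ζ ^ k = 1 ∨ (ζ ^ k).re < 0 := by
    intro k
    by_contra hcon
    push Not at hcon
    refine L.homology (g := g ^ k) (r := b i) (a := a ^ k) (ζ := ζ ^ k) (b.orthonormal.norm_eq_one i) ?_ hcon.1 hcon.2 
      (nr_form (b := b) (μ := fun j => μ j ^ k) (fun j => pow_diag (h j) k) ?_ ?_)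
    · rw [norm_pow, hζn, one_pow]
    · intro j hj
      simp only [ha j hj]
    · simp only [hζ, mul_pow]
  have hdet : a ^ 3 * ζ = 1 := by
    rw [← L.det_diag h, ← Finset.mul_prod_erase _ _ (Finset.mem_univ i), hζ,
      Finset.prod_congr rfl (fun j hj => ha j (Finset.ne_of_mem_erase hj)), Finset.prod_const,
      Finset.card_erase_of_mem (Finset.mem_univ i)]
    simp; ring
  have hsum : ∑ i, μ i = a * ζ + 2 * a := by
    rw [← Finset.add_sum_erase _ _ (Finset.mem_univ i), hζ,
      Finset.sum_congr rfl (fun j hj => ha j (Finset.ne_of_mem_erase hj)), Finset.sum_const,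
      Finset.card_erase_of_mem (Finset.mem_univ i)]
    simp
  have hk : ∀ k : ℕ, ζ ^ k = 1 → ∀ j, ρ (g ^ k) (b j) = a ^ k • b j := by
    intro k hk j
    rw [pow_diag (h j)]
    by_cases hj : j = i
    · rw [hj, hζ, mul_pow, hk, mul_one]
    · rw [ha j hj]
  have hζ2 : ζ.re * ζ.re + ζ.im * ζ.im = 1 := by
    rw [← Complex.normSq_apply, Complex.normSq_eq_norm_sq, hζn]; norm_num
  have hx : ζ.re < 0 := by
    rcases hpow 1 with h1 | h1
    · exact absurd (by rwa [pow_one] at h1) hζ1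
    · rwa [pow_one] at h1
  rcases hpow 2 with h2 | h2
  · have hm : ζ = -1 := (sq_eq_one_iff.1 h2).resolve_left hζ1
    have h3 := L.scal_val (hk 2 h2)
    have h4 : a = -1 := by rw [hm] at hdet; linear_combination -hdet - a * h3
    refine ⟨L.scal_of (hk 2 h2), ?_, i, fun j hj => ?_⟩
    · rw [hsum, hm, h4]; norm_num
    · rw [ha j hj]; exact hna.symm
  · exfalso
    have e2 : (ζ ^ 2).re = ζ.re * ζ.re - ζ.im * ζ.im := by rw [sq, Complex.mul_re]
    rw [e2] at h2
    rcases hpow 3 with h3 | h3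
    · have h4 := L.scal_val (hk 3 h3)
      rw [h4, one_mul] at hdet
      exact hζ1 hdet
    · have e3 : (ζ ^ 3).re = ζ.re * (4 * (ζ.re * ζ.re) - 3) := by
        rw [pow_succ, sq, Complex.mul_re, Complex.mul_re, Complex.mul_im]
        linear_combination (-3 * ζ.re) * hζ2
      rw [e3] at h3
      nlinarith

theorem eig_line (L : Lin ρ) {g d : N} {b : OrthonormalBasis (Fin 3) ℂ V} {μ : Fin 3 → ℂ}
    (h : ∀ i, ρ g (b i) = μ i • b i) {i : Fin 3} (hi : ∀ j, j ≠ i → μ j ≠ μ i) (hd : d * g = g * d) : 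
    ρ d (b i) = (inner ℂ (b i) (ρ d (b i)) : ℂ) • b i := by
  have h1 : ρ g (ρ d (b i)) = μ i • ρ d (b i) := by
    rw [← mulv, ← hd, mulv, h, map_smul]
  conv_lhs => rw [← b.sum_repr' (ρ d (b i))]
  apply Finset.sum_eq_single i
  · intro j _ hj
    rw [L.eig_orth (h j) h1 (hi j hj), zero_smul]
  · simp

theorem isIrr (L : Lin ρ) : Representation.IsIrreducible (ρ : Representation ℂ N V) := by
  have := L.fd
  have hn : Nontrivial V := Module.nontrivial_of_finrank_pos (R := ℂ) (by rw [L.dim]; norm_num)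
  refine { exists_pair_ne := ⟨⊥, ⊤, ?_⟩, eq_bot_or_eq_top := ?_ }
  · intro h
    have := congrArg Subrepresentation.toSubmodule h
    exact bot_ne_top this
  · intro W
    by_cases hW : W.toSubmodule = ⊥
    · left; exact Subrepresentation.toSubmodule_injective hW
    · right
      exact Subrepresentation.toSubmodule_injective (L.irr W.toSubmodule (fun g w hw => W.apply_mem_toSubmodule g hw) hW)

theorem setup (L : Lin ρ) [Fintype N] (hnt : Nontrivial N) : Setup N (fun g => LinearMap.trace ℂ V (ρ g)) where
  perf := L.perf
  nontriv := hnt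
  tor := by
    intro g hg
    obtain ⟨b, μ, h⟩ := L.diag g
    have hinj : Function.Injective μ := by
      by_contra hni
      by_cases hg1 : g = 1
      · exact hg (by rw [hg1, one_pow])
      · exact hg (L.nonreg hg1 h hni).1
    have hd : ∀ (d : Subgroup.centralizer {g}) i, ρ d (b i) = (inner ℂ (b i) (ρ d (b i)) : ℂ) • b i := 
      fun d i => L.eig_line h (fun j hj e => hj (hinj e)) (Subgroup.mem_centralizer_singleton_iff.1 d.2)
    refine ⟨fun i => { toFun := fun d => inner ℂ (b i) (ρ d (b i)), map_one' := ?_, map_mul' := ?_ }, ?_, ?_, ?_, ?_⟩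
    · simp [bb]
    · intro x y
      rw [Subgroup.coe_mul, mulv, hd y i, map_smul, inner_smul_right, inner_smul_right, bb, if_pos rfl]
      ring
    · intro d
      exact LinearMap.trace_eq_sum_inner _ b
    · intro i j hij
      simp only [MonoidHom.coe_mk, OneHom.coe_mk, h, inner_smul_right, bb, if_pos, mul_one] at hij
      exact hinj hij
    · intro d
      exact L.det_diag (hd d)
    · intro d h1
      apply Subtype.ext
      apply L.scal_of (b := b) (c := 1)
      intro i
      have := hd d i
      have h2 := h1 i
      simp only [MonoidHom.coe_mk, OneHom.coe_mk] at h2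
      rwa [h2] at this
  inv := by
    intro g hg1 hg2
    obtain ⟨b, μ, h⟩ := L.diag g
    simp only [L.tr_diag h]
    refine (L.nonreg hg1 h ?_).2.1
    intro hinj
    have h2 : ∀ j, μ j = 1 ∨ μ j = -1 := by
      intro j
      have h3 := pow_diag (h j) 2
      rw [hg2, map_one] at h3
      have h4 : (1 : ℂ) • b j = μ j ^ 2 • b j := by rw [one_smul]; exact h3
      exact sq_eq_one_iff.1 (smul_left_injective ℂ (b.orthonormal.ne_zero j) h4).symm
    have h01 := hinj.ne (show (0 : Fin 3) ≠ 1 by decide)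
    have h02 := hinj.ne (show (0 : Fin 3) ≠ 2 by decide)
    have h12 := hinj.ne (show (1 : Fin 3) ≠ 2 by decide)
    rcases h2 0 with e0 | e0 <;> rcases h2 1 with e1 | e1 <;> rcases h2 2 with e2 | e2 <;> simp_all
  one := by
    simp only [map_one]
    have := L.fd
    rw [LinearMap.trace_one, L.dim]; norm_num
  conj := by
    intro x g
    rw [map_mul, LinearMap.trace_mul_comm, ← map_mul]
    congr 2
    group
  sum := by
    have := L.fd
    rw [← map_sum]
    have : ∑ g, ρ g = 0 := by
      by_contra hne
      obtain ⟨v, hv⟩ : ∃ v, (∑ g, ρ g) v ≠ 0 := by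
        by_contra hcon
        push Not at hcon
        exact hne (LinearMap.ext hcon)
      have := L.common_eig ⊤ hv (fun k _ => ⟨1, by
        rw [one_smul, LinearMap.sum_apply, map_sum]
        refine Fintype.sum_equiv (Equiv.mulLeft k) _ _ (fun g => ?_)
        rw [← mulv]; rfl⟩)
      exact top_ne_bot this
    rw [this, map_zero]
  norm := by
    have := L.fd
    have := L.isIrr
    have hc : (Nat.card N : ℂ) ≠ 0 := by exact_mod_cast Nat.card_pos.ne'
    let _ : Invertible (Nat.card N : ℂ) := invertibleOfNonzero hc
    have h := Representation.card_inv_mul_sum_char_mul_char_eq_finrank (k := ℂ) (ρ := (ρ : Representation ℂ N V)) 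
      (σ := (ρ : Representation ℂ N V))
    rw [Representation.IsIrreducible.finrank_intertwiningMap_self, inv_mul_eq_iff_eq_mul₀ hc, Nat.cast_one, mul_one, 
      Nat.card_eq_fintype_card] at h
    exact h
  abel := by
    intro K hK hc
    by_contra hne
    obtain ⟨⟨k, hk⟩, hk0⟩ := Subgroup.ne_bot_iff_exists_ne_one.1 hne
    have hk1 : k ≠ 1 := fun h => hk0 (Subtype.ext h)
    obtain ⟨b, μ, h⟩ := L.diag (k : N)
    obtain ⟨i, hi⟩ : ∃ i, ∀ j, j ≠ i → μ j ≠ μ i := by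
      by_cases hinj : Function.Injective μ
      · exact ⟨0, fun j hj e => hj (hinj e)⟩
      · exact (L.nonreg hk1 h hinj).2.2
    exact hne (L.common_eig K (b.orthonormal.ne_zero i) (fun d hd => ⟨_, L.eig_line h hi (hc d hd _ hk)⟩))

theorem classify (L : Lin ρ) [Finite N] (hnt : Nontrivial N) : 
    Nonempty (N ≃* alternatingGroup (Fin 5)) ∨ Nonempty (N ≃* PSL27) := by
  have : Fintype N := Fintype.ofFinite N
  exact (L.setup hnt).classify

end Lin


namespace CT
variable {H V W : Type} [Group H] [AddCommGroup V] [Module ℂ V] [FiniteDimensional ℂ V]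
  [AddCommGroup W] [Module ℂ W] [FiniteDimensional ℂ W]

theorem exists_core [Fintype H] (ρ : Representation ℂ H V) : 
    ∃ c : InnerProductSpace.Core ℂ V, ∀ g v w, c.inner (ρ g v) (ρ g w) = c.inner v w := by
  let e : V ≃ₗ[ℂ] EuclideanSpace ℂ (Fin (finrank ℂ V)) := LinearEquiv.ofFinrankEq _ _ (by simp)
  let c : InnerProductSpace.Core ℂ V := 
    { inner := fun v w => ∑ g : H, inner ℂ (e (ρ g v)) (e (ρ g w))
      conj_inner_symm := fun v w => by
        rw [map_sum]
        exact Finset.sum_congr rfl fun g _ => inner_conj_symm _ _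
      re_inner_nonneg := fun v => by
        rw [map_sum]
        exact Finset.sum_nonneg fun g _ => inner_self_nonneg
      add_left := fun u v w => by
        rw [← Finset.sum_add_distrib]
        exact Finset.sum_congr rfl fun g _ => by rw [map_add, map_add, inner_add_left]
      smul_left := fun u v r => by
        rw [Finset.mul_sum]
        exact Finset.sum_congr rfl fun g _ => by rw [map_smul, map_smul, inner_smul_left]
      definite := fun v hv => by
        have h1 := congrArg (RCLike.re (K := ℂ)) hv
        rw [map_sum, map_zero, Finset.sum_eq_zero_iff_of_nonneg (fun g _ => inner_self_nonneg)] at h1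
        have h2 := h1 1 (Finset.mem_univ _)
        rw [map_one, inner_self_eq_norm_sq, sq_eq_zero_iff, norm_eq_zero] at h2
        simpa using h2 }
  refine ⟨c, fun g v w => ?_⟩
  change ∑ x : H, inner ℂ (e (ρ x (ρ g v))) (e (ρ x (ρ g w))) = ∑ x : H, inner ℂ (e (ρ x v)) (e (ρ x w))
  refine Fintype.sum_equiv (Equiv.mulRight g) _ _ (fun x => ?_)
  simp

theorem char_inv [Fintype H] (ρ : Representation ℂ H V) (g : H) : 
    ρ.character g⁻¹ = (starRingEnd ℂ) (ρ.character g) := by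
  obtain ⟨c, hc⟩ := exists_core ρ
  let _ : NormedAddCommGroup V := c.toNormedAddCommGroup
  let _ : InnerProductSpace ℂ V := InnerProductSpace.ofCore c.toCore
  have hc' : ∀ v w, inner ℂ (ρ g v) (ρ g w) = inner ℂ v w := hc g
  let b := stdOrthonormalBasis ℂ V
  unfold Representation.character
  rw [LinearMap.trace_eq_sum_inner _ b, LinearMap.trace_eq_sum_inner _ b, map_sum]
  refine Finset.sum_congr rfl fun i _ => ?_
  rw [inner_conj_symm, ← hc']
  simp

/-- unnormalized product -/
def ip [Fintype H] (f f' : H → ℂ) : ℂ := ∑ g, f g * f' g⁻¹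

theorem ip_eq [Fintype H] (ρ : Representation ℂ H V) (σ : Representation ℂ H W) :
    ip σ.character ρ.character = Fintype.card H * finrank ℂ (Representation.IntertwiningMap ρ σ) := by
  have hc : (Nat.card H : ℂ) ≠ 0 := by exact_mod_cast Nat.card_pos.ne'
  let _ : Invertible (Nat.card H : ℂ) := invertibleOfNonzero hc
  have h := Representation.card_inv_mul_sum_char_mul_char_eq_finrank (k := ℂ) (ρ := ρ) (σ := σ)
  rw [inv_mul_eq_iff_eq_mul₀ hc, Nat.card_eq_fintype_card] at h
  exact h

theorem irr_norm [Fintype H] (ρ : Representation ℂ H V) (h : ρ.IsIrreducible) : 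
    ip ρ.character ρ.character = Fintype.card H := by
  rw [ip_eq, Representation.IsIrreducible.finrank_intertwiningMap_self, Nat.cast_one, mul_one]

theorem irr_orth [Fintype H] (ρ : Representation ℂ H V) (σ : Representation ℂ H W) (h : ρ.IsIrreducible) 
    (h' : σ.IsIrreducible) (hne : σ.character ≠ ρ.character) : ip σ.character ρ.character = 0 := by
  have : IsEmpty (Representation.Equiv ρ σ) := ⟨fun e => hne (Representation.char_iso e).symm⟩
  rw [ip_eq, finrank_zero_of_subsingleton, Nat.cast_zero, mul_zero]

theorem exists_proj [Fintype H] (ρ : Representation ℂ H V) (X : Subrepresentation ρ) :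
    ∃ P : Representation.IntertwiningMap ρ ρ, (∀ x ∈ X.toSubmodule, P x = x) ∧ ∀ v, P v ∈ X.toSubmodule := by
  obtain ⟨Y, hXY⟩ := exists_isCompl X
  have hc : IsCompl X.toSubmodule Y.toSubmodule := by
    constructor
    · rw [disjoint_iff, ← Subrepresentation.toSubmodule_inf, hXY.inf_eq_bot]; rfl
    · rw [codisjoint_iff, ← Subrepresentation.toSubmodule_sup, hXY.sup_eq_top]; rfl
  let p := X.toSubmodule.projection _ hc
  have hl : ∀ x ∈ X.toSubmodule, p x = x := fun x hx => Submodule.projection_apply_of_mem_left hc hx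
  have hr : ∀ x ∈ Y.toSubmodule, p x = 0 := fun x hx => (Submodule.projection_apply_eq_zero_iff hc).2 hx
  refine ⟨{ toLinearMap := p
            isIntertwining' := fun g => by
              ext v
              have hv : v ∈ X.toSubmodule ⊔ Y.toSubmodule := by rw [hc.sup_eq_top]; trivial
              obtain ⟨x, hx, y, hy, rfl⟩ := Submodule.mem_sup.1 hv
              simp only [LinearMap.comp_apply, map_add]
              rw [hl _ hx, hl _ (X.apply_mem_toSubmodule g hx), hr _ hy, hr _ (Y.apply_mem_toSubmodule g hy), map_zero] }, 
          hl, fun v => Submodule.projection_apply_mem hc v⟩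

theorem norm_irr [Fintype H] (ρ : Representation ℂ H V) (h : ip ρ.character ρ.character = Fintype.card H) : 
    ρ.IsIrreducible := by
  have hc : (Fintype.card H : ℂ) ≠ 0 := by exact_mod_cast Fintype.card_ne_zero
  have h1 : finrank ℂ (Representation.IntertwiningMap ρ ρ) = 1 := by
    rw [ip_eq] at h
    exact_mod_cast (mul_eq_left₀ hc).1 h
  have hsm := Representation.IntertwiningMap.toLinearMap_injective (ρ := ρ) (σ := ρ)
  have hnt : Nontrivial V := by
    by_contra hcon
    rw [not_nontrivial_iff_subsingleton] at hcon
    have : Subsingleton (Representation.IntertwiningMap ρ ρ) := ⟨fun f g => hsm (by ext x; exact Subsingleton.elim _ _)⟩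
    rw [finrank_zero_of_subsingleton] at h1
    exact zero_ne_one h1
  have hid : Representation.IntertwiningMap.id ρ ≠ 0 := by
    intro h0
    obtain ⟨v, hv⟩ := exists_ne (0 : V)
    exact hv (congrArg (fun f : Representation.IntertwiningMap ρ ρ => f v) h0)
  have hall := (finrank_eq_one_iff_of_nonzero' _ hid).1 h1
  refine { exists_pair_ne := ⟨⊥, ⊤, ?_⟩, eq_bot_or_eq_top := ?_ }
  · intro h
    have := congrArg Subrepresentation.toSubmodule h
    exact bot_ne_top this
  · intro X
    obtain ⟨P, hl, hm⟩ := exists_proj ρ X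
    obtain ⟨a, ha⟩ := hall P
    have hP : ∀ v, P v = a • v := fun v => 
      (congrArg (fun f : Representation.IntertwiningMap ρ ρ => f v) ha).symm
    by_cases ha0 : a = 0
    · left
      apply Subrepresentation.toSubmodule_injective
      change X.toSubmodule = ⊥
      rw [eq_bot_iff]
      intro x hx
      have := hP x
      rw [hl x hx, ha0, zero_smul] at this
      exact this
    · right
      apply Subrepresentation.toSubmodule_injective
      change X.toSubmodule = ⊤
      rw [eq_top_iff]
      intro x _
      have h2 : a • x ∈ X.toSubmodule := by rw [← hP x]; exact hm x
      exact (Submodule.smul_mem_iff _ ha0).1 h2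

/-- irreducible representation with given character and degree -/
structure IR (H : Type) [Group H] (χ : H → ℂ) (d : ℕ) where
  V : Type
  acg : AddCommGroup V
  mod : Module ℂ V
  fd : FiniteDimensional ℂ V
  ρ : Representation ℂ H V
  irr : ρ.IsIrreducible
  ch : ρ.character = χ
  dim : finrank ℂ V = d

attribute [instance] IR.acg IR.mod IR.fd

theorem ir_of [Fintype H] {χ : H → ℂ} {d : ℕ} (h : IsIrrCharDeg H χ d) : Nonempty (IR H χ d) := by
  obtain ⟨V, hV, hχ, hd⟩ := h
  have h1 := (FDRep.simple_iff_char_is_norm_one (V := V)).1 hV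
  rw [Nat.card_eq_fintype_card] at h1
  exact ⟨⟨V, inferInstance, inferInstance, inferInstance, V.ρ, norm_irr V.ρ h1, hχ.symm, hd⟩⟩

theorem of_ir [Fintype H] {χ : H → ℂ} {d : ℕ} (R : IR H χ d) : IsIrrCharDeg H χ d := by
  refine ⟨FDRep.of R.ρ, ?_, R.ch.symm, R.dim⟩
  rw [FDRep.simple_iff_char_is_norm_one, Nat.card_eq_fintype_card]
  exact irr_norm R.ρ R.irr

end CT


namespace CT
variable {H V W : Type} [Group H] [AddCommGroup V] [Module ℂ V] [FiniteDimensional ℂ V]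
  [AddCommGroup W] [Module ℂ W] [FiniteDimensional ℂ W]

theorem irr_sub {ρ : Representation ℂ H V} (h : ρ.IsIrreducible) (U : Submodule ℂ V) 
    (hU : ∀ g, ∀ u ∈ U, ρ g u ∈ U) : U = ⊥ ∨ U = ⊤ := by
  rcases h.eq_bot_or_eq_top ⟨U, fun g v hv => hU g v hv⟩ with h | h
  · left; exact congrArg Subrepresentation.toSubmodule h
  · right; exact congrArg Subrepresentation.toSubmodule h

theorem irr_of_sub [Nontrivial V] {ρ : Representation ℂ H V} (h : ∀ U : Submodule ℂ V,
    (∀ g, ∀ u ∈ U, ρ g u ∈ U) → U = ⊥ ∨ U = ⊤) : ρ.IsIrreducible := by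
  refine { exists_pair_ne := ⟨⊥, ⊤, ?_⟩, eq_bot_or_eq_top := ?_ }
  · intro h
    have := congrArg Subrepresentation.toSubmodule h
    exact bot_ne_top this
  · intro X
    rcases h X.toSubmodule (fun g u hu => X.apply_mem_toSubmodule g hu) with h | h
    · left; exact Subrepresentation.toSubmodule_injective h
    · right; exact Subrepresentation.toSubmodule_injective h

theorem irr_nt {ρ : Representation ℂ H V} (h : ρ.IsIrreducible) : Nontrivial V := by
  by_contra hcon
  rw [not_nontrivial_iff_subsingleton] at hcon
  obtain ⟨a, b, hab⟩ := h.exists_pair_ne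
  exact hab (Subrepresentation.toSubmodule_injective (Subsingleton.elim _ _))

theorem exists_compl [Fintype H] (ρ : Representation ℂ H V) (U : Submodule ℂ V) 
    (hU : ∀ g, ∀ u ∈ U, ρ g u ∈ U) : ∃ U' : Submodule ℂ V, (∀ g, ∀ u ∈ U', ρ g u ∈ U') ∧ IsCompl U U' := by
  obtain ⟨Y, hXY⟩ := exists_isCompl (⟨U, fun g v hv => hU g v hv⟩ : Subrepresentation ρ)
  refine ⟨Y.toSubmodule, fun g u hu => Y.apply_mem_toSubmodule g hu, ?_, ?_⟩
  · rw [disjoint_iff]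
    exact congrArg Subrepresentation.toSubmodule hXY.inf_eq_bot
  · rw [codisjoint_iff]
    exact congrArg Subrepresentation.toSubmodule hXY.sup_eq_top

/-- in a reducible 3-dimensional representation there is an invariant line -/
theorem exists_line [Fintype H] (ρ : Representation ℂ H V) (hd : finrank ℂ V = 3) (h : ¬ ρ.IsIrreducible) :
    ∃ U : Submodule ℂ V, (∀ g, ∀ u ∈ U, ρ g u ∈ U) ∧ finrank ℂ U = 1 := by
  have : Nontrivial V := Module.nontrivial_of_finrank_pos (R := ℂ) (by omega)
  by_contra hcon
  push Not at hcon
  refine h (irr_of_sub fun U hU => ?_)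
  by_contra hU2
  push Not at hU2
  obtain ⟨U', hU', hc⟩ := exists_compl ρ U hU
  have h1 := Submodule.finrank_add_eq_of_isCompl hc
  have h2 := hcon U hU
  have h3 := hcon U' hU'
  have h4 : finrank ℂ U ≠ 0 := fun h0 => hU2.1 (Submodule.finrank_eq_zero.1 h0)
  have h5 : finrank ℂ U ≠ 3 := fun h0 => hU2.2 (Submodule.eq_top_of_finrank_eq (h0.trans hd.symm))
  omega

theorem line_comm (U : Submodule ℂ V) (h : finrank ℂ U = 1) (f g : Module.End ℂ U) : f * g = g * f := by
  obtain ⟨v, hv, hall⟩ := finrank_eq_one_iff'.1 h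
  obtain ⟨a, ha⟩ := hall (f v)
  obtain ⟨b, hb⟩ := hall (g v)
  ext w
  obtain ⟨c, rfl⟩ := hall w
  simp only [Module.End.mul_apply, map_smul, ← ha, ← hb]
  rw [smul_comm a b]

theorem line_fix (ρ : Representation ℂ H V) (hp : commutator H = ⊤) (U : Submodule ℂ V)
    (hU : ∀ g, ∀ u ∈ U, ρ g u ∈ U) (h : finrank ℂ U = 1) (g : H) (u : V) (hu : u ∈ U) : ρ g u = u := by
  let X : Subrepresentation ρ := ⟨U, fun g v hv => hU g v hv⟩
  have h1 := Setup.perf_comm hp (MonoidHom.toHomUnits X.toRepresentation) 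
    (fun x y => Units.ext (line_comm U h _ _)) g
  have h2 : X.toRepresentation g = 1 := congrArg Units.val h1
  exact congrArg Subtype.val (congrArg (fun f : Module.End ℂ U => f ⟨u, hu⟩) h2)

end CT


namespace CT
variable {H V W : Type} [Group H] [AddCommGroup V] [Module ℂ V] [FiniteDimensional ℂ V]
  [AddCommGroup W] [Module ℂ W] [FiniteDimensional ℂ W]

theorem perf_of_min {G : Type} [Group G] (N : Subgroup G) [N.Normal] 
    (hmin : ∀ M : Subgroup G, M.Normal → M ≤ N → M ≠ ⊥ → M = N)
    (hnab : ¬ ∀ x y : N, x * y = y * x) : commutator N = ⊤ := by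
  have h1 : ⁅N, N⁆ = N := by
    refine hmin _ inferInstance (Subgroup.commutator_le_left _ _) fun h => hnab fun x y => ?_
    have h2 := Subgroup.commutator_mem_commutator x.2 y.2
    rw [h, Subgroup.mem_bot, commutatorElement_eq_one_iff_mul_comm] at h2
    exact Subtype.ext h2
  apply Subgroup.map_injective N.subtype_injective
  rw [commutator_def, Subgroup.map_commutator, ← MonoidHom.range_eq_map, Subgroup.range_subtype, h1]

theorem N_triv {G : Type} [Group G] [Fintype G] (N : Subgroup G) [N.Normal] (hbot : N ≠ ⊥)
    (hmin : ∀ M : Subgroup G, M.Normal → M ≤ N → M ≠ ⊥ → M = N)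
    (hnab : ¬ ∀ x y : ↥N, x * y = y * x)
    (hnofactor : ¬ ∃ H K : Subgroup ↥N, H.Normal ∧ K.Normal ∧ Disjoint H K ∧ H ⊔ K = ⊤ ∧
      (Nonempty (↥H ≃* ↥(alternatingGroup (Fin 5))) ∨ Nonempty (↥H ≃* PSL27)))
    (ρ : Representation ℂ G V) (hi : ρ.IsIrreducible) (hd : finrank ℂ V = 3) (n : N) : ρ n = 1 := by
  classical
  by_contra hn
  have hp := perf_of_min N hmin hnab
  have hinv : ∀ g v, ρ g⁻¹ (ρ g v) = v := fun g v => by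
    rw [← Module.End.mul_apply, ← map_mul, inv_mul_cancel, map_one]; rfl
  have hinv' : ∀ g v, ρ g (ρ g⁻¹ v) = v := fun g v => by simp
  -- scalar subgroup
  let S : Subgroup G := 
    { carrier := {g | g ∈ N ∧ ∃ c : ℂ, ∀ v, ρ g v = c • v}
      one_mem' := ⟨N.one_mem, 1, fun v => by simp⟩
      mul_mem' := by
        rintro a b ⟨ha, c, hc⟩ ⟨hb, d, hd⟩
        exact ⟨N.mul_mem ha hb, c * d, fun v => by rw [map_mul, Module.End.mul_apply, hd, map_smul, hc, smul_smul, mul_comm]⟩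
      inv_mem' := by
        rintro a ⟨ha, c, hc⟩
        refine ⟨N.inv_mem ha, c⁻¹, fun v => ?_⟩
        have h1 := hinv' a v
        rw [hc] at h1
        have hc0 : v ≠ 0 → c ≠ 0 := by rintro h rfl; rw [zero_smul] at h1; exact h h1.symm
        by_cases hv : v = 0
        · simp [hv]
        · rw [eq_inv_smul_iff₀ (hc0 hv), h1] }
  have hS : S.Normal := ⟨by
    rintro a ⟨ha, c, hc⟩ g
    refine ⟨Subgroup.Normal.conj_mem inferInstance a ha g, c, fun v => ?_⟩
    rw [map_mul, map_mul, Module.End.mul_apply, Module.End.mul_apply, hc, map_smul, hinv']⟩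
  have hS1 : S = ⊥ := by
    by_contra hne
    have h1 := hmin S hS (fun g hg => hg.1) hne
    have hsc : ∀ x : N, ∃ c : ℂ, ∀ v, ρ x v = c • v := fun x => by
      have h2 : (x : G) ∈ S := by rw [h1]; exact x.2
      exact h2.2
    have h3 := Setup.perf_comm hp (MonoidHom.toHomUnits (ρ.comp N.subtype)) (fun x y => Units.ext (by
      obtain ⟨c, hc⟩ := hsc x
      obtain ⟨d, hd⟩ := hsc y
      ext v
      change ρ x (ρ y v) = ρ y (ρ x v)
      rw [hc, hd, hc, hd, smul_comm])) n
    exact hn (congrArg Units.val h3)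
  obtain ⟨c, hc⟩ := exists_core ρ
  let _ : NormedAddCommGroup V := c.toNormedAddCommGroup
  let _ : InnerProductSpace ℂ V := InnerProductSpace.ofCore c.toCore
  have hirr : Representation.IsIrreducible (ρ.comp N.subtype : Representation ℂ N V) := by
    by_contra hcon
    obtain ⟨U, hU, hU1⟩ := exists_line (ρ.comp N.subtype : Representation ℂ N V) hd hcon
    have hfix : ∀ x : N, ∀ u ∈ U, ρ x u = u := fun x u hu => line_fix _ hp U hU hU1 x u hu
    let F : Submodule ℂ V := 
      { carrier := {v | ∀ x : N, ρ x v = v}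
        add_mem' := fun {a b} ha hb x => by rw [map_add, ha, hb]
        zero_mem' := fun x => map_zero _
        smul_mem' := fun c v hv x => by rw [map_smul, hv] }
    have hUF : U ≤ F := fun u hu x => hfix x u hu
    rcases irr_sub hi F (fun g u hu x => by
      have h1 := hu ⟨g⁻¹ * x * g, by simpa using Subgroup.Normal.conj_mem (inferInstance : N.Normal) x x.2 g⁻¹⟩
      have h2 : ρ (g⁻¹ * x * g) u = u := h1
      rw [map_mul, map_mul, Module.End.mul_apply, Module.End.mul_apply] at h2
      have h3 := congrArg (ρ g) h2
      rwa [hinv'] at h3) with h | h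
    · rw [h, le_bot_iff] at hUF
      rw [hUF] at hU1
      simp at hU1
    · apply hn
      ext v
      have : v ∈ F := by rw [h]; trivial
      exact this n
  have L : Lin (ρ.comp N.subtype) := 
    { perf := hp
      iso := fun g v w => hc g v w
      dim := hd
      irr := fun U hU h => (irr_sub hirr U hU).resolve_left h
      scal := fun g c h => by
        have : (g : G) ∈ S := ⟨g.2, c, h⟩
        rw [hS1, Subgroup.mem_bot] at this
        exact Subtype.ext this }
  have hnt : Nontrivial N := (Subgroup.nontrivial_iff_ne_bot N).2 hbot
  refine hnofactor ⟨⊤, ⊥, inferInstance, inferInstance, disjoint_bot_right, by simp, ?_⟩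
  rcases L.classify hnt with ⟨⟨e⟩⟩ | ⟨⟨e⟩⟩
  · exact Or.inl ⟨Subgroup.topEquiv.trans e⟩
  · exact Or.inr ⟨Subgroup.topEquiv.trans e⟩

/-- finiteness of the set of irreducible characters -/
theorem irr_fin {G : Type} [Group G] [Fintype G] (d : ℕ) : {χ : G → ℂ | IsIrrCharDeg G χ d}.Finite := by
  have hli : LinearIndependent ℂ (Subtype.val : {χ : G → ℂ | IsIrrCharDeg G χ d} → (G → ℂ)) := by
    rw [linearIndependent_iff']
    intro s a h i hi
    obtain ⟨R⟩ := ir_of i.2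
    have h1 : ∑ j ∈ s, a j * ip (j : G → ℂ) i = 0 := by
      have h2 : ∑ g, (∑ j ∈ s, a j • (j : G → ℂ)) g * (i : G → ℂ) g⁻¹ = 0 := by rw [h]; simp
      rw [← h2]
      unfold ip
      simp only [Finset.sum_apply, Pi.smul_apply, smul_eq_mul, Finset.sum_mul, Finset.mul_sum]
      rw [Finset.sum_comm]
      simp only [mul_assoc]
    rw [Finset.sum_eq_single i] at h1
    · have h3 := irr_norm R.ρ R.irr
      rw [R.ch] at h3
      rw [h3] at h1
      exact (mul_eq_zero.1 h1).resolve_right (by exact_mod_cast Fintype.card_ne_zero)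
    · intro j _ hj
      obtain ⟨R'⟩ := ir_of j.2
      have h3 := irr_orth R.ρ R'.ρ R.irr R'.irr (by rw [R.ch, R'.ch]; exact fun h => hj (Subtype.ext h))
      rw [R.ch, R'.ch] at h3
      rw [h3, mul_zero]
    · exact fun h => absurd hi h
  have := hli.finite
  exact Set.toFinite _
end CT


namespace CT
variable {H V W : Type} [Group H] [AddCommGroup V] [Module ℂ V] [FiniteDimensional ℂ V]
  [AddCommGroup W] [Module ℂ W] [FiniteDimensional ℂ W]

theorem tr_basis {ι : Type} [Fintype ι] [DecidableEq ι] (b : Basis ι ℂ V) (f : Module.End ℂ V) : 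
    LinearMap.trace ℂ V f = ∑ i, b.coord i (f (b i)) := by
  rw [LinearMap.trace_eq_matrix_trace ℂ b, Matrix.trace]
  exact Finset.sum_congr rfl fun i _ => by rw [Matrix.diag_apply, LinearMap.toMatrix_apply]; rfl

/-- averaging a linear map -/
def avg [Fintype H] (R : Representation ℂ H V) (R' : Representation ℂ H W) (X : W →ₗ[ℂ] V) : 
    Representation.IntertwiningMap R' R where
  toLinearMap := ∑ n, R n ∘ₗ X ∘ₗ R' n⁻¹
  isIntertwining' := fun g => by
    ext w
    simp only [LinearMap.comp_apply, LinearMap.sum_apply, map_sum]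
    refine Fintype.sum_equiv (Equiv.mulLeft g⁻¹) _ _ (fun x => ?_)
    rw [Equiv.coe_mulLeft, ← Module.End.mul_apply (R g), ← map_mul, mul_inv_cancel_left, mul_inv_rev, inv_inv, map_mul]
    rfl

theorem avg_apply [Fintype H] (R : Representation ℂ H V) (R' : Representation ℂ H W) (X : W →ₗ[ℂ] V) (w : W) :
    avg R R' X w = ∑ n, R n (X (R' n⁻¹ w)) := by
  change (∑ n, R n ∘ₗ X ∘ₗ R' n⁻¹ : W →ₗ[ℂ] V) w = _
  rw [LinearMap.sum_apply]; rfl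

theorem schur_expand [Fintype H] (R : Representation ℂ H V) (R' : Representation ℂ H W) 
    (A : Module.End ℂ V) (B : Module.End ℂ W) {ι κ : Type} [Fintype ι] [DecidableEq ι] [Fintype κ] [DecidableEq κ]
    (b : Basis ι ℂ V) (b' : Basis κ ℂ W) : 
    ∑ n, LinearMap.trace ℂ V (R n * A) * LinearMap.trace ℂ W (R' n⁻¹ * B) 
      = ∑ i, ∑ j, b.coord i (avg R R' ((b'.coord j).smulRight (A (b i))) (B (b' j))) := by
  simp only [tr_basis b, tr_basis b', Finset.sum_mul_sum, avg_apply, map_sum, LinearMap.smulRight_apply, map_smul,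
    Module.End.mul_apply]
  rw [Finset.sum_comm]
  refine Finset.sum_congr rfl fun i _ => ?_
  rw [Finset.sum_comm]
  refine Finset.sum_congr rfl fun j _ => Finset.sum_congr rfl fun n _ => ?_
  rw [smul_eq_mul, mul_comm]

theorem schur_sum0 [Fintype H] (R : Representation ℂ H V) (R' : Representation ℂ H W) (hR : R.IsIrreducible)
    (hR' : R'.IsIrreducible) (hne : R.character ≠ R'.character) (A : Module.End ℂ V) (B : Module.End ℂ W) :
    ∑ n, LinearMap.trace ℂ V (R n * A) * LinearMap.trace ℂ W (R' n⁻¹ * B) = 0 := by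
  classical
  have : IsEmpty (Representation.Equiv R' R) := ⟨fun e => hne (Representation.char_iso e).symm⟩
  rw [schur_expand R R' A B (Module.finBasis ℂ V) (Module.finBasis ℂ W)]
  refine Finset.sum_eq_zero fun i _ => Finset.sum_eq_zero fun j _ => ?_
  rw [Subsingleton.elim (avg R R' _) 0]
  exact map_zero _

theorem avg_self [Fintype H] (R : Representation ℂ H V) (hR : R.IsIrreducible) (X : Module.End ℂ V) (v : V) :
    (finrank ℂ V : ℂ) • avg R R X v = (Fintype.card H * LinearMap.trace ℂ V X) • v := by
  obtain ⟨c, hc⟩ := (Representation.IsIrreducible.algebraMap_intertwiningMap_bijective_of_isAlgClosed (ρ := R)).2 (avg R R X)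
  have h1 : ∀ v, avg R R X v = c • v := fun v => by rw [← hc]; rfl
  have h2 : LinearMap.trace ℂ V (avg R R X).toLinearMap = Fintype.card H * LinearMap.trace ℂ V X := by
    change LinearMap.trace ℂ V (∑ n, R n ∘ₗ X ∘ₗ R n⁻¹) = _
    rw [map_sum, Finset.sum_congr rfl (g := fun _ => LinearMap.trace ℂ V X)]
    · simp
    · intro n _
      rw [LinearMap.trace_comp_comm', LinearMap.comp_assoc, ← Module.End.mul_eq_comp (R n⁻¹), ← map_mul, inv_mul_cancel, map_one]
      rfl
  have h3 : (avg R R X).toLinearMap = c • LinearMap.id := LinearMap.ext h1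
  rw [h3, map_smul, LinearMap.trace_id, smul_eq_mul] at h2
  rw [h1, smul_smul, ← h2, mul_comm]

theorem schur_sum1 [Fintype H] (R : Representation ℂ H V) (hR : R.IsIrreducible)
    (A B : Module.End ℂ V) :
    (finrank ℂ V : ℂ) * ∑ n, LinearMap.trace ℂ V (R n * A) * LinearMap.trace ℂ V (R n⁻¹ * B) = 
      Fintype.card H * LinearMap.trace ℂ V (A * B) := by
  classical
  let b := Module.finBasis ℂ V
  rw [schur_expand R R A B b b, Finset.mul_sum, tr_basis b, Finset.mul_sum, Finset.sum_congr rfl (fun i _ => Finset.mul_sum _ _ _), 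
    Finset.sum_comm]
  refine Finset.sum_congr rfl fun j _ => ?_
  have h2 : A (B (b j)) = ∑ i, (b.coord i (B (b j))) • A (b i) := by
    conv_lhs => rw [← b.sum_repr (B (b j)), map_sum]
    simp only [map_smul]; rfl
  rw [Module.End.mul_apply, h2, map_sum, Finset.mul_sum]
  refine Finset.sum_congr rfl fun i _ => ?_
  rw [← smul_eq_mul, ← map_smul, avg_self R hR, map_smul, smul_eq_mul, map_smul, smul_eq_mul, LinearMap.trace_smulRight]
  ring
end CT


namespace CT
variable {G V W : Type} [Group G] [AddCommGroup V] [Module ℂ V] [FiniteDimensional ℂ V]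
  [AddCommGroup W] [Module ℂ W] [FiniteDimensional ℂ W] {T : Subgroup G}

theorem cc_mem (g : G) (q : G ⧸ T) : q.out⁻¹ * g * (g⁻¹ • q).out ∈ T := by
  rw [mul_assoc, ← QuotientGroup.eq, QuotientGroup.out_eq', ← smul_eq_mul, ← MulAction.Quotient.smul_mk, 
    QuotientGroup.out_eq', smul_inv_smul]

def cc (g : G) (q : G ⧸ T) : T := ⟨_, cc_mem g q⟩

theorem cc_mul (g h : G) (q : G ⧸ T) : cc (g * h) q = cc g q * cc h (g⁻¹ • q) := by
  apply Subtype.ext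
  change q.out⁻¹ * (g * h) * ((g * h)⁻¹ • q).out = q.out⁻¹ * g * (g⁻¹ • q).out * ((g⁻¹ • q).out⁻¹ * h * (h⁻¹ • g⁻¹ • q).out)
  rw [mul_inv_rev, mul_smul]
  group

theorem cc_one (q : G ⧸ T) : cc 1 q = 1 := by
  apply Subtype.ext
  change q.out⁻¹ * 1 * ((1 : G)⁻¹ • q).out = 1
  simp

/-- induced representation -/
def indr (κ : Representation ℂ T W) : Representation ℂ G (G ⧸ T → W) where
  toFun g := 
    { toFun := fun f q => κ (cc g q) (f (g⁻¹ • q))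
      map_add' := fun f f' => by ext q; simp
      map_smul' := fun c f => by ext q; simp }
  map_one' := by
    ext f q
    simp [cc_one]
  map_mul' g h := by
    apply LinearMap.ext; intro f; ext q
    change κ (cc (g * h) q) (f ((g * h)⁻¹ • q)) = κ (cc g q) (κ (cc h (g⁻¹ • q)) (f (h⁻¹ • g⁻¹ • q)))
    rw [cc_mul, map_mul, mul_inv_rev, mul_smul]; rfl

open Classical in
/-- extension by zero -/
def ext0 (χ : T → ℂ) (g : G) : ℂ := if h : g ∈ T then χ ⟨g, h⟩ else 0

theorem ext0_mem (χ : T → ℂ) (t : T) : ext0 χ (t : G) = χ t := by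
  unfold ext0; rw [dif_pos t.2]

theorem ext0_not (χ : T → ℂ) {g : G} (h : g ∉ T) : ext0 χ g = 0 := by
  unfold ext0; rw [dif_neg h]

theorem ext0_conj (κ : Representation ℂ T W) (t : T) (g : G) : 
    ext0 κ.character ((t : G)⁻¹ * g * t) = ext0 κ.character g := by
  by_cases h : g ∈ T
  · have h1 := ext0_mem κ.character (t⁻¹ * ⟨g, h⟩ * t)
    have h2 := Representation.char_conj κ ⟨g, h⟩ t⁻¹
    rw [inv_inv] at h2
    rw [h2] at h1
    exact h1.trans (ext0_mem _ ⟨g, h⟩).symm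
  · rw [ext0_not _ h, ext0_not]
    intro h1
    apply h
    have h2 := T.mul_mem (T.mul_mem t.2 h1) (T.inv_mem t.2)
    have h3 : (t : G) * ((t : G)⁻¹ * g * t) * (t : G)⁻¹ = g := by group
    rwa [h3] at h2

variable [Fintype G] [Fintype T] [Fintype (G ⧸ T)]

theorem indr_char (κ : Representation ℂ T W) (g : G) : 
    (indr κ).character g = ∑ q : G ⧸ T, ext0 κ.character (q.out⁻¹ * g * q.out) := by
  classical
  let b := Module.finBasis ℂ W
  unfold Representation.character
  rw [tr_basis (Pi.basis fun _ : G ⧸ T => b), Fintype.sum_sigma]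
  refine Finset.sum_congr rfl fun q _ => ?_
  have h1 : ∀ i, (Pi.basis fun _ : G ⧸ T => b).coord ⟨q, i⟩ (indr κ g ((Pi.basis fun _ : G ⧸ T => b) ⟨q, i⟩)) 
      = b.coord i (κ (cc g q) ((Pi.single q (b i) : G ⧸ T → W) (g⁻¹ • q))) := fun i => by
    rw [Pi.basis_apply]
    rfl
  simp only [h1]
  by_cases h : g⁻¹ • q = q
  · have h2 : q.out⁻¹ * g * q.out = (cc g q : T) := by
      change _ = q.out⁻¹ * g * (g⁻¹ • q).out
      rw [h]
    rw [h2, ext0_mem, h]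
    simp only [Pi.single_eq_same]
    exact (tr_basis b _).symm
  · simp only [Pi.single_eq_of_ne h, map_zero, Finset.sum_const_zero]
    rw [ext0_not]
    intro h2
    apply h
    rw [mul_assoc, ← QuotientGroup.eq, QuotientGroup.out_eq', ← smul_eq_mul, ← MulAction.Quotient.smul_mk, 
      QuotientGroup.out_eq'] at h2
    rw [inv_smul_eq_iff]
    exact h2

theorem indr_char' (κ : Representation ℂ T W) (g : G) : 
    Fintype.card T * (indr κ).character g = ∑ x : G, ext0 κ.character (x⁻¹ * g * x) := by
  rw [indr_char, Finset.mul_sum, Fintype.sum_equiv Subgroup.groupEquivQuotientProdSubgroup 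
    (fun x => ext0 κ.character (x⁻¹ * g * x)) (fun p : (G ⧸ T) × T => ext0 κ.character (p.1.out⁻¹ * g * p.1.out)), Fintype.sum_prod_type]
  · simp
  · intro x
    have h : ((x : G ⧸ T).out)⁻¹ * x ∈ T := by rw [← QuotientGroup.eq, QuotientGroup.out_eq']
    have h1 := ext0_conj κ ⟨_, h⟩ (((x : G ⧸ T).out)⁻¹ * g * (x : G ⧸ T).out)
    change _ = ext0 κ.character (((x : G ⧸ T).out)⁻¹ * g * (x : G ⧸ T).out)
    rw [← h1]
    congr 1
    simp only
    group

theorem ext0_sum (χ : T → ℂ) (f : G → ℂ) : ∑ g, ext0 χ g * f g = ∑ t : T, χ t * f t := by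
  refine (Fintype.sum_of_injective Subtype.val Subtype.val_injective _ _ (fun g hg => ?_) (fun t => ?_)).symm
  · rw [ext0_not, zero_mul]
    intro h
    exact hg ⟨⟨g, h⟩, rfl⟩
  · rw [ext0_mem]

/-- Frobenius reciprocity -/
theorem frob (κ : Representation ℂ T W) (η : Representation ℂ G V) : 
    Fintype.card T * ip (indr κ).character η.character = 
      Fintype.card G * ip κ.character (fun t : T => η.character t) := by
  unfold ip
  rw [Finset.mul_sum]
  simp only [← mul_assoc, indr_char', Finset.sum_mul]
  rw [Finset.sum_comm, Finset.sum_congr rfl (g := fun _ => ∑ t : T, κ.character t * η.character (t : G)⁻¹)]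
  · simp
  · intro x _
    rw [← ext0_sum κ.character (fun g => η.character g⁻¹)]
    refine Fintype.sum_equiv (MulAut.conj x⁻¹).toEquiv _ _ (fun g => ?_)
    have : η.character (x⁻¹ * g * x)⁻¹ = η.character g⁻¹ := by
      have := Representation.char_conj η g⁻¹ x⁻¹
      rw [← this]; congr 1; group
    change _ = ext0 κ.character (x⁻¹ * g * x⁻¹⁻¹) * η.character (x⁻¹ * g * x⁻¹⁻¹)⁻¹
    rw [inv_inv, this]

theorem indr_dim : finrank ℂ (G ⧸ T → W) = T.index * finrank ℂ W := by
  rw [Module.finrank_pi_fintype]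
  simp [Subgroup.index]
end CT


namespace CT
variable {G U W W' : Type} [Group G] [AddCommGroup U] [Module ℂ U] [FiniteDimensional ℂ U]
  [AddCommGroup W] [Module ℂ W] [FiniteDimensional ℂ W] [AddCommGroup W'] [Module ℂ W'] [FiniteDimensional ℂ W']
  [Fintype G] {N : Subgroup G} [N.Normal] {ψ : N → ℂ} [Fintype N] [Fintype (charStab N ψ)] 
  [Fintype (G ⧸ charStab N ψ)]

/-- restriction to N -/
abbrev resN (hle : N ≤ charStab N ψ) (M : Representation ℂ (charStab N ψ) U) : Representation ℂ N U :=
  M.comp (Subgroup.inclusion hle)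

theorem sum_avg {T : Subgroup G} [Fintype T] (hle : N ≤ T) (f : T → ℂ) : 
    Fintype.card N * ∑ t, f t = ∑ t, ∑ n : N, f (Subgroup.inclusion hle n * t) := by
  rw [Finset.sum_comm, Finset.sum_congr rfl (g := fun _ : N => ∑ t, f t)]
  · simp
  · exact fun n _ => Fintype.sum_equiv (Equiv.mulLeft (Subgroup.inclusion hle n)) _ _ (fun _ => rfl)

theorem triv_l {T : Subgroup G} (hle : N ≤ T) {L : Representation ℂ T W} 
    (hL : ∀ n, L (Subgroup.inclusion hle n) = 1) (n : N) (t : T) : 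
    L.character (Subgroup.inclusion hle n * t) = L.character t := by
  unfold Representation.character
  rw [map_mul, hL, one_mul]

theorem triv_r {T : Subgroup G} (hle : N ≤ T) {L : Representation ℂ T W} 
    (hL : ∀ n, L (Subgroup.inclusion hle n) = 1) (n : N) (t : T) : 
    L.character (t * Subgroup.inclusion hle n) = L.character t := by
  unfold Representation.character
  rw [map_mul, hL, mul_one]

theorem lemA (hle : N ≤ charStab N ψ) (M : Representation ℂ (charStab N ψ) U) (hMi : (resN hle M).IsIrreducible)
    {L : Representation ℂ (charStab N ψ) W} (hL : ∀ n, L (Subgroup.inclusion hle n) = 1) 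
    {L' : Representation ℂ (charStab N ψ) W'} (hL' : ∀ n, L' (Subgroup.inclusion hle n) = 1) :
    ip (M.tprod L).character (M.tprod L').character = ip L.character L'.character := by
  have hc : (Fintype.card N : ℂ) ≠ 0 := by exact_mod_cast Fintype.card_ne_zero
  have hd : (finrank ℂ U : ℂ) ≠ 0 := by
    have := irr_nt hMi
    exact_mod_cast finrank_pos.ne'
  apply mul_left_cancel₀ hc
  unfold ip
  rw [sum_avg hle, Finset.mul_sum]
  refine Finset.sum_congr rfl fun t _ => ?_
  have h1 := schur_sum1 (resN hle M) hMi (M t) (M t⁻¹)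
  rw [← map_mul, mul_inv_cancel, map_one, LinearMap.trace_one, mul_comm (Fintype.card N : ℂ)] at h1
  have h2 := mul_left_cancel₀ hd h1
  rw [← h2, Finset.sum_mul]
  refine Finset.sum_congr rfl fun n _ => ?_
  have e1 : (Subgroup.inclusion hle n * t)⁻¹ = t⁻¹ * Subgroup.inclusion hle n⁻¹ := by rw [mul_inv_rev, map_inv]
  rw [Representation.char_tensor, Representation.char_tensor, Pi.mul_apply, Pi.mul_apply, e1, triv_l hle hL, triv_r hle hL', 
    Representation.char_mul_comm M _ t⁻¹]
  unfold Representation.character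
  rw [map_mul M, map_mul M]
  change LinearMap.trace ℂ U (M _ * M t) * _ * (LinearMap.trace ℂ U (M _ * M t⁻¹) * _) = 
    LinearMap.trace ℂ U (M _ * M t) * LinearMap.trace ℂ U (M _ * M t⁻¹) * _
  ring

theorem lemB (hle : N ≤ charStab N ψ) (M : Representation ℂ (charStab N ψ) U) (hMi : (resN hle M).IsIrreducible)
    (hM : (resN hle M).character = ψ)
    {L : Representation ℂ (charStab N ψ) W} (hL : ∀ n, L (Subgroup.inclusion hle n) = 1) 
    {L' : Representation ℂ (charStab N ψ) W'} (hL' : ∀ n, L' (Subgroup.inclusion hle n) = 1) (x : G) (hx : x ∉ charStab N ψ) :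
    ∑ t : charStab N ψ, (M.tprod L).character t * ext0 (M.tprod L').character (x⁻¹ * (t : G)⁻¹ * x) = 0 := by
  have hc : (Fintype.card N : ℂ) ≠ 0 := by exact_mod_cast Fintype.card_ne_zero
  apply (mul_eq_zero.1 _).resolve_left hc
  rw [sum_avg hle]
  refine Finset.sum_eq_zero fun t _ => ?_
  let φ : N →* N := (MulAut.conjNormal x⁻¹ : MulAut N).toMonoidHom
  have hφ : ∀ n, (φ n : G) = x⁻¹ * n * x := fun n => by
    have := MulAut.conjNormal_apply x⁻¹ n
    rw [inv_inv] at this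
    exact this
  have e1 : ∀ n : N, x⁻¹ * ((Subgroup.inclusion hle n * t : charStab N ψ) : G)⁻¹ * x = 
      (x⁻¹ * (t : G)⁻¹ * x) * (Subgroup.inclusion hle (φ n⁻¹) : charStab N ψ) := fun n => by
    rw [Subgroup.coe_inclusion, hφ, Subgroup.coe_mul, Subgroup.coe_inclusion, Subgroup.coe_inv]
    group
  by_cases ht : x⁻¹ * (t : G)⁻¹ * x ∈ charStab N ψ
  · let R' : Representation ℂ N U := (resN hle M).comp φ
    have hnt := irr_nt hMi
    have hR' : R'.IsIrreducible := irr_of_sub fun X hX => irr_sub hMi X fun g u hu => by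
      obtain ⟨g', rfl⟩ := (MulAut.conjNormal x⁻¹ : MulAut N).surjective g
      exact hX g' u hu
    have hne : (resN hle M).character ≠ R'.character := by
      intro he
      apply hx
      rw [← inv_mem_iff]
      intro n
      have h1 := congrFun he n
      rw [hM] at h1
      rw [h1, ← hM]
      rfl
    have h2 := schur_sum0 (resN hle M) R' hMi hR' hne (M t) (M ⟨_, ht⟩)
    rw [← mul_zero (L.character t * L'.character ⟨_, ht⟩), ← h2, Finset.mul_sum]
    refine Finset.sum_congr rfl fun n _ => ?_
    have e2 : x⁻¹ * ((Subgroup.inclusion hle n * t : charStab N ψ) : G)⁻¹ * x = 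
      ((⟨_, ht⟩ * Subgroup.inclusion hle (φ n⁻¹) : charStab N ψ) : G) := e1 n
    rw [e2, ext0_mem, Representation.char_tensor, Representation.char_tensor, Pi.mul_apply, Pi.mul_apply, triv_l hle hL, triv_r hle hL', 
      Representation.char_mul_comm M _ ⟨_, ht⟩]
    unfold Representation.character
    rw [map_mul M, map_mul M]
    change LinearMap.trace ℂ U (M _ * M t) * _ * (LinearMap.trace ℂ U (M _ * M ⟨_, ht⟩) * _) = _ * (
      LinearMap.trace ℂ U (M _ * M t) * LinearMap.trace ℂ U (M _ * M ⟨_, ht⟩))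
    ring
  · refine Finset.sum_eq_zero fun n _ => ?_
    rw [e1, ext0_not, mul_zero]
    intro h
    exact ht ((Subgroup.mul_mem_cancel_right _ (Subtype.prop _)).1 h)

theorem clifford (hle : N ≤ charStab N ψ) (M : Representation ℂ (charStab N ψ) U) (hMi : (resN hle M).IsIrreducible)
    (hM : (resN hle M).character = ψ)
    {L : Representation ℂ (charStab N ψ) W} (hL : ∀ n, L (Subgroup.inclusion hle n) = 1) 
    {L' : Representation ℂ (charStab N ψ) W'} (hL' : ∀ n, L' (Subgroup.inclusion hle n) = 1) :
    Fintype.card (charStab N ψ) * ip (indr (M.tprod L)).character (indr (M.tprod L')).character = 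
      Fintype.card G * ip L.character L'.character := by
  have hc : (Fintype.card (charStab N ψ) : ℂ) ≠ 0 := by exact_mod_cast Fintype.card_ne_zero
  rw [frob]
  congr 1
  apply mul_left_cancel₀ hc
  have h1 : ∀ x : G, ∑ t : charStab N ψ, (M.tprod L).character t * ext0 (M.tprod L').character (x⁻¹ * (t : G)⁻¹ * x) = 
      ext0 (fun _ => ip L.character L'.character) x * 1 := fun x => by
    by_cases hx : x ∈ charStab N ψ
    · have := ext0_mem (fun _ => ip L.character L'.character) (⟨x, hx⟩ : charStab N ψ)
      rw [this, mul_one, ← lemA hle M hMi hL hL']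
      refine Finset.sum_congr rfl fun t _ => ?_
      have h2 := ext0_conj (M.tprod L') ⟨x, hx⟩ (t : G)⁻¹
      exact congrArg _ (h2.trans (ext0_mem _ t⁻¹))
    · rw [lemB hle M hMi hM hL hL' x hx, ext0_not _ hx, zero_mul]
  have h2 := ext0_sum (fun _ : charStab N ψ => ip L.character L'.character) (fun _ => 1)
  rw [← Finset.sum_congr rfl (fun x _ => h1 x), Finset.sum_comm] at h2
  rw [Finset.sum_const, Finset.card_univ, nsmul_eq_mul, mul_one] at h2
  rw [← h2]
  unfold ip
  rw [Finset.mul_sum]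
  refine Finset.sum_congr rfl fun t _ => ?_
  rw [mul_left_comm, indr_char', Finset.mul_sum]
  rfl
end CT


namespace CT
variable {G V W Y : Type} [Group G] [AddCommGroup V] [Module ℂ V] [FiniteDimensional ℂ V]
  [AddCommGroup W] [Module ℂ W] [FiniteDimensional ℂ W] [AddCommGroup Y] [Module ℂ Y] [FiniteDimensional ℂ Y]
  [Fintype G] 

theorem ip_comm (f f' : G → ℂ) : ip f f' = ip f' f := by
  unfold ip
  refine Fintype.sum_equiv (Equiv.inv G) _ _ (fun g => ?_)
  rw [Equiv.inv_apply, inv_inv, mul_comm]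

/-- class sum operator -/
def csum (χ : Representation ℂ G W) (ρ : Representation ℂ G V) : Representation.IntertwiningMap ρ ρ where
  toLinearMap := ∑ x, χ.character x⁻¹ • ρ x
  isIntertwining' := fun g => by
    ext w
    simp only [LinearMap.comp_apply, LinearMap.sum_apply, map_sum, LinearMap.smul_apply, map_smul]
    refine Fintype.sum_equiv (MulAut.conj g⁻¹).toEquiv _ _ (fun x => ?_)
    change _ = χ.character (g⁻¹ * x * g⁻¹⁻¹)⁻¹ • ρ g (ρ (g⁻¹ * x * g⁻¹⁻¹) w)
    have h1 : χ.character (g⁻¹ * x * g⁻¹⁻¹)⁻¹ = χ.character x⁻¹ := by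
      rw [← Representation.char_conj χ x⁻¹ g⁻¹]; congr 1; group
    rw [h1, ← Module.End.mul_apply, ← map_mul, ← Module.End.mul_apply, ← map_mul]
    congr 3
    group

theorem csum_apply (χ : Representation ℂ G W) (ρ : Representation ℂ G V) (v : V) : 
    csum χ ρ v = ∑ x, χ.character x⁻¹ • ρ x v := by
  change (∑ x, χ.character x⁻¹ • ρ x : Module.End ℂ V) v = _
  rw [LinearMap.sum_apply]; rfl

theorem csum_irr (χ : Representation ℂ G W) (ρ : Representation ℂ G V) (h : ρ.IsIrreducible) (v : V) : 
    (finrank ℂ V : ℂ) • csum χ ρ v = ip ρ.character χ.character • v := by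
  obtain ⟨c, hc⟩ := (Representation.IsIrreducible.algebraMap_intertwiningMap_bijective_of_isAlgClosed (ρ := ρ)).2 (csum χ ρ)
  have h1 : ∀ v, csum χ ρ v = c • v := fun v => by rw [← hc]; rfl
  have h2 : LinearMap.trace ℂ V (csum χ ρ).toLinearMap = ip ρ.character χ.character := by
    change LinearMap.trace ℂ V (∑ x, χ.character x⁻¹ • ρ x) = _
    rw [map_sum]
    refine Finset.sum_congr rfl fun x _ => ?_
    rw [map_smul, smul_eq_mul, mul_comm]
    rfl
  have h3 : (csum χ ρ).toLinearMap = c • LinearMap.id := LinearMap.ext h1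
  rw [h3, map_smul, LinearMap.trace_id, smul_eq_mul] at h2
  rw [h1, smul_smul, ← h2, mul_comm]

theorem csum_map (χ : Representation ℂ G W) (ρ : Representation ℂ G V) (σ : Representation ℂ G Y) 
    (f : Representation.IntertwiningMap ρ σ) (v : V) : csum χ σ (f v) = f (csum χ ρ v) := by
  rw [csum_apply, csum_apply, map_sum]
  refine Finset.sum_congr rfl fun x _ => ?_
  rw [map_smul, f.isIntertwining]

theorem fibre_gen (σ : Representation ℂ G Y) (S : Finset (G → ℂ)) (d : ℕ) (R : ∀ θ : S, IR G θ d) 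
    (h : ∀ θ : S, ip σ.character θ ≠ 0) : S.card * d ≤ finrank ℂ Y := by
  classical
  have h1 : ∀ θ : S, ∃ f : Representation.IntertwiningMap (R θ).ρ σ, Function.Injective f := fun θ => by
    have h2 := ip_eq (R θ).ρ σ
    rw [(R θ).ch] at h2
    have h3 : finrank ℂ (Representation.IntertwiningMap (R θ).ρ σ) ≠ 0 := fun h0 => h θ (by rw [h2, h0]; simp)
    have : Nontrivial (Representation.IntertwiningMap (R θ).ρ σ) := Module.nontrivial_of_finrank_pos (R := ℂ) (Nat.pos_of_ne_zero h3)
    obtain ⟨f, hf⟩ := exists_ne (0 : Representation.IntertwiningMap (R θ).ρ σ)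
    have := (R θ).irr
    exact ⟨f, (Representation.IsIrreducible.injective_or_eq_zero f).resolve_right hf⟩
  choose f hf using h1
  let Φ : (∀ θ : S, (R θ).V) →ₗ[ℂ] Y := ∑ θ, (f θ).toLinearMap ∘ₗ LinearMap.proj θ
  have hΦ : ∀ v, Φ v = ∑ θ, f θ (v θ) := fun v => by
    change (∑ θ, (f θ).toLinearMap ∘ₗ LinearMap.proj θ : (∀ θ : S, (R θ).V) →ₗ[ℂ] Y) v = _
    rw [LinearMap.sum_apply]; rfl
  have hinj : Function.Injective Φ := by
    rw [injective_iff_map_eq_zero]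
    intro v hv
    rw [hΦ] at hv
    funext i
    have h2 : ∑ θ, f θ (csum (R i).ρ (R θ).ρ (v θ)) = 0 := by
      have h3 := congrArg (csum (R i).ρ σ) hv
      rw [map_sum, map_zero] at h3
      rw [← h3]
      exact Finset.sum_congr rfl fun θ _ => (csum_map _ _ _ _ _).symm
    have h4 : ∑ θ, (d : ℂ) • f θ (csum (R i).ρ (R θ).ρ (v θ)) = 0 := by rw [← Finset.smul_sum, h2, smul_zero]
    have h5 : ∀ θ : S, (d : ℂ) • f θ (csum (R i).ρ (R θ).ρ (v θ)) = ip (θ : G → ℂ) i • f θ (v θ) := fun θ => by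
      have h6 := csum_irr (R i).ρ (R θ).ρ (R θ).irr (v θ)
      rw [(R θ).dim, (R θ).ch, (R i).ch] at h6
      exact (map_smul (f θ) _ _).symm.trans ((congrArg (f θ) h6).trans (map_smul _ _ _))
    rw [Finset.sum_congr rfl (fun θ _ => h5 θ), Finset.sum_eq_single i] at h4
    · have h6 := irr_norm (R i).ρ (R i).irr
      rw [(R i).ch] at h6
      rw [h6] at h4
      have h7 := (smul_eq_zero.1 h4).resolve_left (by exact_mod_cast Fintype.card_ne_zero)
      exact hf i (h7.trans (map_zero _).symm)
    · intro j _ hj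
      have h6 := irr_orth (R i).ρ (R j).ρ (R i).irr (R j).irr (by rw [(R i).ch, (R j).ch]; exact fun h => hj (Subtype.ext h))
      rw [(R i).ch, (R j).ch] at h6
      rw [h6, zero_smul]
    · exact fun h => absurd (Finset.mem_univ _) h
  have h8 := LinearMap.finrank_le_finrank_of_injective hinj
  rw [Module.finrank_pi_fintype, Finset.sum_congr rfl (fun θ _ => (R θ).dim)] at h8
  simpa using h8

theorem fibre {T : Subgroup G} [Fintype T] [Fintype (G ⧸ T)] (κ : Representation ℂ T W) (S : Finset (G → ℂ)) (d : ℕ)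
    (hS : ∀ θ ∈ S, IsIrrCharDeg G θ d) (h : ∀ θ ∈ S, ip κ.character (fun t : T => θ t) ≠ 0) : 
    S.card * d ≤ T.index * finrank ℂ W := by
  have R : ∀ θ : S, IR G θ d := fun θ => Classical.choice (ir_of (hS θ θ.2))
  rw [← indr_dim]
  refine fibre_gen (indr κ) S d R fun θ h0 => h θ θ.2 ?_
  have h1 := frob κ (R θ).ρ
  rw [(R θ).ch, h0, mul_zero] at h1
  exact (mul_eq_zero.1 h1.symm).resolve_left (by exact_mod_cast Fintype.card_ne_zero)

theorem exists_const {T : Subgroup G} [Fintype T] {θ : G → ℂ} (R : IR G θ 3) (N : Subgroup G) (hle : N ≤ T) 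
    (hN : ∀ n : N, R.ρ n = 1) : ∃ d l, (d = 3 ∨ (d = 1 ∧ T ≠ ⊤)) ∧ ip l (fun t : T => θ t) ≠ 0 ∧
      ∃ L : IR T l d, ∀ n, L.ρ (Subgroup.inclusion hle n) = 1 := by
  let τ : Representation ℂ T R.V := R.ρ.comp T.subtype
  have hτ : τ.character = fun t : T => θ t := by
    funext t
    exact congrFun R.ch t
  have hc : (Fintype.card T : ℂ) ≠ 0 := by exact_mod_cast Fintype.card_ne_zero
  by_cases hi : τ.IsIrreducible
  · refine ⟨3, τ.character, Or.inl rfl, ?_, ⟨R.V, _, _, inferInstance, τ, hi, rfl, R.dim⟩, fun n => hN n⟩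
    rw [← hτ, irr_norm τ hi]
    exact hc
  · obtain ⟨U, hU, hU1⟩ := exists_line τ R.dim hi
    let X : Subrepresentation τ := ⟨U, fun g v hv => hU g v hv⟩
    have hnt : Nontrivial U := Module.nontrivial_of_finrank_pos (R := ℂ) (by omega)
    have hX : X.toRepresentation.IsIrreducible := by
      refine irr_of_sub (V := U) fun Z _ => ?_
      have h1 := Submodule.finrank_le Z
      rw [hU1] at h1
      rcases Nat.le_one_iff_eq_zero_or_eq_one.1 h1 with h | h
      · exact Or.inl (Submodule.finrank_eq_zero.1 h)
      · exact Or.inr (Submodule.eq_top_of_finrank_eq (h.trans hU1.symm))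
    refine ⟨1, X.toRepresentation.character, Or.inr ⟨rfl, ?_⟩, ?_, ⟨U, _, _, inferInstance, X.toRepresentation, hX, rfl, hU1⟩, fun n => ?_⟩
    · intro hT
      apply hi
      have := irr_nt R.irr
      exact irr_of_sub fun Z hZ => irr_sub R.irr Z fun g u hu => hZ ⟨g, by rw [hT]; trivial⟩ u hu
    · rw [← hτ, ip_comm, ip_eq]
      have : Nontrivial (Representation.IntertwiningMap X.toRepresentation τ) := by
        refine ⟨⟨⟨U.subtype, fun g => rfl⟩, 0, fun h => ?_⟩⟩
        obtain ⟨u, hu⟩ := exists_ne (0 : U)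
        exact hu (Subtype.ext (congrArg (fun f : Representation.IntertwiningMap X.toRepresentation τ => f u) h))
      exact mul_ne_zero hc (by exact_mod_cast finrank_pos.ne')
    · ext u
      exact congrArg (fun f : Module.End ℂ R.V => f u) (hN n)
end CT


namespace CT
variable {G U : Type} [Group G] [AddCommGroup U] [Module ℂ U] [FiniteDimensional ℂ U]
  [Fintype G] {N : Subgroup G} [N.Normal] {ψ : N → ℂ} [Fintype N] [Fintype (charStab N ψ)] 
  [Fintype (G ⧸ charStab N ψ)]

/-- induced character -/
def indc (M : Representation ℂ (charStab N ψ) U) (l : charStab N ψ → ℂ) (g : G) : ℂ :=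
  ∑ q : G ⧸ charStab N ψ, ext0 (M.character * l) (q.out⁻¹ * g * q.out)

theorem indc_eq (M : Representation ℂ (charStab N ψ) U) {l : charStab N ψ → ℂ} {d : ℕ} (L : IR (charStab N ψ) l d) :
    (indr (M.tprod L.ρ)).character = indc M l := by
  funext g
  rw [indr_char, Representation.char_tensor, L.ch]
  rfl

theorem indc_irr (hle : N ≤ charStab N ψ) (M : Representation ℂ (charStab N ψ) U) (hMi : (resN hle M).IsIrreducible)
    (hM : (resN hle M).character = ψ) {l : charStab N ψ → ℂ} {d : ℕ} (L : IR (charStab N ψ) l d) 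
    (hL : ∀ n, L.ρ (Subgroup.inclusion hle n) = 1) : 
    IsIrrCharDeg G (indc M l) (d * (finrank ℂ U * (charStab N ψ).index)) := by
  have hc : (Fintype.card (charStab N ψ) : ℂ) ≠ 0 := by exact_mod_cast Fintype.card_ne_zero
  have h1 := clifford hle M hMi hM hL hL
  rw [irr_norm L.ρ L.irr, mul_comm (Fintype.card G : ℂ)] at h1
  have h2 := mul_left_cancel₀ hc h1
  refine of_ir ⟨_, _, _, inferInstance, indr (M.tprod L.ρ), norm_irr _ h2, indc_eq M L, ?_⟩
  rw [indr_dim, Module.finrank_tensorProduct, L.dim]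
  ring

theorem indc_inj (hle : N ≤ charStab N ψ) (M : Representation ℂ (charStab N ψ) U) (hMi : (resN hle M).IsIrreducible)
    (hM : (resN hle M).character = ψ) {l l' : charStab N ψ → ℂ} {d d' : ℕ} (L : IR (charStab N ψ) l d) 
    (hL : ∀ n, L.ρ (Subgroup.inclusion hle n) = 1) (L' : IR (charStab N ψ) l' d') 
    (hL' : ∀ n, L'.ρ (Subgroup.inclusion hle n) = 1) (h : indc M l = indc M l') : l = l' := by
  by_contra hne
  have hc : (Fintype.card (charStab N ψ) : ℂ) ≠ 0 := by exact_mod_cast Fintype.card_ne_zero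
  have hG : (Fintype.card G : ℂ) ≠ 0 := by exact_mod_cast Fintype.card_ne_zero
  have h1 := clifford hle M hMi hM hL hL'
  rw [irr_orth L'.ρ L.ρ L'.irr L.irr (by rw [L.ch, L'.ch]; exact hne), indc_eq M L, indc_eq M L', ← h, ← indc_eq M L, 
    clifford hle M hMi hM hL hL, irr_norm L.ρ L.irr, mul_zero] at h1
  exact mul_ne_zero hG hc h1

theorem count (hle : N ≤ charStab N ψ) (M : Representation ℂ (charStab N ψ) U) (hMi : (resN hle M).IsIrreducible)
    (hM : (resN hle M).character = ψ) (d : ℕ) (S : Finset (G → ℂ)) (hS : ∀ θ ∈ S, IsIrrCharDeg G θ 3)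
    (l : (G → ℂ) → charStab N ψ → ℂ) (hl : ∀ θ ∈ S, ip (l θ) (fun t => θ t) ≠ 0 ∧ 
      ∃ L : IR (charStab N ψ) (l θ) d, ∀ n, L.ρ (Subgroup.inclusion hle n) = 1) :
    3 * S.card ≤ (charStab N ψ).index * d * nChars G (d * (finrank ℂ U * (charStab N ψ).index)) := by
  classical
  have hfin := irr_fin (G := G) (d * (finrank ℂ U * (charStab N ψ).index))
  have h1 := Finset.card_le_mul_card_image_of_maps_to (s := S) (t := hfin.toFinset) (f := fun θ => indc M (l θ)) 
    (fun θ hθ => by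
      obtain ⟨_, L, hL⟩ := hl θ hθ
      rw [Set.Finite.mem_toFinset]
      exact indc_irr hle M hMi hM L hL) ((charStab N ψ).index * d / 3) (fun b _ => by
      rw [Nat.le_div_iff_mul_le (by norm_num)]
      rcases Finset.eq_empty_or_nonempty {a ∈ S | indc M (l a) = b} with h0 | ⟨θ, hθ⟩
      · rw [h0]; simp
      · obtain ⟨hθ1, hθ2⟩ := Finset.mem_filter.1 hθ
        obtain ⟨_, L, hL⟩ := hl θ hθ1
        have h2 := fibre L.ρ {a ∈ S | indc M (l a) = b} 3 (fun a ha => hS a (Finset.mem_filter.1 ha).1) (fun a ha => by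
          obtain ⟨ha1, ha2⟩ := Finset.mem_filter.1 ha
          obtain ⟨h3, L', hL'⟩ := hl a ha1
          rw [L.ch, indc_inj hle M hMi hM L hL L' hL' (hθ2.trans ha2.symm)]
          exact h3)
        rwa [L.dim] at h2)
  rw [← Set.ncard_eq_toFinset_card _ hfin] at h1
  change _ ≤ _ * nChars G _ at h1
  calc 3 * S.card ≤ 3 * ((charStab N ψ).index * d / 3 * nChars G (d * (finrank ℂ U * (charStab N ψ).index))) := 
        Nat.mul_le_mul_left _ h1
    _ = (3 * ((charStab N ψ).index * d / 3)) * nChars G (d * (finrank ℂ U * (charStab N ψ).index)) := by ring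
    _ ≤ _ := Nat.mul_le_mul_right _ (Nat.mul_div_le _ _)
end CT

/-- Proposition 3.3: if `N` is a nonabelian minimal normal subgroup of `G` with no direct
factor isomorphic to `A₅` or `PSL(2,7)`, and `ψ ∈ Irr(N)` extends to `T := Stab_G(ψ)`, then
with `a := ψ(1)|G:T|` we have `n₃(G) ≤ n_{3a}(G)|G:T| + (1/3)n_a(G)|G:T|`; moreover if
`G = T` then `n₃(G) ≤ n_{3a}(G)`. -/
theorem nChars_three_le_of_extendible
    (G : Type) [Group G] [Finite G]
    (N : Subgroup G) [N.Normal] (hbot : N ≠ ⊥)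
    (hmin : ∀ M : Subgroup G, M.Normal → M ≤ N → M ≠ ⊥ → M = N)
    (hnab : ¬ ∀ x y : ↥N, x * y = y * x)
    (hnofactor : ¬ ∃ H K : Subgroup ↥N, H.Normal ∧ K.Normal ∧ Disjoint H K ∧ H ⊔ K = ⊤ ∧
      (Nonempty (↥H ≃* ↥(alternatingGroup (Fin 5))) ∨ Nonempty (↥H ≃* PSL27)))
    (ψ : ↥N → ℂ) (V : FDRep ℂ ↥N) (hV : Simple V) (hψ : ψ = FDRep.character V)
    (hext : ∃ χ : ↥(charStab N ψ) → ℂ, IsIrrChar ↥(charStab N ψ) χ ∧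
      ExtendsToChar N (charStab N ψ) ψ χ) :
    (nChars G 3 : ℝ) ≤
      nChars G (3 * (finrank ℂ V * (charStab N ψ).index)) * (charStab N ψ).index +
        (1 / 3) * (nChars G (finrank ℂ V * (charStab N ψ).index) * (charStab N ψ).index) ∧
    (charStab N ψ = ⊤ →
      nChars G 3 ≤ nChars G (3 * (finrank ℂ V * (charStab N ψ).index))) := by
  classical
  let _ : Fintype G := Fintype.ofFinite G
  let _ : Fintype N := Fintype.ofFinite N
  let _ : Fintype (charStab N ψ) := Fintype.ofFinite _
  let _ : Fintype (G ⧸ charStab N ψ) := Fintype.ofFinite _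
  obtain ⟨χ, ⟨e, hχ⟩, hle, hex⟩ := hext
  obtain ⟨M⟩ := CT.ir_of hχ
  have hM : (CT.resN hle M.ρ).character = ψ := by
    funext n
    rw [← hex n]
    exact congrFun M.ch _
  have hMi : (CT.resN hle M.ρ).IsIrreducible := by
    apply CT.norm_irr
    have h1 := (FDRep.simple_iff_char_is_norm_one (V := V)).1 hV
    rw [Nat.card_eq_fintype_card] at h1
    rw [hM, hψ]
    exact h1
  have hdim : finrank ℂ M.V = finrank ℂ V := by
    have h1 := Representation.char_one (CT.resN hle M.ρ)
    rw [hM] at h1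
    have h2 := (congrFun hψ 1).symm.trans h1
    rw [FDRep.char_one] at h2
    exact_mod_cast h2.symm
  have hfin := CT.irr_fin (G := G) 3
  have hcn : nChars G 3 = hfin.toFinset.card := Set.ncard_eq_toFinset_card _ hfin
  have key : ∀ θ : G → ℂ, ∃ d l, θ ∈ hfin.toFinset → (d = 3 ∨ (d = 1 ∧ charStab N ψ ≠ ⊤)) ∧ 
      CT.ip l (fun t : charStab N ψ => θ t) ≠ 0 ∧
      ∃ L : CT.IR (charStab N ψ) l d, ∀ n, L.ρ (Subgroup.inclusion hle n) = 1 := fun θ => by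
    by_cases hθ : θ ∈ hfin.toFinset
    · obtain ⟨R⟩ := CT.ir_of (hfin.mem_toFinset.1 hθ)
      obtain ⟨d, l, h⟩ := CT.exists_const R N hle (CT.N_triv N hbot hmin hnab hnofactor R.ρ R.irr R.dim)
      exact ⟨d, l, fun _ => h⟩
    · exact ⟨0, 0, fun h => absurd h hθ⟩
  choose d l hdl using key
  have h3 := CT.count hle M.ρ hMi hM 3 {θ ∈ hfin.toFinset | d θ = 3} 
    (fun θ hθ => hfin.mem_toFinset.1 (Finset.mem_filter.1 hθ).1) l (fun θ hθ => by
      obtain ⟨h1, h2⟩ := Finset.mem_filter.1 hθ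
      have := (hdl θ h1).2
      rwa [h2] at this)
  have h1 := CT.count hle M.ρ hMi hM 1 {θ ∈ hfin.toFinset | ¬ d θ = 3} 
    (fun θ hθ => hfin.mem_toFinset.1 (Finset.mem_filter.1 hθ).1) l (fun θ hθ => by
      obtain ⟨h1, h2⟩ := Finset.mem_filter.1 hθ
      have := hdl θ h1
      rw [(this.1.resolve_left h2).1] at this
      exact this.2)
  have hsum := Finset.card_filter_add_card_filter_not (s := hfin.toFinset) (fun θ => d θ = 3)
  rw [hdim] at h3 h1
  rw [one_mul, mul_one] at h1
  rw [← hcn] at hsum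
  constructor
  · generalize nChars G (3 * (finrank ℂ V * (charStab N ψ).index)) = z at h3 ⊢
    generalize nChars G (finrank ℂ V * (charStab N ψ).index) = y at h1 ⊢
    generalize nChars G 3 = w at hsum ⊢
    generalize Finset.card _ = A at h3 hsum
    generalize Finset.card _ = B at h1 hsum
    generalize (charStab N ψ).index = k at h1 h3 ⊢
    have e1 := (Nat.cast_le (α := ℝ)).2 h1
    have e3 := (Nat.cast_le (α := ℝ)).2 h3
    subst hsum
    push_cast at e1 e3 ⊢
    nlinarith
  · intro hT
    have hem : {θ ∈ hfin.toFinset | ¬ d θ = 3} = ∅ := by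
      rw [Finset.filter_eq_empty_iff]
      intro θ hθ h
      exact ((hdl θ hθ).1.resolve_left h).2 hT
    rw [hem, Finset.card_empty, add_zero] at hsum
    have hidx : (charStab N ψ).index = 1 := by rw [hT, Subgroup.index_top]
    rw [hsum] at h3
    generalize nChars G (3 * (finrank ℂ V * (charStab N ψ).index)) = z at h3 ⊢
    rw [hidx] at h3
    omega
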